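/- Let k be a field, let k̂ = k((t)) be the field of formal Laurent series over k, and let X be a smooth projective connected curve over k̂ with function field K. Then every finite split embedding problem E = (α : G_K → G, f : Γ → G) for K has a proper solution β : G_K → Γ that is regular over k̂, i.e., the algebraic closure of k̂ in the fixed field M of ker β equals the algebraic closure of k̂ in the fixed field L of ker α. -/

import Mathlib

set_option synthInstance.maxHeartbeats 1000000
set_option maxHeartbeats 1000000

open AlgebraicGeometry CategoryTheory

/-- Continuity of a map into a set carrying the discrete topology. -/
def ContinuousToDiscrete {A B : Type*} [TopologicalSpace A] (f : A → B) : Prop :=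
  ∀ s : Set B, IsOpen (f ⁻¹' s)

/-- Data exhibiting `K` as the function field of a smooth projective connected curve over `F`. -/
structure SmoothProjectiveCurveData (F K : Type) [Field F] [Field K] [Algebra F K] : Type 1 where
  X : Scheme
  hInt : IsIntegral X
  f : X ⟶ Spec (CommRingCat.of F)
  smooth : IsSmooth f
  proper : IsProper f
  dim1 : topologicalKrullDim X = 1
  e : letI := hInt; K ≃+* X.functionField
  compat : ∀ a : F,
    letI := hInt
    haveI : Nonempty (⊤ : X.Opens) := ⟨⟨Nonempty.some (by infer_instance : Nonempty X), trivial⟩⟩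
    e (algebraMap F K a) =
      ((Scheme.ΓSpecIso (CommRingCat.of F)).inv ≫ f.appTop ≫ X.germToFunctionField ⊤) a

/-- The absolute Galois group of a field `K`, carrying the Krull topology. -/
abbrev AbsGaloisGroup (K : Type) [Field K] : Type :=
  AlgebraicClosure K ≃ₐ[K] AlgebraicClosure K

/-- A solution `β` of an embedding problem `(α, f)` for `K` is *regular* over a subfield `F`
of `K` if the algebraic closure of `F` in the fixed field `M` of `ker β` coincides with the
algebraic closure of `F` in the fixed field `L` of `ker α` (note `L ⊆ M`). -/
def RegularSolutionOver (F K : Type) [Field F] [Field K] [Algebra F K]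
    {G Γ : Type} [Group G] [Group Γ]
    (α : AbsGaloisGroup K →* G) (β : AbsGaloisGroup K →* Γ) : Prop :=
  ∀ x : AlgebraicClosure K, x ∈ IntermediateField.fixedField β.ker →
    IsAlgebraic F x → x ∈ IntermediateField.fixedField α.ker

/-- `k[[t]]` is a domain (this is an instance in Mathlib; recorded here for emphasis). -/
noncomputable example (k : Type) [Field k] : Field (FractionRing (PowerSeries k)) :=
  inferInstance

section EquivariantFunctions

variable {K E Γ : Type*} [Field K] [Field E] [Algebra K E] [Group Γ]

/-- Functions `Γ → L` which are equivariant for a homomorphism `a : Gal(L/K) → Γ`, viewed as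
functions with values in the overfield `E` of `L`. -/
def equivariantFun (L : IntermediateField K E) (a : (L ≃ₐ[K] L) →* Γ) :
    Subalgebra K (Γ → E) where
  carrier := {w | ∃ u : Γ → L, (∀ γ, w γ = u γ) ∧ ∀ τ γ, τ (u γ) = u (a τ * γ)}
  mul_mem' := by
    rintro w w' ⟨u, hu, hu'⟩ ⟨v, hv, hv'⟩
    exact ⟨u * v, fun γ => by simp [hu, hv], fun τ γ => by simp [hu', hv']⟩
  add_mem' := by
    rintro w w' ⟨u, hu, hu'⟩ ⟨v, hv, hv'⟩
    exact ⟨u + v, fun γ => by simp [hu, hv], fun τ γ => by simp [hu', hv']⟩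
  algebraMap_mem' r := ⟨fun _ => algebraMap K L r, fun γ => rfl, fun τ γ => by simp⟩

theorem equivariantFun_translate {L : IntermediateField K E} {a : (L ≃ₐ[K] L) →* Γ}
    {w : Γ → E} (hw : w ∈ equivariantFun L a) (δ : Γ) :
    (fun γ => w (γ * δ)) ∈ equivariantFun L a := by
  obtain ⟨u, hu, hu'⟩ := hw
  exact ⟨fun γ => u (γ * δ), fun γ => hu _, fun τ γ => by simp [hu', mul_assoc]⟩

theorem span_equivariantFun [Finite Γ] (L : IntermediateField K E) [FiniteDimensional K L]
    (a : (L ≃ₐ[K] L) →* Γ) :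
    Submodule.span E (equivariantFun L a : Set (Γ → E)) = ⊤ := by
  classical
  have := Fintype.ofFinite Γ
  by_contra hne
  obtain ⟨φ, hφ0, hφ⟩ := Submodule.exists_le_ker_of_lt_top _ (lt_top_iff_ne_top.2 hne)
  apply hφ0
  refine LinearMap.pi_ext' fun γ₀ => ?_
  ext
  simp only [LinearMap.coe_comp, Function.comp_apply, LinearMap.coe_single, LinearMap.zero_comp,
    LinearMap.zero_apply]
  have key : ∀ z : L, ∑ σ : L ≃ₐ[K] L, φ (Pi.single (a σ * γ₀) 1) * (σ z : E) = 0 := by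
    intro z
    let u : Γ → L := fun γ => ∑ σ : L ≃ₐ[K] L, if γ = a σ * γ₀ then σ z else 0
    have hu : (fun γ => (u γ : E)) ∈ equivariantFun L a := by
      refine ⟨u, fun γ => rfl, fun τ γ => ?_⟩
      simp only [u, map_sum]
      refine Fintype.sum_equiv (Equiv.mulLeft τ) _ _ fun σ => ?_
      simp only [Equiv.coe_mulLeft, map_mul, mul_assoc, mul_right_inj]
      split_ifs <;> simp
    have h0 : φ (fun γ => (u γ : E)) = 0 := hφ (Submodule.subset_span hu)
    have : (fun γ => (u γ : E)) =
        ∑ σ : L ≃ₐ[K] L, (σ z : E) • (Pi.single (a σ * γ₀) 1 : Γ → E) := by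
      ext γ
      simp only [u, Finset.sum_apply, Pi.smul_apply, Pi.single_apply, smul_eq_mul]
      push_cast
      refine Finset.sum_congr rfl fun σ _ => ?_
      split_ifs <;> simp
    rw [this, map_sum] at h0
    rw [← h0]
    refine Finset.sum_congr rfl fun σ _ => ?_
    rw [map_smul, smul_eq_mul, mul_comm]
  have hli := linearIndependent_monoidHom L E
  have hinj : Function.Injective
      (fun σ : L ≃ₐ[K] L => ((L.val.comp σ.toAlgHom : L →ₐ[K] E) : L →* E)) := by
    intro σ τ h
    ext z
    exact DFunLike.congr_fun h z
  have h2 := Fintype.linearIndependent_iff.1 (hli.comp _ hinj)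
    (fun σ => φ (Pi.single (a σ * γ₀) 1)) (by
      ext z
      simpa using key z) 1
  simpa using h2

theorem equivariantFun_repr_mem [Finite Γ] (L : IntermediateField K E) [FiniteDimensional K L]
    [IsGalois K L] (a : (L ≃ₐ[K] L) →* Γ) (g : Module.Basis Γ E (Γ → E))
    (hg : ∀ γ, g γ ∈ equivariantFun L a) {w : Γ → E} (hw : w ∈ equivariantFun L a) (γ : Γ) :
    g.repr w γ ∈ (algebraMap K E).range := by
  classical
  have := Fintype.ofFinite Γ
  choose u hu hu' using hg
  obtain ⟨v, hv, hv'⟩ := hw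
  have hliE : LinearIndependent L (fun γ => u γ) := by
    rw [Fintype.linearIndependent_iff]
    intro c hc i
    have h2 := Fintype.linearIndependent_iff.1 g.linearIndependent (fun i => (c i : E)) (by
      ext δ
      have := congrArg (fun x : L => (x : E)) (congrFun hc δ)
      simpa [hu] using this) i
    exact_mod_cast h2
  let B := basisOfLinearIndependentOfCardEqFinrank hliE (by simp)
  have hB : ∀ i, B i = u i := fun i => by simp [B]
  set c : Γ → L := fun i => B.repr v i with hc
  have hvc : ∀ δ, v δ = ∑ i, c i * u i δ := fun δ => by
    conv_lhs => rw [← B.sum_repr v]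
    simp [hB, hc]
  have hwc : w = ∑ i, (c i : E) • g i := by
    ext δ
    rw [hv, hvc]
    simp [hu]
  have hrep : ∀ i, g.repr w i = c i := by
    intro i
    rw [hwc, g.repr_sum_self]
  have hfix : ∀ τ : L ≃ₐ[K] L, τ (c γ) = c γ := by
    intro τ
    have h1 : ∑ i, (τ (c i) - c i) • u i = 0 := by
      ext δ
      simp only [Finset.sum_apply, Pi.smul_apply, smul_eq_mul, sub_mul, Finset.sum_sub_distrib,
        Pi.zero_apply, ZeroMemClass.coe_zero]
      have e1 : τ (v ((a τ)⁻¹ * δ)) = v δ := by rw [hv']; simp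
      rw [← hvc, ← e1, hvc, map_sum]
      simp [hu']
    have := Fintype.linearIndependent_iff.1 hliE _ h1 γ
    exact sub_eq_zero.1 this
  rw [hrep]
  obtain ⟨r, hr⟩ := (IsGalois.mem_bot_iff_fixed (c γ)).2 hfix
  exact ⟨r, by rw [← hr]; rfl⟩

theorem coeff_prod_equivariantFun_mem [Fintype Γ] [DecidableEq E] {L : IntermediateField K E}
    [FiniteDimensional K L] [IsGalois K L] {a : (L ≃ₐ[K] L) →* Γ} {w : Γ → E}
    (hw : w ∈ equivariantFun L a) (n : ℕ) :
    (∏ v ∈ Finset.univ.image w, (Polynomial.X - Polynomial.C v)).coeff n ∈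
      (algebraMap K E).range := by
  classical
  obtain ⟨u, hu, hu'⟩ := hw
  have himg : Finset.univ.image w = (Finset.univ.image u).image (algebraMap L E) := by
    rw [Finset.image_image]
    congr 1
    ext γ
    exact hu γ
  set Q : Polynomial L := ∏ v ∈ Finset.univ.image u, (Polynomial.X - Polynomial.C v) with hQ
  have hwQ : ∏ v ∈ Finset.univ.image w, (Polynomial.X - Polynomial.C v) =
      Q.map (algebraMap L E) := by
    rw [himg, Finset.prod_image fun _ _ _ _ h => (algebraMap L E).injective h]
    simp [hQ, Polynomial.map_prod]
  have hfix : ∀ τ : L ≃ₐ[K] L, τ (Q.coeff n) = Q.coeff n := by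
    intro τ
    have : Q.map (τ : L →+* L) = Q := by
      have himg' : Finset.univ.image u = (Finset.univ.image u).image τ := by
        rw [Finset.image_image]
        ext x
        simp only [Finset.mem_image, Finset.mem_univ, true_and, Function.comp_apply, hu']
        exact ⟨fun ⟨γ, h⟩ => ⟨(a τ)⁻¹ * γ, by simpa using h⟩, fun ⟨γ, h⟩ => ⟨_, h⟩⟩
      conv_rhs => rw [hQ, himg', Finset.prod_image fun _ _ _ _ h => τ.injective h]
      simp [hQ, Polynomial.map_prod]
    conv_rhs => rw [← this, Polynomial.coeff_map]
    rfl
  obtain ⟨r, hr⟩ := (IsGalois.mem_bot_iff_fixed (Q.coeff n)).2 hfix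
  rw [hwQ, Polynomial.coeff_map, ← hr]
  exact ⟨r, rfl⟩

end EquivariantFunctions

section Patching

variable {K E : Type*} [Field K] [Field E] [Algebra K E]

/-- Any two bases of `E ^ n` have enough common combinations, the first with coefficients in `K₁`
and the second with coefficients in `K₂`. -/
def PatchingProperty (K₁ K₂ : Subfield E) : Prop :=
  ∀ (ι : Type) [Finite ι] (g₁ g₂ : Module.Basis ι E (ι → E)),
    Submodule.span E ((Submodule.span K₁ (Set.range g₁) : Set (ι → E)) ∩
      (Submodule.span K₂ (Set.range g₂) : Set (ι → E))) = ⊤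

theorem exists_basis_subset_of_span_eq_top {ι : Type*} [Finite ι] {S : Set (ι → E)}
    (hS : Submodule.span E S = ⊤) : ∃ g : Module.Basis ι E (ι → E), ∀ i, g i ∈ S := by
  have := Fintype.ofFinite ι
  let b := Module.Basis.ofSpan hS.ge
  have e : Nonempty ((LinearIndepOn.extend (K := E) (v := id) (s := ∅) (t := S)
      (linearIndepOn_empty _ _) (Set.empty_subset _)) ≃ ι) :=
    ⟨b.indexEquiv (Pi.basisFun E ι)⟩
  obtain ⟨e⟩ := e
  refine ⟨b.reindex e, fun i => ?_⟩
  rw [Module.Basis.reindex_apply]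
  exact Module.Basis.ofSpan_subset hS.ge ⟨_, rfl⟩

theorem span_subset_equivariantFun {ι : Type*} {K₁ : IntermediateField K E}
    {A : Subalgebra K₁ (ι → E)} {g : ι → ι → E} (hg : ∀ i, g i ∈ A) {w : ι → E}
    (hw : w ∈ Submodule.span K₁.toSubfield (Set.range g)) : w ∈ A := by
  have : Submodule.span K₁ (Set.range g) ≤ Subalgebra.toSubmodule A := by
    rw [Submodule.span_le]
    rintro _ ⟨i, rfl⟩
    exact hg i
  exact this hw

variable {Γ : Type} [Group Γ] [Finite Γ]

theorem exists_galois_patching (K₁ K₂ : IntermediateField K E) (hK : K₁ ⊓ K₂ = ⊥)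
    (hP : PatchingProperty K₁.toSubfield K₂.toSubfield)
    (L₁ : IntermediateField K₁ E) [FiniteDimensional K₁ L₁] [IsGalois K₁ L₁]
    (a₁ : (L₁ ≃ₐ[K₁] L₁) →* Γ)
    (L₂ : IntermediateField K₂ E) [FiniteDimensional K₂ L₂] [IsGalois K₂ L₂]
    (a₂ : (L₂ ≃ₐ[K₂] L₂) →* Γ) :
    ∃ M : IntermediateField K E, FiniteDimensional K M ∧ IsGalois K M ∧
      (∀ x ∈ M, x ∈ L₁) ∧ (∀ x ∈ M, x ∈ L₂) ∧
      ∃ b : (M ≃ₐ[K] M) →* Γ, Function.Injective b ∧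
        (∀ τ : L₁ ≃ₐ[K₁] L₁, ∃ σ : M ≃ₐ[K] M,
          (∀ (x : M) (h : (x : E) ∈ L₁), (τ ⟨x, h⟩ : E) = σ x) ∧ b σ = a₁ τ) ∧
        (∀ τ : L₂ ≃ₐ[K₂] L₂, ∃ σ : M ≃ₐ[K] M,
          (∀ (x : M) (h : (x : E) ∈ L₂), (τ ⟨x, h⟩ : E) = σ x) ∧ b σ = a₂ τ) := by
  classical
  have := Fintype.ofFinite Γ
  let A₁ := equivariantFun L₁ a₁
  let A₂ := equivariantFun L₂ a₂
  let A : Subalgebra K (Γ → E) := A₁.restrictScalars K ⊓ A₂.restrictScalars K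
  have memA : ∀ w, w ∈ A ↔ w ∈ A₁ ∧ w ∈ A₂ := fun w => Iff.rfl
  have hspan : Submodule.span E (A : Set (Γ → E)) = ⊤ := by
    obtain ⟨g₁, hg₁⟩ := exists_basis_subset_of_span_eq_top (span_equivariantFun L₁ a₁)
    obtain ⟨g₂, hg₂⟩ := exists_basis_subset_of_span_eq_top (span_equivariantFun L₂ a₂)
    rw [eq_top_iff, ← hP Γ g₁ g₂]
    refine Submodule.span_mono fun w hw => ?_
    exact ⟨span_subset_equivariantFun hg₁ hw.1, span_subset_equivariantFun hg₂ hw.2⟩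
  obtain ⟨g, hg⟩ := exists_basis_subset_of_span_eq_top hspan
  have hrepr : ∀ w ∈ A, ∀ γ, ∃ r : K, algebraMap K E r = g.repr w γ := by
    intro w hw γ
    obtain ⟨⟨r₁, h₁⟩, h₁'⟩ := equivariantFun_repr_mem L₁ a₁ g (fun i => (hg i).1) hw.1 γ
    obtain ⟨⟨r₂, h₂⟩, h₂'⟩ := equivariantFun_repr_mem L₂ a₂ g (fun i => (hg i).2) hw.2 γ
    have : g.repr w γ ∈ K₁ ⊓ K₂ := ⟨by rw [← h₁']; exact h₁, by rw [← h₂']; exact h₂⟩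
    rw [hK] at this
    exact this
  let gA : Γ → A := fun i => ⟨g i, hg i⟩
  have hgA : ⊤ ≤ Submodule.span K (Set.range gA) := by
    rintro ⟨w, hw⟩ -
    choose r hr using hrepr w hw
    have : (⟨w, hw⟩ : A) = ∑ i, r i • gA i := by
      ext1
      conv_lhs => rw [show ((⟨w, hw⟩ : A) : Γ → E) = w from rfl, ← g.sum_repr w]
      push_cast
      refine Finset.sum_congr rfl fun i _ => ?_
      rw [← hr]
      ext
      simp [gA, Algebra.smul_def]
    rw [this]
    exact Submodule.sum_mem _ fun i _ => Submodule.smul_mem _ _ (Submodule.subset_span ⟨i, rfl⟩)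
  have hfin : FiniteDimensional K A :=
    ⟨⟨Finset.univ.image gA, by simpa using top_le_iff.1 hgA⟩⟩
  have hrank : Module.finrank K A ≤ Nat.card Γ := by
    have := finrank_range_le_card (R := K) gA
    rw [Set.finrank, top_le_iff.1 hgA, finrank_top] at this
    simpa using this
  have hsep : ∀ γ δ : Γ, (∀ w ∈ A, w γ = w δ) → γ = δ := by
    intro γ δ h
    have : (⊤ : Submodule E (Γ → E)) ≤
        LinearMap.ker ((LinearMap.proj γ : (Γ → E) →ₗ[E] E) - LinearMap.proj δ) := by
      rw [← hspan, Submodule.span_le]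
      intro w hw
      simp [h w hw]
    have h1 := this (Submodule.mem_top : (Pi.single γ 1 : Γ → E) ∈ ⊤)
    by_contra hne
    simp [Ne.symm hne] at h1
  let ev : Γ → (A →ₐ[K] E) := fun γ => (Pi.evalAlgHom K (fun _ : Γ => E) γ).comp A.val
  have hev : ∀ γ w, ev γ w = w.1 γ := fun _ _ => rfl
  have hevinj : Function.Injective ev := fun γ δ h =>
    hsep γ δ fun w hw => DFunLike.congr_fun h ⟨w, hw⟩
  have hevsurj : Function.Surjective ev :=
    (hevinj.bijective_of_nat_card_le ((card_algHom_le_finrank K A E).trans hrank)).2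
  have htr : ∀ w ∈ A, ∀ δ, (fun γ => w (γ * δ)) ∈ A := fun w hw δ =>
    ⟨equivariantFun_translate hw.1 δ, equivariantFun_translate hw.2 δ⟩
  have hfinR : FiniteDimensional K (ev 1).range :=
    inferInstanceAs (FiniteDimensional K (LinearMap.range (ev 1).toLinearMap))
  have hRfield : IsField (ev 1).range :=
    isField_of_isIntegral_of_isField' (Field.toIsField K)
  let M : IntermediateField K E :=
    Subalgebra.toIntermediateField' (ev 1).range hRfield
  have hMfin : FiniteDimensional K M := hfinR
  have memM : ∀ x, x ∈ M ↔ ∃ w ∈ A, w 1 = x := fun x =>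
    ⟨fun ⟨w, hw⟩ => ⟨w.1, w.2, hw⟩, fun ⟨w, hw, h⟩ => ⟨⟨w, hw⟩, h⟩⟩
  have memM' : ∀ w ∈ A, ∀ γ, w γ ∈ M := fun w hw γ =>
    (memM _).2 ⟨_, htr w hw γ, by simp⟩
  have hpoly : ∀ w ∈ A, ∃ Q : Polynomial K, Q.map (algebraMap K E) =
      ∏ v ∈ Finset.univ.image w, (Polynomial.X - Polynomial.C v) := by
    intro w hw
    have : (∏ v ∈ Finset.univ.image w, (Polynomial.X - Polynomial.C v)) ∈
        Polynomial.lifts (algebraMap K E) := by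
      rw [Polynomial.lifts_iff_coeff_lifts]
      intro n
      obtain ⟨r₁, h₁⟩ := coeff_prod_equivariantFun_mem hw.1 n
      obtain ⟨r₂, h₂⟩ := coeff_prod_equivariantFun_mem hw.2 n
      have : (∏ v ∈ Finset.univ.image w, (Polynomial.X - Polynomial.C v)).coeff n ∈ K₁ ⊓ K₂ :=
        ⟨by rw [← h₁]; exact r₁.2, by rw [← h₂]; exact r₂.2⟩
      rw [hK] at this
      exact this
    exact (Polynomial.mem_lifts _).1 this
  have hsepE : ∀ w : Γ → E, (∏ v ∈ Finset.univ.image w,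
      (Polynomial.X - Polynomial.C v)).Separable := fun w =>
    (Polynomial.separable_prod_X_sub_C_iff' (f := id)).2 fun x _ y _ h => h
  have hdvd : ∀ x : M, ∃ w ∈ A, w 1 = x ∧ ∃ Q : Polynomial K, Q.map (algebraMap K E) =
      ∏ v ∈ Finset.univ.image w, (Polynomial.X - Polynomial.C v) ∧ minpoly K x ∣ Q := by
    intro x
    obtain ⟨w, hw, hwx⟩ := (memM x).1 x.2
    obtain ⟨Q, hQ⟩ := hpoly w hw
    refine ⟨w, hw, hwx, Q, hQ, minpoly.dvd _ _ ?_⟩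
    have : (Polynomial.aeval (x : E) Q) = 0 := by
      rw [Polynomial.aeval_def, ← Polynomial.eval_map, hQ, Polynomial.eval_prod]
      refine Finset.prod_eq_zero (Finset.mem_image_of_mem w (Finset.mem_univ 1)) ?_
      simp [hwx]
    apply Subtype.val_injective
    simpa using this
  have hgal : IsGalois K M := by
    refine @IsGalois.mk _ _ _ _ _ ⟨fun x => ?_⟩ (normal_iff.2 fun x => ⟨?_, ?_⟩)
    · obtain ⟨w, hw, hwx, Q, hQ, hd⟩ := hdvd x
      refine Polynomial.Separable.of_dvd ?_ hd
      rw [← Polynomial.separable_map (algebraMap K E), hQ]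
      exact hsepE w
    · exact Algebra.IsIntegral.isIntegral x
    · obtain ⟨w, hw, hwx, Q, hQ, hd⟩ := hdvd x
      have hQM : Q.map (algebraMap K M) = ∏ v ∈ Finset.univ.image
          (fun γ => (⟨w γ, memM' w hw γ⟩ : M)), (Polynomial.X - Polynomial.C v) := by
        apply Polynomial.map_injective (algebraMap M E) (algebraMap M E).injective
        rw [Polynomial.map_map, ← IsScalarTower.algebraMap_eq, hQ, Polynomial.map_prod]
        have : Finset.univ.image w = (Finset.univ.image
          (fun γ => (⟨w γ, memM' w hw γ⟩ : M))).image (algebraMap M E) := by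
          rw [Finset.image_image]; rfl
        rw [this, Finset.prod_image fun _ _ _ _ h => (algebraMap M E).injective h]
        simp
      refine Polynomial.Splits.of_dvd (g := Q.map (algebraMap K M)) ?_ ?_
        (Polynomial.map_dvd _ hd)
      · rw [hQM]
        exact Polynomial.Splits.prod fun v _ => Polynomial.Splits.X_sub_C v
      · rw [hQM]
        exact Finset.prod_ne_zero_iff.2 fun v _ => Polynomial.X_sub_C_ne_zero v
  let π : A →ₐ[K] M := (ev 1).rangeRestrict
  have hπ : ∀ w : A, (π w : E) = w.1 1 := fun w => rfl
  have hb : ∀ σ : M ≃ₐ[K] M, ∃ γ, ∀ w : A, (σ (π w) : E) = w.1 γ := by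
    intro σ
    obtain ⟨γ, hγ⟩ := hevsurj ((M.val.comp σ.toAlgHom).comp π)
    exact ⟨γ, fun w => (DFunLike.congr_fun hγ w).symm⟩
  choose b hb using hb
  have hbuniq : ∀ σ γ, (∀ w : A, (σ (π w) : E) = w.1 γ) → b σ = γ := fun σ γ h =>
    hsep _ _ fun w hw => (hb σ ⟨w, hw⟩).symm.trans (h ⟨w, hw⟩)
  let bh : (M ≃ₐ[K] M) →* Γ := MonoidHom.mk' b (fun σ τ => by
    apply hbuniq
    intro w
    have h1 : τ (π w) = π ⟨_, htr w.1 w.2 (b τ)⟩ := by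
      ext
      rw [hb, hπ]
      simp
    rw [AlgEquiv.mul_apply, h1, hb])
  have hlift : ∀ (K' : IntermediateField K E) (L : IntermediateField K' E)
      (a : (L ≃ₐ[K'] L) →* Γ), (∀ w ∈ A, w ∈ equivariantFun L a) →
      (∀ x ∈ M, x ∈ L) ∧ ∀ τ : L ≃ₐ[K'] L, ∃ σ : M ≃ₐ[K] M,
          (∀ (x : M) (h : (x : E) ∈ L), (τ ⟨x, h⟩ : E) = σ x) ∧ bh σ = a τ := by
    intro K' L a hA
    have hML : ∀ x ∈ M, x ∈ L := by
      intro x hx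
      obtain ⟨w, hw, rfl⟩ := (memM x).1 hx
      obtain ⟨u, hu, -⟩ := hA w hw
      rw [hu]
      exact (u 1).2
    refine ⟨hML, fun τ => ?_⟩
    have hτ : ∀ w (hw : w ∈ A) (h : w 1 ∈ L), (τ ⟨w 1, h⟩ : E) = w (a τ) := by
      intro w hw h
      obtain ⟨u, hu, hu'⟩ := hA w hw
      have : (⟨w 1, h⟩ : L) = u 1 := Subtype.ext (hu 1)
      rw [this, hu', hu, mul_one]
    let inc : M →ₐ[K] L := IntermediateField.inclusion (E := M) (F := L.restrictScalars K) hML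
    have hinc : ∀ x, (inc x : E) = x := fun x => rfl
    let φ : M →ₐ[K] M := (((IntermediateField.val L).restrictScalars K).comp
      ((τ.toAlgHom.restrictScalars K).comp inc)).codRestrict M.toSubalgebra (fun x => by
        obtain ⟨w, hw, hwx⟩ := (memM x).1 x.2
        have hh := hτ w hw (by rw [hwx]; exact hML x x.2)
        have : inc x = ⟨w 1, by rw [hwx]; exact hML x x.2⟩ := Subtype.ext hwx.symm
        change (τ (inc x) : E) ∈ M
        rw [this, hh]
        exact memM' w hw _)
    let σ : M ≃ₐ[K] M := AlgEquiv.ofBijective φ (Algebra.IsAlgebraic.algHom_bijective φ)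
    have hσ : ∀ (x : M) (h : (x : E) ∈ L), (τ ⟨x, h⟩ : E) = σ x := fun x h => rfl
    refine ⟨σ, hσ, hbuniq σ _ fun w => ?_⟩
    rw [← hσ _ (hML _ (π w).2)]
    exact hτ w.1 w.2 (hML _ (π w).2)
  obtain ⟨h1, h1'⟩ := hlift K₁ L₁ a₁ fun w hw => hw.1
  obtain ⟨h2, h2'⟩ := hlift K₂ L₂ a₂ fun w hw => hw.2
  refine ⟨M, hMfin, hgal, h1, h2, bh, ?_, h1', h2'⟩
  intro σ τ h
  ext x
  obtain ⟨w, hw, hwx⟩ := (memM x).1 x.2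
  have : x = π ⟨w, hw⟩ := Subtype.ext hwx.symm
  rw [this, hb, hb]
  exact congrArg w h

end Patching

section Compositum

open IntermediateField

variable {K E : Type*} [Field K] [Field E] [Algebra K E]

theorem isGalois_adjoin_of_isGalois (K₁ : IntermediateField K E) (N : IntermediateField K E)
    [FiniteDimensional K N] [IsGalois K N] :
    FiniteDimensional K₁ (adjoin K₁ (N : Set E)) ∧ IsGalois K₁ (adjoin K₁ (N : Set E)) := by
  obtain ⟨y, hy⟩ := Field.exists_primitive_element K N
  let q := (minpoly K y).map (algebraMap K K₁)
  have hmap : q.map (algebraMap K₁ E) = ((minpoly K y).map (algebraMap K N)).map (algebraMap N E) := by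
    rw [Polynomial.map_map, Polynomial.map_map]; rfl
  have hs : (q.map (algebraMap K₁ E)).Splits := by
    rw [hmap]
    exact (Normal.splits inferInstance y).map _
  have h1 : adjoin K₁ (q.rootSet E) = adjoin K₁ (N : Set E) := by
    apply le_antisymm
    · rw [adjoin_le_iff]
      intro x hx
      apply subset_adjoin
      rw [Polynomial.mem_rootSet'] at hx
      have h2 : ((minpoly K y).map (algebraMap K N)).Splits := Normal.splits inferInstance y
      have h3 := h2.roots_map (algebraMap N E)
      have hx' : x ∈ (q.map (algebraMap K₁ E)).roots := by
        rw [Polynomial.mem_roots hx.1, Polynomial.IsRoot, Polynomial.eval_map]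
        exact hx.2
      rw [hmap, h3, Multiset.mem_map] at hx'
      obtain ⟨z, -, rfl⟩ := hx'
      exact z.2
    · rw [adjoin_le_iff]
      intro x hx
      have hyq : (y : E) ∈ adjoin K₁ (q.rootSet E) := by
        apply subset_adjoin
        rw [Polynomial.mem_rootSet']
        refine ⟨Polynomial.map_ne_zero (Polynomial.map_ne_zero
          (minpoly.ne_zero (Algebra.IsIntegral.isIntegral y))), ?_⟩
        rw [Polynomial.aeval_map_algebraMap]
        simp
      have h4 : (⊤ : IntermediateField K N) ≤
          ((adjoin K₁ (q.rootSet E)).restrictScalars K).comap N.val := by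
        rw [← hy, adjoin_le_iff, Set.singleton_subset_iff]
        exact hyq
      exact h4 (IntermediateField.mem_top : (⟨x, hx⟩ : N) ∈ _)
  rw [← h1]
  have := adjoin_rootSet_isSplittingField hs
  have hsep : q.Separable := by
    refine Polynomial.Separable.map ?_
    exact Algebra.IsSeparable.isSeparable K y
  exact ⟨Polynomial.IsSplittingField.finiteDimensional _ q,
    IsGalois.of_separable_splitting_field hsep⟩

theorem exists_restrict_bijective (K₁ : IntermediateField K E) (N : IntermediateField K E)
    [FiniteDimensional K N] [IsGalois K N] (h : N ⊓ K₁ = ⊥) :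
    ∃ φ : (adjoin K₁ (N : Set E) ≃ₐ[K₁] adjoin K₁ (N : Set E)) →* (N ≃ₐ[K] N),
      Function.Bijective φ ∧ ∀ (τ : adjoin K₁ (N : Set E) ≃ₐ[K₁] adjoin K₁ (N : Set E)) (x : N),
        (φ τ x : E) = τ ⟨x, subset_adjoin K₁ _ x.2⟩ := by
  obtain ⟨hfin, hgal⟩ := isGalois_adjoin_of_isGalois K₁ N
  set S := adjoin K₁ (N : Set E) with hS
  let i : N →ₐ[K] S := IntermediateField.inclusion (E := N) (F := S.restrictScalars K)
    fun x hx => subset_adjoin K₁ _ hx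
  let _ : Algebra N S := i.toRingHom.toAlgebra
  have : IsScalarTower K N S := IsScalarTower.of_algebraMap_eq fun x => (i.commutes x).symm
  let φ := restrictRestrictAlgEquivMapHom K N K₁ S
  have hφ : ∀ τ x, (φ τ x : E) = τ (i x) := by
    intro τ x
    have : algebraMap N S (φ τ x) = τ (algebraMap N S x) :=
      AlgEquiv.restrictNormal_commutes (MulSemiringAction.toAlgAut Gal(S/K₁) K S τ) N x
    exact congrArg (fun z : S => (z : E)) this
  refine ⟨φ, ⟨?_, ?_⟩, hφ⟩
  · rw [injective_iff_map_eq_one]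
    intro τ hτ
    have : (⊤ : IntermediateField K₁ S) ≤ fixedField (Subgroup.zpowers τ) := by
      have : adjoin K₁ (Set.range i) ≤ fixedField (Subgroup.zpowers τ) := by
        rw [adjoin_le_iff]
        rintro _ ⟨x, rfl⟩
        rw [SetLike.mem_coe, mem_fixedField_iff]
        have h1 : τ ∈ MulAction.stabilizer (S ≃ₐ[K₁] S) (i x) := by
          rw [MulAction.mem_stabilizer_iff]
          apply Subtype.ext
          exact (hφ τ x).symm.trans (by rw [hτ]; rfl)
        intro f hf
        exact (Subgroup.zpowers_le.2 h1) hf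
      refine le_trans ?_ this
      rintro ⟨x, hx⟩ -
      have : adjoin K₁ (N : Set E) ≤ (adjoin K₁ (Set.range i)).map S.val := by
        rw [adjoin_map, ← Set.range_comp]
        apply adjoin.mono
        intro z hz
        exact ⟨⟨z, hz⟩, rfl⟩
      obtain ⟨z, hz, hz'⟩ := this hx
      have : (⟨x, hx⟩ : S) = z := Subtype.ext hz'.symm
      rw [this]
      exact hz
    ext x
    have h2 := (mem_fixedField_iff _ _).1 (this (IntermediateField.mem_top : x ∈ _)) τ
      (Subgroup.mem_zpowers τ)
    rw [h2]; rfl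
  · suffices fixedField φ.range = ⊥ from
      MonoidHom.range_eq_top.mp <|
        fixingSubgroup_fixedField φ.range ▸ this ▸ fixingSubgroup_bot
    refine eq_bot_iff.mpr fun x hx => ?_
    have hx1 : i x ∈ (⊥ : IntermediateField K₁ S) := by
      refine (IsGalois.mem_bot_iff_fixed _).mpr fun τ => ?_
      apply Subtype.ext
      rw [← hφ]
      rw [mem_fixedField_iff] at hx
      rw [hx _ ⟨τ, rfl⟩]
      rfl
    obtain ⟨r, hr⟩ := mem_bot.1 hx1
    have : (x : E) ∈ N ⊓ K₁ := ⟨x.2, by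
      have : (r : E) = x := congrArg (fun z : S => (z : E)) hr
      rw [← this]; exact r.2⟩
    rw [h] at this
    obtain ⟨s, hs⟩ := mem_bot.1 this
    exact mem_bot.2 ⟨s, Subtype.ext hs⟩

theorem finrank_adjoin_eq_of_inf_eq_bot (K₁ : IntermediateField K E) (N : IntermediateField K E)
    [FiniteDimensional K N] [IsGalois K N] (h : N ⊓ K₁ = ⊥) :
    Module.finrank K₁ (adjoin K₁ (N : Set E)) = Module.finrank K N := by
  obtain ⟨hfin, hgal⟩ := isGalois_adjoin_of_isGalois K₁ N
  obtain ⟨φ, hφ, -⟩ := exists_restrict_bijective K₁ N h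
  rw [← IsGalois.card_aut_eq_finrank, ← IsGalois.card_aut_eq_finrank]
  exact Nat.card_congr (Equiv.ofBijective φ hφ)

/-- An element of a Galois subextension `M` of `L K₁` all of whose conjugates lie in `K₂`
already lies in `L`. -/
theorem mem_of_conj_mem {K₁ K₂ L M : IntermediateField K E} (hK : K₁ ⊓ K₂ = ⊥)
    [FiniteDimensional K L] [IsGalois K L] (hL : L ≤ K₂)
    [FiniteDimensional K M] [IsGalois K M] (hM : ∀ x ∈ M, x ∈ adjoin K₁ (L : Set E))
    (z : M) (hz : ∀ σ : M ≃ₐ[K] M, (σ z : E) ∈ K₂) : (z : E) ∈ L := by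
  let T : IntermediateField K M :=
    ⨅ σ : M ≃ₐ[K] M, (K₂.comap M.val).map σ.toAlgHom
  have memT : ∀ x, x ∈ T ↔ ∀ σ : M ≃ₐ[K] M, (σ x : E) ∈ K₂ := by
    intro x
    rw [← SetLike.mem_coe, show (T : Set M) = _ from coe_iInf _, Set.mem_iInter]
    constructor
    · intro h σ
      obtain ⟨y, hy, hyx⟩ := h σ⁻¹
      have : σ x = y := by
        rw [← hyx]
        exact AlgEquiv.apply_symm_apply σ y
      rw [this]
      exact hy
    · intro h σ
      exact ⟨σ.symm x, h σ.symm, σ.apply_symm_apply x⟩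
  have hTn : Normal K T := by
    rw [normal_iff_forall_map_le']
    rintro σ _ ⟨x, hx, rfl⟩
    rw [memT]
    intro τ
    exact (memT x).1 hx (τ * σ)
  have : IsGalois K T := ⟨⟩
  let T' : IntermediateField K E := T.map M.val
  have hT'g : IsGalois K T' := IsGalois.of_algEquiv (equivMap T M.val)
  have hT'f : FiniteDimensional K T' :=
    LinearEquiv.finiteDimensional (equivMap T M.val).toLinearEquiv
  have hT'2 : T' ≤ K₂ := by
    rintro _ ⟨x, hx, rfl⟩
    exact (memT x).1 hx 1
  have hT'M : T' ≤ M := by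
    rintro _ ⟨x, hx, rfl⟩
    exact x.2
  have hdisj : ∀ N : IntermediateField K E, N ≤ K₂ → N ⊓ K₁ = ⊥ := fun N hN => by
    rw [eq_bot_iff, ← hK, inf_comm]
    exact inf_le_inf le_rfl hN
  have hadj : adjoin K₁ ((L ⊔ T' : IntermediateField K E) : Set E) = adjoin K₁ (L : Set E) := by
    apply le_antisymm
    · rw [adjoin_le_iff]
      have : L ⊔ T' ≤ (adjoin K₁ (L : Set E)).restrictScalars K :=
        sup_le (fun x hx => subset_adjoin K₁ _ hx) fun x hx => hM x (hT'M hx)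
      exact this
    · exact adjoin.mono _ _ _ (le_sup_left : L ≤ L ⊔ T')
  have h1 := finrank_adjoin_eq_of_inf_eq_bot K₁ L (hdisj L hL)
  have h2 := finrank_adjoin_eq_of_inf_eq_bot K₁ (L ⊔ T') (hdisj _ (sup_le hL hT'2))
  rw [hadj, h1] at h2
  have h3 := eq_of_le_of_finrank_eq (le_sup_left : L ≤ L ⊔ T') h2
  have : (z : E) ∈ L ⊔ T' := (le_sup_right : T' ≤ L ⊔ T') ⟨z, (memT z).2 hz, rfl⟩
  rwa [← h3] at this

end Compositum

section PatchingStep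

open IntermediateField

variable {F K E : Type*} [Field F] [Field K] [Field E] [Algebra F E] [Algebra K E]
  [Algebra F K] [IsScalarTower F K E]
  {Γ : Type} [Group Γ] [Finite Γ]

/-- If every cyclic group element `h` can be realized over `K₂`, an embedding problem over `K`
whose solution field `L` is contained in `K₂` can be modified by `h`. -/
theorem exists_patching_step (K₁ K₂ : IntermediateField K E) (hK : K₁ ⊓ K₂ = ⊥)
    (hP : PatchingProperty K₁.toSubfield K₂.toSubfield)
    (hF : ∀ z : E, IsAlgebraic F z → z ∈ K₂)
    (L : IntermediateField K E) [FiniteDimensional K L] [IsGalois K L] (hL : L ≤ K₂)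
    (a : (L ≃ₐ[K] L) →* Γ)
    (M₂ : IntermediateField K₂ E) [FiniteDimensional K₂ M₂] [IsGalois K₂ M₂]
    (χ : (M₂ ≃ₐ[K₂] M₂) →* Γ) (h : Γ) (hχ : χ.range = Subgroup.zpowers h) :
    ∃ M : IntermediateField K E, FiniteDimensional K M ∧ IsGalois K M ∧
      ∃ b : (M ≃ₐ[K] M) →* Γ, Function.Injective b ∧ h ∈ b.range ∧
        (∀ ρ : L ≃ₐ[K] L, ∃ σ : M ≃ₐ[K] M, b σ = a ρ ∧
          ∀ (x : M) (hx : (x : E) ∈ L), (ρ ⟨x, hx⟩ : E) = σ x) ∧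
        (∀ V : Subgroup Γ, V.Normal → h ∈ V → ∀ σ : M ≃ₐ[K] M,
          (∀ x : M, (x : E) ∈ L → σ x = x) → b σ ∈ V) ∧
        (∀ z ∈ M, IsAlgebraic F z → z ∈ L) := by
  obtain ⟨hfin₁, hgal₁⟩ := isGalois_adjoin_of_isGalois K₁ L
  have hdisj : L ⊓ K₁ = ⊥ := by
    rw [eq_bot_iff, ← hK, inf_comm]
    exact inf_le_inf le_rfl hL
  obtain ⟨φ, hφ, hφ'⟩ := exists_restrict_bijective K₁ L hdisj
  obtain ⟨M, hMf, hMg, hM₁, hM₂, b, hb, hb₁, hb₂⟩ := exists_galois_patching K₁ K₂ hK hP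
    (adjoin K₁ (L : Set E)) (a.comp φ) M₂ χ
  refine ⟨M, hMf, hMg, b, hb, ?_, ?_, ?_, ?_⟩
  · obtain ⟨τ, hτ⟩ : h ∈ χ.range := by rw [hχ]; exact Subgroup.mem_zpowers h
    obtain ⟨σ, -, hσ⟩ := hb₂ τ
    exact ⟨σ, hσ.trans hτ⟩
  · intro ρ
    obtain ⟨τ, hτ⟩ := hφ.2 ρ
    obtain ⟨σ, hσ, hσ'⟩ := hb₁ τ
    refine ⟨σ, hσ'.trans (by simp [hτ]), fun x hx => ?_⟩
    rw [← hσ x (hM₁ x x.2), ← hτ, hφ']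
  · intro V hV hVh σ hσ
    have hfix : ∀ x : M, x ∈ fixedField (V.comap b) → (x : E) ∈ L := by
      intro x hx
      rw [mem_fixedField_iff] at hx
      refine mem_of_conj_mem hK hL hM₁ x fun ρ => ?_
      have hmem : (⟨ρ x, hM₂ _ (ρ x).2⟩ : M₂) ∈ (⊥ : IntermediateField K₂ M₂) := by
        refine (IsGalois.mem_bot_iff_fixed _).2 fun τ => ?_
        obtain ⟨σ', hσ', hσ''⟩ := hb₂ τ
        apply Subtype.ext
        rw [hσ' (ρ x) (hM₂ _ (ρ x).2)]
        have h1 : χ τ ∈ V := (Subgroup.zpowers_le.2 hVh) (hχ ▸ ⟨τ, rfl⟩)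
        have h2 : ρ⁻¹ * σ' * ρ ∈ V.comap b := by
          rw [Subgroup.mem_comap, map_mul, map_mul, map_inv, hσ'']
          simpa using hV.conj_mem _ h1 (b ρ)⁻¹
        have h3 := congrArg ρ (hx _ h2)
        have h4 : σ' (ρ x) = ρ x :=
          (AlgEquiv.apply_symm_apply ρ _).symm.trans h3
        rw [h4]
      obtain ⟨r, hr⟩ := mem_bot.1 hmem
      have : (r : E) = ρ x := congrArg (fun z : M₂ => (z : E)) hr
      rw [← this]
      exact r.2
    have : σ ∈ V.comap b := by
      rw [← fixingSubgroup_fixedField (V.comap b), IntermediateField.mem_fixingSubgroup_iff]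
      exact fun x hx => hσ x (hfix x hx)
    exact this
  · intro z hz hzF
    refine mem_of_conj_mem hK hL hM₁ ⟨z, hz⟩ fun σ => hF _ ?_
    have h1 : IsAlgebraic F (⟨z, hz⟩ : M) :=
      (isAlgebraic_algHom_iff (M.val.restrictScalars F) Subtype.val_injective).1 hzF
    exact (h1.algHom (σ.toAlgHom.restrictScalars F)).algHom (M.val.restrictScalars F)

end PatchingStep

section Factorization

/-- The coefficients of the two factors in the factorization of a power series with constant
coefficient `1`, relative to a decomposition `x = pos x + neg x` of its coefficients. -/
def factorCoeff {S : Type*} [Ring S] (u : ℕ → S) (pos neg : S → S) : ℕ → S × S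
  | 0 => (1, 1)
  | n + 1 =>
    let w := u (n + 1) - ∑ i : Fin n, (factorCoeff u pos neg (i + 1)).1 *
      (factorCoeff u pos neg (n - i)).2
    (pos w, neg w)

theorem exists_factorization {S : Type*} [Ring S] (pos neg : S → S)
    (hpn : ∀ x, pos x + neg x = x) (u : ℕ → S) (hu : u 0 = 1) :
    ∃ a b : ℕ → S, a 0 = 1 ∧ b 0 = 1 ∧ (∀ n, a (n + 1) ∈ Set.range pos) ∧
      (∀ n, b (n + 1) ∈ Set.range neg) ∧
      ∀ n, ∑ p ∈ Finset.HasAntidiagonal.antidiagonal n, a p.1 * b p.2 = u n := by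
  refine ⟨fun n => (factorCoeff u pos neg n).1, fun n => (factorCoeff u pos neg n).2,
    by simp [factorCoeff], by simp [factorCoeff], fun n => ?_, fun n => ?_, fun n => ?_⟩
  · beta_reduce; rw [factorCoeff]; exact ⟨_, rfl⟩
  · beta_reduce; rw [factorCoeff]; exact ⟨_, rfl⟩
  · cases n with
    | zero => simp [factorCoeff, hu]
    | succ n =>
      rw [Finset.Nat.sum_antidiagonal_eq_sum_range_succ_mk, Finset.sum_range_succ,
        Finset.sum_range_succ']
      have h0 : (factorCoeff u pos neg 0) = (1, 1) := by simp [factorCoeff]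
      have h1 : factorCoeff u pos neg (n + 1) =
          (pos (u (n + 1) - ∑ i : Fin n, (factorCoeff u pos neg (i + 1)).1 *
            (factorCoeff u pos neg (n - i)).2), neg (u (n + 1) - ∑ i : Fin n,
            (factorCoeff u pos neg (i + 1)).1 * (factorCoeff u pos neg (n - i)).2)) := by
        rw [factorCoeff]
      have h2 : ∑ k ∈ Finset.range n, (factorCoeff u pos neg (k + 1)).1 *
          (factorCoeff u pos neg (n + 1 - (k + 1))).2 = ∑ i : Fin n,
            (factorCoeff u pos neg (i + 1)).1 * (factorCoeff u pos neg (n - i)).2 := by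
        rw [Finset.sum_range]
        refine Finset.sum_congr rfl fun i _ => ?_
        rw [Nat.add_sub_add_right]
      simp only [Nat.sub_zero, Nat.sub_self]
      rw [h2, h0, h1]
      simp only [one_mul, mul_one]
      generalize ∑ i : Fin n, (factorCoeff u pos neg (i + 1)).1 *
            (factorCoeff u pos neg (n - i)).2 = w
      rw [add_assoc, add_comm (neg _), hpn]
      abel

end Factorization

section LaurentParts

variable (k : Type) [Field k]

/-- Laurent series without positive powers of the variable, that is, `k[1/s]`. -/
def LaurentSeries.nonposPart : Subring (LaurentSeries k) where
  carrier := {f | ∀ n : ℤ, 0 < n → f.coeff n = 0}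
  zero_mem' := by simp
  one_mem' n hn := by simp [HahnSeries.coeff_one, hn.ne']
  add_mem' {f g} hf hg n hn := by simp [hf n hn, hg n hn]
  neg_mem' {f} hf n hn := by simp [hf n hn]
  mul_mem' {f g} hf hg n hn := by
    rw [HahnSeries.coeff_mul]
    refine Finset.sum_eq_zero fun p hp => ?_
    rw [Finset.mem_antidiagonal] at hp
    rcases lt_or_ge 0 p.1 with h | h
    · rw [hf _ h, zero_mul]
    · rw [hg _ (by omega), mul_zero]

/-- Laurent series without negative powers of the variable, that is, `k[[s]]`. -/
def LaurentSeries.nonnegPart : Subring (LaurentSeries k) where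
  carrier := {f | ∀ n : ℤ, n < 0 → f.coeff n = 0}
  zero_mem' := by simp
  one_mem' n hn := by simp [HahnSeries.coeff_one, hn.ne]
  add_mem' {f g} hf hg n hn := by simp [hf n hn, hg n hn]
  neg_mem' {f} hf n hn := by simp [hf n hn]
  mul_mem' {f g} hf hg n hn := by
    rw [HahnSeries.coeff_mul]
    refine Finset.sum_eq_zero fun p hp => ?_
    rw [Finset.mem_antidiagonal] at hp
    rcases lt_or_ge p.1 0 with h | h
    · rw [hf _ h, zero_mul]
    · rw [hg _ (by omega), mul_zero]

variable {k}

theorem LaurentSeries.exists_add_eq (f : LaurentSeries k) :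
    ∃ g ∈ LaurentSeries.nonnegPart k, ∃ h ∈ LaurentSeries.nonposPart k, g + h = f := by
  classical
  let g : LaurentSeries k := ⟨fun n => if n < 0 then 0 else f.coeff n,
    f.isPWO_support.mono fun n hn => by
      simp only [Function.mem_support] at hn ⊢
      intro h
      simp [h] at hn⟩
  refine ⟨g, fun n hn => by simp [g, hn], f - g, fun n hn => ?_, by abel⟩
  simp [g, not_lt.2 hn.le]

/-- Power series with coefficients in a subring. -/
noncomputable def PowerSeries.coeffSubring {S : Type*} [CommRing S] (P : Subring S) : Subring (PowerSeries S) :=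
  (PowerSeries.map P.subtype).range

theorem PowerSeries.mem_coeffSubring {S : Type*} [CommRing S] {P : Subring S} {f : PowerSeries S} :
    f ∈ PowerSeries.coeffSubring P ↔ ∀ n, PowerSeries.coeff n f ∈ P := by
  constructor
  · rintro ⟨g, rfl⟩ n
    simp
  · intro h
    refine ⟨PowerSeries.mk fun n => ⟨_, h n⟩, ?_⟩
    ext n
    simp

theorem PowerSeries.exists_inv_mem_coeffSubring {S : Type*} [CommRing S] {P : Subring S}
    {f : PowerSeries S} (hf : f ∈ PowerSeries.coeffSubring P)
    (h1 : PowerSeries.constantCoeff f = 1) : ∃ g ∈ PowerSeries.coeffSubring P, f * g = 1 := by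
  obtain ⟨f', rfl⟩ := hf
  have : IsUnit f' := by
    rw [PowerSeries.isUnit_iff_constantCoeff]
    rw [← PowerSeries.coeff_zero_eq_constantCoeff_apply, PowerSeries.coeff_map] at h1
    have : PowerSeries.constantCoeff f' = 1 := by
      rw [← PowerSeries.coeff_zero_eq_constantCoeff_apply]
      exact Subtype.ext h1
    rw [this]
    exact isUnit_one
  obtain ⟨g, hg⟩ := this.exists_right_inv
  exact ⟨_, ⟨g, rfl⟩, by rw [← map_mul, hg, map_one]⟩

end LaurentParts

section MatrixFactorization

variable {S : Type*} [CommRing S] {ι : Type*} [Fintype ι] [DecidableEq ι]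

theorem PowerSeries.exists_matrix_factorization {P₁ P₂ : Subring S}
    (hP : ∀ f : S, ∃ g ∈ P₂, ∃ h ∈ P₁, g + h = f)
    (U : Matrix ι ι (PowerSeries S))
    (hU : U.map (PowerSeries.constantCoeff) = 1) :
    ∃ A B : Matrix ι ι (PowerSeries S), A * B = U ∧
      A.map (PowerSeries.constantCoeff) = 1 ∧ B.map (PowerSeries.constantCoeff) = 1 ∧
      (∀ i j, A i j ∈ PowerSeries.coeffSubring P₂) ∧
      (∀ i j, B i j ∈ PowerSeries.coeffSubring P₁) := by
  choose pos hpos neg hneg hpn using hP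
  obtain ⟨a, b, ha0, hb0, ha, hb, hab⟩ := exists_factorization
    (fun M : Matrix ι ι S => M.map pos) (fun M => M.map neg)
    (fun M => by ext i j; simp [hpn]) (fun n => U.map (PowerSeries.coeff n))
    (by simpa using hU)
  refine ⟨Matrix.of fun i j => PowerSeries.mk fun n => a n i j,
    Matrix.of fun i j => PowerSeries.mk fun n => b n i j,
    ?_, ?_, ?_, ?_, ?_⟩
  · ext i j n
    rw [Matrix.mul_apply, map_sum]
    have := congrFun (congrFun (hab n) i) j
    simp only [Matrix.map_apply] at this
    rw [← this, Matrix.sum_apply]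
    simp only [PowerSeries.coeff_mul, Matrix.of_apply, PowerSeries.coeff_mk, Matrix.mul_apply]
    exact Finset.sum_comm
  · ext i j
    simp [← PowerSeries.coeff_zero_eq_constantCoeff_apply, ha0]
  · ext i j
    simp [← PowerSeries.coeff_zero_eq_constantCoeff_apply, hb0]
  · intro i j
    rw [PowerSeries.mem_coeffSubring]
    intro n
    rw [Matrix.of_apply, PowerSeries.coeff_mk]
    cases n with
    | zero =>
      rw [ha0, Matrix.one_apply]
      split_ifs <;> simp [P₂.one_mem, P₂.zero_mem]
    | succ n => obtain ⟨M, hM⟩ := ha n; rw [← hM]; exact hpos _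
  · intro i j
    rw [PowerSeries.mem_coeffSubring]
    intro n
    rw [Matrix.of_apply, PowerSeries.coeff_mk]
    cases n with
    | zero =>
      rw [hb0, Matrix.one_apply]
      split_ifs <;> simp [P₁.one_mem, P₁.zero_mem]
    | succ n => obtain ⟨M, hM⟩ := hb n; rw [← hM]; exact hneg _

end MatrixFactorization

section PatchingPropertyOfSeries

theorem PowerSeries.exists_mul_X_pow_eq {S : Type*} [Field S] {F₀ : Type*} [Field F₀]
    [Algebra (PowerSeries S) F₀] [IsFractionRing (PowerSeries S) F₀] (z : F₀) :
    ∃ (r : PowerSeries S) (j : ℕ), algebraMap (PowerSeries S) F₀ (PowerSeries.X ^ j) * z =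
      algebraMap (PowerSeries S) F₀ r := by
  obtain ⟨a, b, hb, rfl⟩ := IsFractionRing.div_surjective (A := PowerSeries S) z
  have hb0 : b ≠ 0 := nonZeroDivisors.ne_zero hb
  obtain ⟨j, hj⟩ := IsDiscreteValuationRing.associated_pow_irreducible hb0 PowerSeries.X_irreducible
  obtain ⟨u, hu⟩ := hj
  refine ⟨u * a, j, ?_⟩
  have : algebraMap (PowerSeries S) F₀ b ≠ 0 := by
    simpa using hb0
  rw [← hu, map_mul, map_mul]
  field_simp

theorem PowerSeries.exists_matrix_mul_X_pow_eq {S : Type*} [Field S] {F₀ : Type*} [Field F₀]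
    [Algebra (PowerSeries S) F₀] [IsFractionRing (PowerSeries S) F₀] {ι : Type*} [Finite ι]
    (B : Matrix ι ι F₀) :
    ∃ (B' : Matrix ι ι (PowerSeries S)) (j : ℕ),
      algebraMap (PowerSeries S) F₀ (PowerSeries.X ^ j) • B = B'.map (algebraMap _ F₀) := by
  have := Fintype.ofFinite ι
  choose r j h using fun i i' => PowerSeries.exists_mul_X_pow_eq (S := S) (B i i')
  let J := ∑ i, ∑ i', j i i'
  have hJ : ∀ i i', j i i' ≤ J := fun i i' =>
    (Finset.single_le_sum (f := fun i' => j i i') (fun _ _ => Nat.zero_le _)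
      (Finset.mem_univ i')).trans
      (Finset.single_le_sum (f := fun i => ∑ i', j i i') (fun _ _ => Nat.zero_le _)
        (Finset.mem_univ i))
  refine ⟨Matrix.of fun i i' => PowerSeries.X ^ (J - j i i') * r i i', J, ?_⟩
  ext i i'
  rw [Matrix.smul_apply, Matrix.map_apply, Matrix.of_apply, map_mul, ← h, ← mul_assoc, ← map_mul,
    ← pow_add, Nat.sub_add_cancel (hJ i i'), smul_eq_mul]

variable {S : Type*} [Field S] {P₁ P₂ : Subring S} {F₀ : Type*} [Field F₀]
  [Algebra (PowerSeries S) F₀]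

/-- The subfield generated by the power series with coefficients in a subring. -/
noncomputable def PowerSeries.coeffSubfield (P : Subring S) (F₀ : Type*) [Field F₀]
    [Algebra (PowerSeries S) F₀] : Subfield F₀ :=
  Subfield.closure (algebraMap (PowerSeries S) F₀ '' PowerSeries.coeffSubring P)

theorem PowerSeries.algebraMap_mem_coeffSubfield {P : Subring S} {f : PowerSeries S}
    (hf : f ∈ PowerSeries.coeffSubring P) :
    algebraMap (PowerSeries S) F₀ f ∈ PowerSeries.coeffSubfield P F₀ :=
  Subfield.subset_closure ⟨f, hf, rfl⟩

theorem PowerSeries.mem_coeffSubfield_iff {P : Subring S} {z : F₀} :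
    z ∈ PowerSeries.coeffSubfield P F₀ ↔ ∃ a ∈ PowerSeries.coeffSubring P,
      ∃ b ∈ PowerSeries.coeffSubring P,
        algebraMap (PowerSeries S) F₀ a / algebraMap (PowerSeries S) F₀ b = z := by
  rw [PowerSeries.coeffSubfield, Subfield.mem_closure_iff]
  have : Subring.closure (algebraMap (PowerSeries S) F₀ '' PowerSeries.coeffSubring P) =
      (PowerSeries.coeffSubring P).map (algebraMap (PowerSeries S) F₀) := by
    rw [← Subring.coe_map, Subring.closure_eq]
  rw [this]
  constructor
  · rintro ⟨_, ⟨a, ha, rfl⟩, _, ⟨b, hb, rfl⟩, rfl⟩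
    exact ⟨a, ha, b, hb, rfl⟩
  · rintro ⟨a, ha, b, hb, rfl⟩
    exact ⟨_, ⟨a, ha, rfl⟩, _, ⟨b, hb, rfl⟩, rfl⟩

theorem PowerSeries.X_mem_coeffSubring (P : Subring S) :
    (PowerSeries.X : PowerSeries S) ∈ PowerSeries.coeffSubring P :=
  ⟨PowerSeries.X, PowerSeries.map_X _⟩

theorem PowerSeries.C_mem_coeffSubring {P : Subring S} {a : S} (ha : a ∈ P) :
    (PowerSeries.C a : PowerSeries S) ∈ PowerSeries.coeffSubring P :=
  ⟨PowerSeries.C ⟨a, ha⟩, by simp⟩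

variable [IsFractionRing (PowerSeries S) F₀]

theorem PowerSeries.algebraMap_C_mem_coeffSubfield
    (hfrac : ∀ f : S, ∃ d ∈ P₂, d ≠ 0 ∧ d * f ∈ P₂) (f : S) :
    algebraMap (PowerSeries S) F₀ (PowerSeries.C f) ∈ PowerSeries.coeffSubfield P₂ F₀ := by
  obtain ⟨d, hd, hd0, hdf⟩ := hfrac f
  refine PowerSeries.mem_coeffSubfield_iff.2 ⟨_, PowerSeries.C_mem_coeffSubring hdf, _,
    PowerSeries.C_mem_coeffSubring hd, ?_⟩
  have : algebraMap (PowerSeries S) F₀ (PowerSeries.C d) ≠ 0 := by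
    simpa using hd0
  rw [map_mul, map_mul, mul_div_cancel_left₀ _ this]

theorem PowerSeries.exists_matrix_mul_eq {ι : Type*} [Fintype ι] [DecidableEq ι]
    (hP : ∀ f : S, ∃ g ∈ P₂, ∃ h ∈ P₁, g + h = f)
    (hfrac : ∀ f : S, ∃ d ∈ P₂, d ≠ 0 ∧ d * f ∈ P₂) (B : Matrix ι ι F₀) (hB : B.det ≠ 0) :
    ∃ A C : Matrix ι ι F₀, (∀ i j, A i j ∈ PowerSeries.coeffSubfield P₂ F₀) ∧
      (∀ i j, C i j ∈ PowerSeries.coeffSubfield P₁ F₀) ∧ C.det ≠ 0 ∧ A * B = C := by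
  let φ := algebraMap (PowerSeries S) F₀
  have hφ : Function.Injective φ := IsFractionRing.injective _ _
  obtain ⟨B', j, hj⟩ := PowerSeries.exists_matrix_mul_X_pow_eq (S := S) B⁻¹
  have hX : ∀ j, φ (PowerSeries.X ^ j) ≠ 0 := fun j => by
    rw [Ne, map_eq_zero_iff _ hφ]; exact pow_ne_zero _ PowerSeries.X_ne_zero
  have hBu : IsUnit B.det := hB.isUnit
  have hB' : B'.det ≠ 0 := by
    intro h
    have : (B'.map φ).det = 0 := by
      rw [← RingHom.mapMatrix_apply, ← RingHom.map_det, h, map_zero]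
    rw [← hj, Matrix.det_smul, mul_eq_zero] at this
    rcases this with h | h
    · exact pow_ne_zero _ (hX j) h
    · rw [Matrix.det_nonsing_inv, Ring.inverse_eq_inv'] at h
      exact inv_ne_zero hB h
  obtain ⟨d, u, hu⟩ := IsDiscreteValuationRing.associated_pow_irreducible hB'
    PowerSeries.X_irreducible
  let T : Matrix ι ι (PowerSeries S) := Matrix.of fun i i' =>
    ∑ m ∈ Finset.range (d + 1), PowerSeries.C (PowerSeries.coeff m (B' i i')) * PowerSeries.X ^ m
  have hT : ∀ i i', (PowerSeries.X : PowerSeries S) ^ (d + 1) ∣ B' i i' - T i i' := by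
    intro i i'
    rw [PowerSeries.X_pow_dvd_iff]
    intro m hm
    simp only [T, Matrix.of_apply, map_sub, map_sum, PowerSeries.coeff_C_mul,
      PowerSeries.coeff_X_pow]
    rw [Finset.sum_eq_single m]
    · simp
    · intro b _ hb; simp [hb.symm]
    · intro h; exact absurd (Finset.mem_range.2 hm) h
  choose D hD using hT
  have hTD : T = B' - (PowerSeries.X : PowerSeries S) ^ (d + 1) • Matrix.of D := by
    ext1 i i'
    rw [Matrix.sub_apply, Matrix.smul_apply, Matrix.of_apply, smul_eq_mul, ← hD]
    abel
  let W : Matrix ι ι (PowerSeries S) :=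
    1 - (PowerSeries.X * (u : PowerSeries S)) • (Matrix.of D * B'.adjugate)
  have hW : W * B' = T := by
    rw [hTD, sub_mul, one_mul, Matrix.smul_mul, Matrix.mul_assoc, Matrix.adjugate_mul,
      Matrix.mul_smul, Matrix.mul_one, smul_smul]
    congr 2
    linear_combination PowerSeries.X * hu
  have hWc : W.map PowerSeries.constantCoeff = 1 := by
    ext i i'
    simp [W, Matrix.one_apply, apply_ite]
  obtain ⟨U₂, U₁, hU, hU₂, hU₁, hU₂m, hU₁m⟩ := PowerSeries.exists_matrix_factorization hP W hWc
  have hdet : ∀ U : Matrix ι ι (PowerSeries S), U.map PowerSeries.constantCoeff = 1 →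
      φ U.det ≠ 0 := by
    intro U h h0
    rw [map_eq_zero_iff _ hφ] at h0
    have := RingHom.map_det (PowerSeries.constantCoeff (R := S)) U
    rw [RingHom.mapMatrix_apply, h, h0] at this
    simp at this
  have hmapdet : ∀ U : Matrix ι ι (PowerSeries S), (U.map φ).det = φ U.det := fun U => by
    rw [← RingHom.mapMatrix_apply, ← RingHom.map_det]
  have hTm : ∀ i i', (T.map φ) i i' ∈ PowerSeries.coeffSubfield P₂ F₀ := by
    intro i i'
    simp only [T, Matrix.map_apply, Matrix.of_apply, map_sum, map_mul]
    exact sum_mem fun m _ => mul_mem (PowerSeries.algebraMap_C_mem_coeffSubfield hfrac _)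
      (PowerSeries.algebraMap_mem_coeffSubfield (pow_mem (PowerSeries.X_mem_coeffSubring _) _))
  have hU₂F : ∀ i i', (U₂.map φ) i i' ∈ PowerSeries.coeffSubfield P₂ F₀ := fun i i' =>
    PowerSeries.algebraMap_mem_coeffSubfield (hU₂m i i')
  obtain ⟨V, hV⟩ : ∃ V : Matrix ι ι (PowerSeries.coeffSubfield P₂ F₀), V.map Subtype.val = U₂.map φ :=
    ⟨Matrix.of fun i i' => ⟨_, hU₂F i i'⟩, rfl⟩
  refine ⟨(φ (PowerSeries.X ^ j))⁻¹ • (((φ U₂.det)⁻¹ • (U₂.map φ).adjugate) * T.map φ),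
    U₁.map φ, fun i i' => ?_, fun i i' => PowerSeries.algebraMap_mem_coeffSubfield (hU₁m i i'),
    (hmapdet U₁).symm ▸ hdet U₁ hU₁, ?_⟩
  · have hadj : ∀ i i', ((U₂.map φ).adjugate) i i' ∈ PowerSeries.coeffSubfield P₂ F₀ := by
      intro i i'
      have : (U₂.map φ).adjugate = (V.adjugate).map Subtype.val := by
        rw [← hV]
        exact (RingHom.map_adjugate (PowerSeries.coeffSubfield P₂ F₀).subtype V).symm
      rw [this]
      exact (V.adjugate i i').2
    have hd : φ U₂.det ∈ PowerSeries.coeffSubfield P₂ F₀ := by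
      have : φ U₂.det = ((V.det : PowerSeries.coeffSubfield P₂ F₀) : F₀) := by
        rw [← hmapdet, ← hV]
        exact (RingHom.map_det (PowerSeries.coeffSubfield P₂ F₀).subtype V).symm
      rw [this]
      exact V.det.2
    rw [Matrix.smul_apply, smul_eq_mul, Matrix.mul_apply]
    refine mul_mem (inv_mem (PowerSeries.algebraMap_mem_coeffSubfield
      (pow_mem (PowerSeries.X_mem_coeffSubring _) _))) (sum_mem fun m _ => mul_mem ?_ (hTm _ _))
    rw [Matrix.smul_apply, smul_eq_mul]
    exact mul_mem (inv_mem hd) (hadj _ _)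
  · have h1 : B'.map φ * B = φ (PowerSeries.X ^ j) • (1 : Matrix ι ι F₀) := by
      rw [← hj, Matrix.smul_mul, Matrix.nonsing_inv_mul _ hBu]
    have h2 : T.map φ * B = φ (PowerSeries.X ^ j) • (U₂.map φ * U₁.map φ) := by
      rw [← hW, ← hU, Matrix.map_mul, Matrix.map_mul, Matrix.mul_assoc, h1, Matrix.mul_smul,
        Matrix.mul_one]
    rw [Matrix.smul_mul, Matrix.mul_assoc, h2, Matrix.mul_smul, smul_smul,
      inv_mul_cancel₀ (hX j), one_smul, ← Matrix.mul_assoc, Matrix.smul_mul, Matrix.adjugate_mul,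
      smul_smul, hmapdet, inv_mul_cancel₀ (hdet U₂ hU₂), one_smul, one_mul]

theorem PowerSeries.patchingProperty_coeffSubfield
    (hP : ∀ f : S, ∃ g ∈ P₂, ∃ h ∈ P₁, g + h = f)
    (hfrac : ∀ f : S, ∃ d ∈ P₂, d ≠ 0 ∧ d * f ∈ P₂) :
    PatchingProperty (PowerSeries.coeffSubfield P₁ F₀) (PowerSeries.coeffSubfield P₂ F₀) := by
  classical
  intro ι _ g₁ g₂
  have := Fintype.ofFinite ι
  have hdet : ∀ g : Module.Basis ι F₀ (ι → F₀), (Matrix.of g).det ≠ 0 := by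
    intro g
    have := (Matrix.linearIndependent_rows_iff_isUnit (A := Matrix.of g)).1 g.linearIndependent
    exact ((Matrix.isUnit_iff_isUnit_det _).1 this).ne_zero
  obtain ⟨A, C, hA, hC, hCdet, hAC⟩ := PowerSeries.exists_matrix_mul_eq hP hfrac
    (Matrix.of g₂ * (Matrix.of g₁)⁻¹) (by
      rw [Matrix.det_mul, Matrix.det_nonsing_inv, Ring.inverse_eq_inv']
      exact mul_ne_zero (hdet g₂) (inv_ne_zero (hdet g₁)))
  have hAC' : A * Matrix.of g₂ = C * Matrix.of g₁ := by
    rw [← hAC, Matrix.mul_assoc, Matrix.mul_assoc, Matrix.nonsing_inv_mul _ (hdet g₁).isUnit,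
      Matrix.mul_one]
  have hrow : ∀ (M : Matrix ι ι F₀) (g : Module.Basis ι F₀ (ι → F₀)) (F : Subfield F₀),
      (∀ i j, M i j ∈ F) → ∀ i, (M * Matrix.of g).row i ∈ Submodule.span F (Set.range g) := by
    intro M g F hM i
    have : (M * Matrix.of g).row i = ∑ j, (⟨M i j, hM i j⟩ : F) • g j := by
      ext l
      simp only [Matrix.row, Matrix.mul_apply, Finset.sum_apply, Pi.smul_apply, Matrix.of_apply]
      rfl
    rw [this]
    exact Submodule.sum_mem _ fun j _ => Submodule.smul_mem _ _ (Submodule.subset_span ⟨j, rfl⟩)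
  have hli : LinearIndependent F₀ (C * Matrix.of g₁).row := by
    rw [Matrix.linearIndependent_rows_iff_isUnit, Matrix.isUnit_iff_isUnit_det, Matrix.det_mul]
    exact (mul_ne_zero hCdet (hdet g₁)).isUnit
  rw [eq_top_iff, ← hli.span_eq_top_of_card_eq_finrank' (by simp)]
  refine Submodule.span_mono ?_
  rintro _ ⟨i, rfl⟩
  refine ⟨hrow C g₁ _ hC i, ?_⟩
  rw [← hAC']
  exact hrow A g₂ _ hA i

end PatchingPropertyOfSeries

section LaurentCoefficients

variable {k : Type} [Field k]

/-- The coefficients of the power series vanish below `e`. -/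
def PowerSeries.LowerBounded (e : ℤ) (f : PowerSeries (LaurentSeries k)) : Prop :=
  ∀ n i, i < e → (PowerSeries.coeff n f).coeff i = 0

/-- The coefficients of the power series vanish above `e`. -/
def PowerSeries.UpperBounded (e : ℤ) (f : PowerSeries (LaurentSeries k)) : Prop :=
  ∀ n i, e < i → (PowerSeries.coeff n f).coeff i = 0

theorem PowerSeries.LowerBounded.mul {e e' : ℤ} {f g : PowerSeries (LaurentSeries k)}
    (hf : f.LowerBounded e) (hg : g.LowerBounded e') : (f * g).LowerBounded (e + e') := by
  intro n i hi
  rw [PowerSeries.coeff_mul, HahnSeries.coeff_sum]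
  refine Finset.sum_eq_zero fun p _ => ?_
  rw [HahnSeries.coeff_mul]
  refine Finset.sum_eq_zero fun q hq => ?_
  rw [Finset.mem_antidiagonal] at hq
  rcases lt_or_ge q.1 e with h | h
  · rw [hf _ _ h, zero_mul]
  · rw [hg _ _ (by omega), mul_zero]

theorem PowerSeries.UpperBounded.mul {e e' : ℤ} {f g : PowerSeries (LaurentSeries k)}
    (hf : f.UpperBounded e) (hg : g.UpperBounded e') : (f * g).UpperBounded (e + e') := by
  intro n i hi
  rw [PowerSeries.coeff_mul, HahnSeries.coeff_sum]
  refine Finset.sum_eq_zero fun p _ => ?_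
  rw [HahnSeries.coeff_mul]
  refine Finset.sum_eq_zero fun q hq => ?_
  rw [Finset.mem_antidiagonal] at hq
  rcases lt_or_ge e q.1 with h | h
  · rw [hf _ _ h, zero_mul]
  · rw [hg _ _ (by omega), mul_zero]

theorem PowerSeries.lowerBounded_of_mem {f : PowerSeries (LaurentSeries k)}
    (hf : f ∈ PowerSeries.coeffSubring (LaurentSeries.nonnegPart k)) : f.LowerBounded 0 :=
  fun n i hi => PowerSeries.mem_coeffSubring.1 hf n i hi

theorem PowerSeries.upperBounded_of_mem {f : PowerSeries (LaurentSeries k)}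
    (hf : f ∈ PowerSeries.coeffSubring (LaurentSeries.nonposPart k)) : f.UpperBounded 0 :=
  fun n i hi => PowerSeries.mem_coeffSubring.1 hf n i hi

theorem PowerSeries.lowerBounded_C (β : LaurentSeries k) :
    (PowerSeries.C β : PowerSeries (LaurentSeries k)).LowerBounded β.order := by
  intro n i hi
  rw [PowerSeries.coeff_C]
  split_ifs
  · exact HahnSeries.coeff_eq_zero_of_lt_order hi
  · rfl

theorem PowerSeries.lowerBounded_X_pow (n : ℕ) :
    (PowerSeries.X ^ n : PowerSeries (LaurentSeries k)).LowerBounded 0 :=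
  PowerSeries.lowerBounded_of_mem (pow_mem (PowerSeries.X_mem_coeffSubring _) n)

theorem PowerSeries.upperBounded_X_pow (n : ℕ) :
    (PowerSeries.X ^ n : PowerSeries (LaurentSeries k)).UpperBounded 0 :=
  PowerSeries.upperBounded_of_mem (pow_mem (PowerSeries.X_mem_coeffSubring _) n)

variable {F₀ : Type*} [Field F₀] [Algebra (PowerSeries (LaurentSeries k)) F₀]

variable (k F₀) in
/-- The subfield of the field of fractions of `k((s))[[t]]` generated by `k[[t]]` and `s`. -/
noncomputable def baseSubfield : Subfield F₀ :=
  Subfield.closure (insert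
    (algebraMap (PowerSeries (LaurentSeries k)) F₀ (PowerSeries.C (HahnSeries.single 1 1)))
    (algebraMap (PowerSeries (LaurentSeries k)) F₀ ''
      Set.range (PowerSeries.map (HahnSeries.C (Γ := ℤ) (R := k)))))

theorem algebraMap_map_C_mem_baseSubfield (a : PowerSeries k) :
    algebraMap (PowerSeries (LaurentSeries k)) F₀ (PowerSeries.map HahnSeries.C a) ∈
      baseSubfield k F₀ :=
  Subfield.subset_closure (Or.inr ⟨_, ⟨a, rfl⟩, rfl⟩)

theorem algebraMap_C_single_mem_baseSubfield (n : ℤ) :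
    algebraMap (PowerSeries (LaurentSeries k)) F₀ (PowerSeries.C (HahnSeries.single n 1)) ∈
      baseSubfield k F₀ := by
  have h : algebraMap (PowerSeries (LaurentSeries k)) F₀ (PowerSeries.C (HahnSeries.single n 1)) =
    (algebraMap (PowerSeries (LaurentSeries k)) F₀
      (PowerSeries.C (HahnSeries.single 1 1))) ^ n := by
    rw [RatFunc.single_zpow]
    exact map_zpow₀ ((algebraMap (PowerSeries (LaurentSeries k)) F₀).comp
      (PowerSeries.C (R := LaurentSeries k))) _ n
  rw [h]
  exact zpow_mem (Subfield.subset_closure (Set.mem_insert _ _)) n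

theorem algebraMap_mem_baseSubfield {f : PowerSeries (LaurentSeries k)} {a b : ℤ}
    (ha : f.LowerBounded a) (hb : f.UpperBounded b) :
    algebraMap (PowerSeries (LaurentSeries k)) F₀ f ∈ baseSubfield k F₀ := by
  have h : f = ∑ i ∈ Finset.Icc a b, PowerSeries.C (HahnSeries.single i 1) *
      PowerSeries.map HahnSeries.C (PowerSeries.mk fun n => (PowerSeries.coeff n f).coeff i) := by
    ext n m
    rw [map_sum, HahnSeries.coeff_sum]
    have : ∀ i, (PowerSeries.coeff n (PowerSeries.C (HahnSeries.single i (1 : k)) *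
        PowerSeries.map HahnSeries.C (PowerSeries.mk fun n => (PowerSeries.coeff n f).coeff i)) :
        LaurentSeries k).coeff m = if i = m then (PowerSeries.coeff n f).coeff i else 0 := by
      intro i
      rw [PowerSeries.coeff_C_mul, PowerSeries.coeff_map, PowerSeries.coeff_mk,
        HahnSeries.coeff_single_mul, one_mul, HahnSeries.C_apply, HahnSeries.coeff_single]
      simp only [sub_eq_zero, eq_comm]
    simp only [this, Finset.sum_ite_eq']
    split_ifs with hm
    · rfl
    · rw [Finset.mem_Icc, not_and_or, not_le, not_le] at hm
      rcases hm with hm | hm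
      · exact ha _ _ hm
      · exact hb _ _ hm
  rw [h, map_sum]
  refine sum_mem fun i _ => ?_
  rw [map_mul]
  exact mul_mem (algebraMap_C_single_mem_baseSubfield i) (algebraMap_map_C_mem_baseSubfield _)

theorem baseSubfield_le_coeffSubfield_nonneg :
    baseSubfield k F₀ ≤ PowerSeries.coeffSubfield (LaurentSeries.nonnegPart k) F₀ := by
  refine Subfield.closure_le.2 (Set.insert_subset ?_ ?_)
  · refine PowerSeries.algebraMap_mem_coeffSubfield (PowerSeries.C_mem_coeffSubring fun n hn => ?_)
    rw [HahnSeries.coeff_single_of_ne (by omega)]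
  · rintro _ ⟨_, ⟨a, rfl⟩, rfl⟩
    refine PowerSeries.algebraMap_mem_coeffSubfield (PowerSeries.mem_coeffSubring.2 fun n i hi => ?_)
    rw [PowerSeries.coeff_map, HahnSeries.C_apply, HahnSeries.coeff_single_of_ne hi.ne]

theorem baseSubfield_le_coeffSubfield_nonpos :
    baseSubfield k F₀ ≤ PowerSeries.coeffSubfield (LaurentSeries.nonposPart k) F₀ := by
  refine Subfield.closure_le.2 (Set.insert_subset ?_ ?_)
  · have h : algebraMap (PowerSeries (LaurentSeries k)) F₀
        (PowerSeries.C (HahnSeries.single (-1) 1)) ∈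
        PowerSeries.coeffSubfield (LaurentSeries.nonposPart k) F₀ := by
      refine PowerSeries.algebraMap_mem_coeffSubfield
        (PowerSeries.C_mem_coeffSubring fun n hn => ?_)
      rw [HahnSeries.coeff_single_of_ne (by omega)]
    have h' : algebraMap (PowerSeries (LaurentSeries k)) F₀
        (PowerSeries.C (HahnSeries.single 1 1)) * algebraMap (PowerSeries (LaurentSeries k)) F₀
        (PowerSeries.C (HahnSeries.single (-1) 1)) = 1 := by
      rw [← map_mul, ← map_mul, HahnSeries.single_mul_single]
      simp
    rw [eq_inv_of_mul_eq_one_left h']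
    exact inv_mem h
  · rintro _ ⟨_, ⟨a, rfl⟩, rfl⟩
    refine PowerSeries.algebraMap_mem_coeffSubfield (PowerSeries.mem_coeffSubring.2 fun n i hi => ?_)
    rw [PowerSeries.coeff_map, HahnSeries.C_apply, HahnSeries.coeff_single_of_ne hi.ne']

theorem PowerSeries.exists_factorization_of_ne_zero {f : PowerSeries (LaurentSeries k)}
    (hf : f ≠ 0) : ∃ (j : ℕ) (β : LaurentSeries k),
      ∃ u₂ ∈ PowerSeries.coeffSubring (LaurentSeries.nonnegPart k),
      ∃ u₁ ∈ PowerSeries.coeffSubring (LaurentSeries.nonposPart k), β ≠ 0 ∧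
        PowerSeries.constantCoeff u₂ = 1 ∧ PowerSeries.constantCoeff u₁ = 1 ∧
        f = PowerSeries.X ^ j * PowerSeries.C β * u₂ * u₁ := by
  obtain ⟨j, u, hu⟩ := IsDiscreteValuationRing.associated_pow_irreducible hf
    PowerSeries.X_irreducible
  set v : PowerSeries (LaurentSeries k) :=
    ((u⁻¹ : (PowerSeries (LaurentSeries k))ˣ) : PowerSeries (LaurentSeries k)) with hv
  have hfv : f = PowerSeries.X ^ j * v := by rw [← hu, mul_assoc, hv, Units.mul_inv, mul_one]
  set β := PowerSeries.constantCoeff v with hβ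
  have hβ0 : β ≠ 0 := by
    have := (u⁻¹).isUnit
    rw [PowerSeries.isUnit_iff_constantCoeff] at this
    exact this.ne_zero
  obtain ⟨A, B, hAB, hA, hB, hA', hB'⟩ := PowerSeries.exists_matrix_factorization (ι := Unit)
    (P₁ := LaurentSeries.nonposPart k) (P₂ := LaurentSeries.nonnegPart k)
    LaurentSeries.exists_add_eq (Matrix.of fun _ _ => PowerSeries.C β⁻¹ * v) (by
      ext1 i j
      simp [← hβ, inv_mul_cancel₀ hβ0])
  refine ⟨j, β, A () (), hA' _ _, B () (), hB' _ _, hβ0, by simpa using congrFun (congrFun hA ()) (),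
    by simpa using congrFun (congrFun hB ()) (), ?_⟩
  have h := congrFun (congrFun hAB ()) ()
  rw [Matrix.mul_apply] at h
  simp only [Finset.univ_unique, Finset.sum_singleton, Matrix.of_apply] at h
  rw [mul_assoc _ (A () ()), show A () () * B () () = _ from h, hfv, mul_assoc, ← mul_assoc (PowerSeries.C β), ← map_mul,
    mul_inv_cancel₀ hβ0, map_one, one_mul]

variable [IsFractionRing (PowerSeries (LaurentSeries k)) F₀]

theorem coeffSubfield_inf_coeffSubfield :
    PowerSeries.coeffSubfield (LaurentSeries.nonposPart k) F₀ ⊓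
      PowerSeries.coeffSubfield (LaurentSeries.nonnegPart k) F₀ = baseSubfield k F₀ := by
  refine le_antisymm ?_
    (le_inf baseSubfield_le_coeffSubfield_nonpos baseSubfield_le_coeffSubfield_nonneg)
  rintro z ⟨h₁, h₂⟩
  by_cases hz : z = 0
  · rw [hz]; exact zero_mem _
  obtain ⟨a₁, ha₁, b₁, hb₁, hz₁⟩ := PowerSeries.mem_coeffSubfield_iff.1 h₁
  obtain ⟨a₂, ha₂, b₂, hb₂, hz₂⟩ := PowerSeries.mem_coeffSubfield_iff.1 h₂
  have hφ : Function.Injective (algebraMap (PowerSeries (LaurentSeries k)) F₀) :=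
    IsFractionRing.injective _ _
  have hb₁0 : algebraMap (PowerSeries (LaurentSeries k)) F₀ b₁ ≠ 0 := by
    intro h; rw [h, div_zero] at hz₁; exact hz hz₁.symm
  have hb₂0 : algebraMap (PowerSeries (LaurentSeries k)) F₀ b₂ ≠ 0 := by
    intro h; rw [h, div_zero] at hz₂; exact hz hz₂.symm
  obtain ⟨j, β, u₂, hu₂, u₁, hu₁, hβ, hu₂1, hu₁1, hb⟩ :=
    PowerSeries.exists_factorization_of_ne_zero (k := k) (f := b₁) (by rintro rfl; simp at hb₁0)
  obtain ⟨j', β', v₂, hv₂, v₁, hv₁, hβ', hv₂1, hv₁1, hb'⟩ :=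
    PowerSeries.exists_factorization_of_ne_zero (k := k) (f := b₂) (by rintro rfl; simp at hb₂0)
  obtain ⟨w, hw, huw⟩ := PowerSeries.exists_inv_mem_coeffSubring hu₁ hu₁1
  obtain ⟨w', hw', hvw'⟩ := PowerSeries.exists_inv_mem_coeffSubring hv₂ hv₂1
  have hq₁ : b₁ * w = PowerSeries.X ^ j * PowerSeries.C β * u₂ := by
    rw [hb, mul_assoc, huw, mul_one]
  have hββ : PowerSeries.C (R := LaurentSeries k) β' * PowerSeries.C β'⁻¹ = 1 := by
    rw [← map_mul, mul_inv_cancel₀ hβ', map_one]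
  have hq₂ : b₂ * (w' * PowerSeries.C β'⁻¹) = PowerSeries.X ^ j' * v₁ := by
    rw [hb']
    linear_combination (PowerSeries.X ^ j' * v₁ * v₂ * w') * hββ + (PowerSeries.X ^ j' * v₁) * hvw'
  set φ := algebraMap (PowerSeries (LaurentSeries k)) F₀ with hφd
  have hr : a₁ * w * (b₂ * (w' * PowerSeries.C β'⁻¹)) =
      a₂ * (w' * PowerSeries.C β'⁻¹) * (b₁ * w) := by
    apply hφ
    have h : φ a₁ * φ b₂ = φ a₂ * φ b₁ := by
      rw [div_eq_iff hb₁0] at hz₁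
      rw [div_eq_iff hb₂0] at hz₂
      rw [hz₁, hz₂]
      ring
    simp only [map_mul]
    linear_combination (φ w * φ w' * φ (PowerSeries.C β'⁻¹)) * h
  have hw0 : φ w ≠ 0 := fun h => by
    have := congrArg φ huw
    rw [map_mul, h, mul_zero, map_one] at this
    exact zero_ne_one this
  have hw'0 : φ (w' * PowerSeries.C β'⁻¹) ≠ 0 := fun h => by
    have := congrArg φ (show v₂ * (w' * PowerSeries.C β'⁻¹) * PowerSeries.C β' = 1 by
      linear_combination (v₂ * w') * hββ + hvw')
    rw [map_mul, map_mul, h, mul_zero, zero_mul, map_one] at this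
    exact zero_ne_one this
  have hu₂L := PowerSeries.lowerBounded_of_mem hu₂
  have hq₁L : (b₁ * w).LowerBounded (0 + β.order + 0) :=
    hq₁ ▸ ((PowerSeries.lowerBounded_X_pow j).mul (PowerSeries.lowerBounded_C β)).mul hu₂L
  have hq₁U : (b₁ * w).UpperBounded (0 + 0) :=
    (PowerSeries.upperBounded_of_mem hb₁).mul (PowerSeries.upperBounded_of_mem hw)
  have hw'L := (PowerSeries.lowerBounded_of_mem hw').mul (PowerSeries.lowerBounded_C β'⁻¹)
  have hq₂L := (PowerSeries.lowerBounded_of_mem hb₂).mul hw'L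
  have hq₂U : (b₂ * (w' * PowerSeries.C β'⁻¹)).UpperBounded (0 + 0) :=
    hq₂ ▸ (PowerSeries.upperBounded_X_pow j').mul (PowerSeries.upperBounded_of_mem hv₁)
  have hrU := ((PowerSeries.upperBounded_of_mem ha₁).mul
    (PowerSeries.upperBounded_of_mem hw)).mul hq₂U
  have hrL := hr ▸ ((PowerSeries.lowerBounded_of_mem ha₂).mul hw'L).mul hq₁L
  have hz : z = φ (a₁ * w * (b₂ * (w' * PowerSeries.C β'⁻¹))) / φ (b₁ * w) /
      φ (b₂ * (w' * PowerSeries.C β'⁻¹)) := by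
    rw [← hz₁]
    generalize w' * PowerSeries.C β'⁻¹ = c at hw'0
    simp only [map_mul]
    field_simp
  rw [hz]
  exact div_mem (div_mem (algebraMap_mem_baseSubfield hrL hrU)
    (algebraMap_mem_baseSubfield hq₁L hq₁U)) (algebraMap_mem_baseSubfield hq₂L hq₂U)

end LaurentCoefficients

section ConstantsOfSeries

variable {k : Type} [Field k]

theorem LaurentSeries.not_isAlgebraic_of_order_pos {γ : LaurentSeries k} (h0 : γ ≠ 0) (ho : 0 < γ.order) :
    ¬ IsAlgebraic k γ := by
  intro h
  have hintg : IsIntegral k γ := h.isIntegral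
  have hmin := minpoly.aeval k γ
  have hdiv := Polynomial.divX_mul_X_add (minpoly k γ)
  rw [← hdiv] at hmin
  simp only [map_add, map_mul, Polynomial.aeval_X, Polynomial.aeval_C] at hmin
  have hγ : γ ∈ LaurentSeries.nonnegPart k := fun n hn =>
    HahnSeries.coeff_eq_zero_of_lt_order (hn.trans ho)
  have hC : ∀ a : k, algebraMap k (LaurentSeries k) a = HahnSeries.C a := fun a =>
    LaurentSeries.algebraMap_apply k a
  have hmem : Polynomial.aeval γ (minpoly k γ).divX ∈ LaurentSeries.nonnegPart k := by
    rw [Polynomial.aeval_eq_sum_range]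
    refine sum_mem fun i _ => ?_
    rw [Algebra.smul_def, hC]
    refine mul_mem (fun n hn => ?_) (pow_mem hγ i)
    rw [HahnSeries.C_apply, HahnSeries.coeff_single_of_ne hn.ne]
  have hz := congrArg (fun f : LaurentSeries k => f.coeff 0) hmin
  simp only [HahnSeries.coeff_add, hC, HahnSeries.C_apply, HahnSeries.coeff_single_same,
    HahnSeries.coeff_zero, HahnSeries.coeff_mul] at hz
  rw [Finset.sum_eq_zero, zero_add] at hz
  · exact minpoly.coeff_zero_ne_zero hintg h0 hz
  · intro p hp
    rw [Finset.mem_antidiagonal] at hp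
    rcases lt_or_ge p.1 0 with h | h
    · rw [hmem _ h, zero_mul]
    · rw [HahnSeries.coeff_eq_zero_of_lt_order (x := γ) (by omega), mul_zero]

theorem LaurentSeries.exists_eq_C_of_isAlgebraic {β : LaurentSeries k} (h : IsAlgebraic k β) :
    ∃ c : k, β = HahnSeries.C c := by
  have hC : ∀ a : k, algebraMap k (LaurentSeries k) a = HahnSeries.C a := fun a =>
    LaurentSeries.algebraMap_apply k a
  by_cases hβ : β = 0
  · exact ⟨0, by simp [hβ]⟩
  rcases lt_trichotomy β.order 0 with ho | ho | ho
  · have h' : IsAlgebraic k β⁻¹ := h.inv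
    refine absurd h' (LaurentSeries.not_isAlgebraic_of_order_pos (inv_ne_zero hβ) ?_)
    have := HahnSeries.order_mul hβ (inv_ne_zero hβ)
    rw [mul_inv_cancel₀ hβ, HahnSeries.order_one] at this
    omega
  · refine ⟨β.coeff 0, ?_⟩
    by_contra hne
    have h0 : β - HahnSeries.C (β.coeff 0) ≠ 0 := sub_ne_zero.2 hne
    refine LaurentSeries.not_isAlgebraic_of_order_pos h0 ?_ (h.sub (hC _ ▸ isAlgebraic_algebraMap _))
    have hcoe : ∀ n : ℤ, n ≤ 0 → (β - HahnSeries.C (β.coeff 0)).coeff n = 0 := by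
      intro n hn
      rw [HahnSeries.coeff_sub, HahnSeries.C_apply]
      rcases hn.lt_or_eq with hn | rfl
      · rw [HahnSeries.coeff_single_of_ne hn.ne, HahnSeries.coeff_eq_zero_of_lt_order (by omega),
          sub_zero]
      · rw [HahnSeries.coeff_single_same, sub_self]
    by_contra hle
    exact h0 (HahnSeries.coeff_order_eq_zero.1 (hcoe _ (not_lt.1 hle)))
  · exact absurd h (LaurentSeries.not_isAlgebraic_of_order_pos hβ ho)

theorem Polynomial.exists_map_constantCoeff_ne_zero {p : Polynomial (PowerSeries k)} (hp : p ≠ 0) :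
    ∃ (n : ℕ) (q : Polynomial (PowerSeries k)), q.map PowerSeries.constantCoeff ≠ 0 ∧
      p = Polynomial.C (PowerSeries.X ^ n) * q := by
  have hirr : Irreducible (Polynomial.C (PowerSeries.X : PowerSeries k)) :=
    (Polynomial.prime_C_iff.2 PowerSeries.X_prime).irreducible
  obtain ⟨n, q, hq, h⟩ := WfDvdMonoid.max_power_factor hp hirr
  refine ⟨n, q, fun h0 => hq ?_, by rw [h, map_pow]⟩
  rw [Polynomial.C_dvd_iff_dvd_coeff]
  intro i
  rw [PowerSeries.X_dvd_iff, ← Polynomial.coeff_map, h0, Polynomial.coeff_zero]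

variable {F : Type*} [Field F] [Algebra (PowerSeries k) F] [IsFractionRing (PowerSeries k) F]
  {F₀ : Type*} [Field F₀] [Algebra (PowerSeries (LaurentSeries k)) F₀]
  [IsFractionRing (PowerSeries (LaurentSeries k)) F₀] [Algebra F F₀]

theorem PowerSeries.constantCoeff_mem_of_isAlgebraic
    (hF : ∀ a : PowerSeries k, algebraMap F F₀ (algebraMap _ F a) =
      algebraMap (PowerSeries (LaurentSeries k)) F₀ (PowerSeries.map HahnSeries.C a))
    {r : PowerSeries (LaurentSeries k)} (hr : IsAlgebraic F (algebraMap _ F₀ r)) :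
    ∃ c : k, PowerSeries.constantCoeff r = HahnSeries.C c := by
  let := ((algebraMap F F₀).comp (algebraMap (PowerSeries k) F)).toAlgebra
  have : IsScalarTower (PowerSeries k) F F₀ := IsScalarTower.of_algebraMap_eq fun _ => rfl
  rw [← IsFractionRing.isAlgebraic_iff (PowerSeries k) F F₀] at hr
  obtain ⟨p, hp, hpr⟩ := hr
  obtain ⟨n, q, hq, rfl⟩ := Polynomial.exists_map_constantCoeff_ne_zero hp
  have hφ : Function.Injective (algebraMap (PowerSeries (LaurentSeries k)) F₀) :=
    IsFractionRing.injective _ _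
  have halg : algebraMap (PowerSeries k) F₀ = (algebraMap _ F₀).comp
      (PowerSeries.map (HahnSeries.C (Γ := ℤ) (R := k))) := RingHom.ext hF
  have hq0 : q.eval₂ (PowerSeries.map (HahnSeries.C (Γ := ℤ) (R := k))) r = 0 := by
    apply hφ
    rw [map_mul, Polynomial.aeval_C, mul_eq_zero] at hpr
    rcases hpr with h | h
    · rw [halg, RingHom.comp_apply, map_eq_zero_iff _ hφ, map_pow, PowerSeries.map_X] at h
      exact absurd h (pow_ne_zero _ PowerSeries.X_ne_zero)
    · rw [Polynomial.aeval_def, halg, ← Polynomial.hom_eval₂] at h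
      rw [map_zero]; exact h
  apply LaurentSeries.exists_eq_C_of_isAlgebraic
  refine ⟨_, hq, ?_⟩
  have := congrArg PowerSeries.constantCoeff hq0
  rw [Polynomial.hom_eval₂, map_zero] at this
  rw [Polynomial.aeval_def, Polynomial.eval₂_map, ← this]
  congr 1
  ext1 a
  rw [RingHom.comp_apply, RingHom.comp_apply, LaurentSeries.algebraMap_apply,
    ← PowerSeries.coeff_zero_eq_constantCoeff_apply, ← PowerSeries.coeff_zero_eq_constantCoeff_apply,
    PowerSeries.coeff_map]

theorem mem_range_algebraMap_of_isAlgebraic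
    (hF : ∀ a : PowerSeries k, algebraMap F F₀ (algebraMap _ F a) =
      algebraMap (PowerSeries (LaurentSeries k)) F₀ (PowerSeries.map HahnSeries.C a))
    {z : F₀} (hz : IsAlgebraic F z) : z ∈ (algebraMap F F₀).range := by
  obtain ⟨r, j, hrj⟩ := PowerSeries.exists_mul_X_pow_eq (S := LaurentSeries k) z
  have hφ : Function.Injective (algebraMap (PowerSeries (LaurentSeries k)) F₀) :=
    IsFractionRing.injective _ _
  have hX : ∀ j, algebraMap (PowerSeries (LaurentSeries k)) F₀ (PowerSeries.X ^ j) =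
      algebraMap F F₀ (algebraMap (PowerSeries k) F (PowerSeries.X ^ j)) := fun j => by
    rw [hF, map_pow (PowerSeries.map _), PowerSeries.map_X]
  have hX0 : ∀ j, algebraMap (PowerSeries (LaurentSeries k)) F₀ (PowerSeries.X ^ j) ≠ 0 :=
    fun j => by
      rw [Ne, map_eq_zero_iff _ hφ]
      exact pow_ne_zero _ PowerSeries.X_ne_zero
  have hr : IsAlgebraic F (algebraMap _ F₀ r) := by
    rw [← hrj, hX]
    exact (isAlgebraic_algebraMap _).mul hz
  have key : ∀ (n : ℕ) (r : PowerSeries (LaurentSeries k)), IsAlgebraic F (algebraMap _ F₀ r) →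
      ∃ c : k, PowerSeries.coeff n r = HahnSeries.C c := by
    intro n
    induction n with
    | zero =>
      intro r hr
      rw [PowerSeries.coeff_zero_eq_constantCoeff_apply]
      exact PowerSeries.constantCoeff_mem_of_isAlgebraic hF hr
    | succ n ih =>
      intro r hr
      obtain ⟨c, hc⟩ := PowerSeries.constantCoeff_mem_of_isAlgebraic hF hr
      obtain ⟨r', hr'⟩ : (PowerSeries.X : PowerSeries (LaurentSeries k)) ∣
          r - PowerSeries.map HahnSeries.C (PowerSeries.C c) := by
        rw [PowerSeries.X_dvd_iff, map_sub, hc]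
        simp
      have hr'alg : IsAlgebraic F (algebraMap _ F₀ r') := by
        have h1 : algebraMap _ F₀ r' = algebraMap F F₀ ((algebraMap (PowerSeries k) F
            (PowerSeries.X ^ 1))⁻¹) * (algebraMap _ F₀ r -
            algebraMap F F₀ (algebraMap _ F (PowerSeries.C c))) := by
          rw [hF, ← map_sub, hr', map_inv₀, ← hX, pow_one, map_mul, inv_mul_cancel_left₀]
          simp
        rw [h1]
        exact (isAlgebraic_algebraMap _).mul (hr.sub (isAlgebraic_algebraMap _))
      obtain ⟨c', hc'⟩ := ih r' hr'alg
      refine ⟨c', ?_⟩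
      have := congrArg (PowerSeries.coeff (n + 1)) hr'
      rw [PowerSeries.coeff_succ_X_mul, hc', map_sub, PowerSeries.map_C, PowerSeries.coeff_C,
        if_neg (Nat.succ_ne_zero n), sub_zero] at this
      exact this
  choose c hc using fun n => key n r hr
  have hrc : r = PowerSeries.map HahnSeries.C (PowerSeries.mk c) := by
    ext1 n
    rw [hc, PowerSeries.coeff_map, PowerSeries.coeff_mk]
  refine ⟨(algebraMap (PowerSeries k) F (PowerSeries.X ^ j))⁻¹ * algebraMap _ F (PowerSeries.mk c),
    ?_⟩
  rw [map_mul, map_inv₀, ← hX, hF, ← hrc, ← hrj, inv_mul_cancel_left₀ (hX0 j)]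

end ConstantsOfSeries

/-- Separatedness and completeness for the topology defined by the powers of `t`. -/
def IsPowComplete {R : Type*} [CommRing R] (t : R) : Prop :=
  (∀ x : R, (∀ n, t ^ n ∣ x) → x = 0) ∧
    ∀ f : ℕ → R, (∀ n, t ^ n ∣ f (n + 1) - f n) → ∃ L, ∀ n, t ^ n ∣ L - f n

theorem PowerSeries.isPowComplete_X {A : Type*} [CommRing A] :
    IsPowComplete (PowerSeries.X : PowerSeries A) := by
  refine ⟨fun x hx => ?_, fun f hf => ?_⟩
  · ext n
    exact PowerSeries.X_pow_dvd_iff.1 (hx (n + 1)) n (Nat.lt_succ_self n)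
  · have h1 : ∀ n d m, m < n → PowerSeries.coeff m (f (n + d)) = PowerSeries.coeff m (f n) := by
      intro n d m hm
      induction d with
      | zero => rfl
      | succ d ih =>
        rw [← ih, ← sub_eq_zero, ← map_sub]
        exact PowerSeries.X_pow_dvd_iff.1 (hf (n + d)) m (by omega)
    refine ⟨PowerSeries.mk fun n => PowerSeries.coeff n (f (n + 1)), fun n => ?_⟩
    rw [PowerSeries.X_pow_dvd_iff]
    intro m hm
    obtain ⟨d, rfl⟩ := Nat.exists_eq_add_of_lt hm
    rw [map_sub, PowerSeries.coeff_mk, sub_eq_zero,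
      show m + d + 1 = (m + 1) + d by omega, h1 (m + 1) d m (by omega)]

/-- Completeness passes to finite free algebras. -/
theorem IsPowComplete.of_basis {A R : Type*} [CommRing A] [CommRing R] [Algebra A R] {t : A}
    (ht : IsPowComplete t) {ι : Type*} [Finite ι] (b : Module.Basis ι A R) :
    IsPowComplete (algebraMap A R t) := by
  have hdvd : ∀ (n : ℕ) (z : R), (algebraMap A R t) ^ n ∣ z ↔ ∀ i, t ^ n ∣ b.repr z i := by
    have := Fintype.ofFinite ι
    intro n z
    constructor
    · rintro ⟨w, rfl⟩ i
      rw [← map_pow, ← Algebra.smul_def, map_smul, Finsupp.smul_apply, smul_eq_mul]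
      exact dvd_mul_right _ _
    · intro h
      choose c hc using h
      refine ⟨∑ i, c i • b i, ?_⟩
      rw [← map_pow, ← Algebra.smul_def, Finset.smul_sum]
      simp_rw [smul_smul, ← hc]
      exact (b.sum_repr z).symm
  refine ⟨fun x hx => ?_, fun f hf => ?_⟩
  · apply b.repr.injective
    ext i
    rw [map_zero]
    exact ht.1 _ fun n => (hdvd n x).1 (hx n) i
  · have h2 : ∀ i, ∃ L, ∀ n, t ^ n ∣ L - b.repr (f n) i := by
      intro i
      refine ht.2 (fun n => b.repr (f n) i) fun n => ?_
      have := (hdvd n _).1 (hf n) i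
      rwa [map_sub, Finsupp.sub_apply] at this
    choose L hL using h2
    have := Fintype.ofFinite ι
    refine ⟨b.equivFun.symm L, fun n => (hdvd n _).2 fun i => ?_⟩
    rw [map_sub, Finsupp.sub_apply, ← Module.Basis.equivFun_apply, LinearEquiv.apply_symm_apply]
    exact hL i n

theorem IsPowComplete.exists_eq_add_mul_eval {R : Type*} [CommRing R] {t : R}
    (ht : IsPowComplete t) (c : R) (W : Polynomial R) : ∃ z, z = c + t * W.eval z := by
  let T : R → R := fun z => c + t * W.eval z
  have hT : ∀ n x y, t ^ n ∣ x - y → t ^ (n + 1) ∣ T x - T y := by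
    intro n x y h
    have : T x - T y = t * (W.eval x - W.eval y) := by simp only [T]; ring
    rw [this, pow_succ']
    exact mul_dvd_mul_left _ (h.trans (Polynomial.sub_dvd_eval_sub x y W))
  let s : ℕ → R := fun n => T^[n] 0
  have hs : ∀ n, s (n + 1) = T (s n) := fun n => Function.iterate_succ_apply' T n 0
  have h1 : ∀ n, t ^ n ∣ s (n + 1) - s n := by
    intro n
    induction n with
    | zero => simp
    | succ n ih =>
      rw [hs (n + 1), hs n]
      exact hT n _ _ (hs n ▸ ih)
  obtain ⟨z, hz⟩ := ht.2 s h1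
  refine ⟨z, ?_⟩
  rw [← sub_eq_zero]
  refine ht.1 _ fun n => ?_
  have e : z - (c + t * W.eval z) = (z - s (n + 1)) - (T z - T (s n)) := by
    rw [hs]; simp only [T]; ring
  rw [e]
  exact ((pow_dvd_pow t n.le_succ).trans (hz (n + 1))).sub
    ((pow_dvd_pow t n.le_succ).trans (hT n _ _ (hz n)))

theorem IsPowComplete.isUnit_one_add {R : Type*} [CommRing R] {t : R}
    (ht : IsPowComplete t) (r : R) : IsUnit (1 + t * r) := by
  obtain ⟨z, hz⟩ := ht.exists_eq_add_mul_eval 1 (Polynomial.C (-r) * Polynomial.X)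
  refine IsUnit.of_mul_eq_one z ?_
  simp only [Polynomial.eval_mul, Polynomial.eval_C, Polynomial.eval_X] at hz
  linear_combination hz

/-- Hensel's lemma in Newton's form. -/
theorem IsPowComplete.exists_root {R : Type*} [CommRing R] {t : R}
    (ht : IsPowComplete t) (f : Polynomial R) {a v c : R} {m : ℕ}
    (hv : v * f.derivative.eval a = t ^ m) (hc : f.eval a = t ^ (2 * m + 1) * c) :
    ∃ b, f.eval b = 0 ∧ t ^ (m + 1) ∣ b - a := by
  let P := Polynomial.taylor a f
  let Q := P.divX.divX
  have hP : ∀ h : R, f.eval (a + h) = f.eval a + h * (f.derivative.eval a + h * Q.eval h) := by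
    intro h
    have h0 : P.eval h = f.eval (a + h) := by
      rw [Polynomial.taylor_eval, add_comm]
    have h1 := congrArg (Polynomial.eval h) (Polynomial.divX_mul_X_add P)
    have h2 := congrArg (Polynomial.eval h) (Polynomial.divX_mul_X_add P.divX)
    simp only [Polynomial.eval_add, Polynomial.eval_mul, Polynomial.eval_X, Polynomial.eval_C,
      Polynomial.coeff_divX] at h1 h2
    have h3 : P.coeff 0 = f.eval a := Polynomial.taylor_coeff_zero a f
    have h4 : P.coeff (0 + 1) = f.derivative.eval a := Polynomial.taylor_coeff_one a f
    rw [h3] at h1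
    rw [h4] at h2
    rw [← h0, ← h1, ← h2]
    ring
  obtain ⟨z, hz⟩ := ht.exists_eq_add_mul_eval (-c)
    (-(Polynomial.C (v ^ 2) * Polynomial.X ^ 2 *
      Q.comp (Polynomial.C (t ^ (m + 1) * v) * Polynomial.X)))
  simp only [Polynomial.eval_neg, Polynomial.eval_mul, Polynomial.eval_C, Polynomial.eval_X,
    Polynomial.eval_pow, Polynomial.eval_comp] at hz
  refine ⟨a + t ^ (m + 1) * v * z, ?_, ⟨v * z, by ring⟩⟩
  rw [hP, hc]
  have e : t ^ (2 * m + 1) = t ^ (m + 1) * t ^ m := by rw [← pow_add]; congr 1; omega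
  rw [e]
  generalize Q.eval (t ^ (m + 1) * v * z) = q at hz ⊢
  linear_combination (t ^ (m + 1) * t ^ m) * hz + (t ^ (m + 1) * z) * hv

section RelativelyAlgebraicallyClosed

variable {F F₀ : Type*} [Field F] [Field F₀] [Algebra F F₀]

/-- Irreducible polynomials stay irreducible over extensions without new algebraic elements. -/
theorem Polynomial.Monic.irreducible_map_of_forall_isAlgebraic
    (hF : ∀ z : F₀, IsAlgebraic F z → z ∈ (algebraMap F F₀).range)
    {q : Polynomial F} (hm : q.Monic) (hq : Irreducible q) :
    Irreducible (q.map (algebraMap F F₀)) := by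
  have hfac : ∀ g : Polynomial F₀, g.Monic → g ∣ q.map (algebraMap F F₀) →
      ∃ g' : Polynomial F, g'.Monic ∧ g'.map (algebraMap F F₀) = g := by
    intro g hg hd
    have h1 := integralClosure.mem_lifts_of_monic_of_dvd_map F₀ hm hg hd
    have h2 : g ∈ Polynomial.lifts (algebraMap F F₀) := by
      rw [Polynomial.lifts_iff_coeff_lifts] at h1 ⊢
      intro n
      obtain ⟨c, hc⟩ := h1 n
      have := hF (c : F₀) (IsIntegral.isAlgebraic c.2)
      rw [← hc]
      exact this
    obtain ⟨g', h3, -, h4⟩ := Polynomial.lifts_and_natDegree_eq_and_monic h2 hg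
    exact ⟨g', h4, h3⟩
  refine (Polynomial.Monic.irreducible_iff_natDegree (hm.map _)).2 ⟨?_, ?_⟩
  · intro h
    exact hq.ne_one (Polynomial.map_injective _ (algebraMap F F₀).injective
      (h.trans (Polynomial.map_one _).symm))
  · intro f g hf hg hfg
    obtain ⟨f', hf', rfl⟩ := hfac f hf (hfg ▸ dvd_mul_right _ _)
    obtain ⟨g', hg', rfl⟩ := hfac g hg (hfg ▸ dvd_mul_left _ _)
    have : f' * g' = q := by
      apply Polynomial.map_injective _ (algebraMap F F₀).injective
      rw [Polynomial.map_mul, hfg]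
    simpa using ((Polynomial.Monic.irreducible_iff_natDegree hm).1 hq).2 f' g' hf' hg' this

/-- A simple separable constant extension adds only the expected constants. -/
theorem PowerBasis.repr_mem_range_of_isAlgebraic {K₀ : Type*} [Field K₀] [Algebra F₀ K₀]
    [Algebra F K₀] [IsScalarTower F F₀ K₀]
    (hF : ∀ z : F₀, IsAlgebraic F z → z ∈ (algebraMap F F₀).range)
    (pb : PowerBasis F₀ K₀) {q : Polynomial F} (hq : q.Separable)
    (hpb : minpoly F₀ pb.gen = q.map (algebraMap F F₀)) {z : K₀} (hz : IsAlgebraic F z)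
    (i : Fin pb.dim) : pb.basis.repr z i ∈ (algebraMap F F₀).range := by
  classical
  let Ω := AlgebraicClosure K₀
  let Z := algebraicClosure F Ω
  let P := minpoly F₀ pb.gen
  have hPs : P.Separable := by simp only [P]; rw [hpb]; exact hq.map
  have hcard : Fintype.card (P.rootSet Ω) = pb.dim := by
    rw [Polynomial.card_rootSet_eq_natDegree hPs (IsAlgClosed.splits _), pb.natDegree_minpoly]
  let e : Fin pb.dim ≃ P.rootSet Ω := Fintype.equivOfCardEq (by simp [hcard])
  have hr0 : ∀ j, Polynomial.aeval (e j : Ω) P = 0 := fun j =>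
    (Polynomial.mem_rootSet.1 (e j).2).2
  have hr1 : ∀ j, (e j : Ω) ∈ Z := by
    intro j
    rw [mem_algebraicClosure_iff]
    refine ⟨q, hq.ne_zero, ?_⟩
    rw [← Polynomial.aeval_map_algebraMap F₀, ← hpb]
    exact hr0 j
  let r : Fin pb.dim → Z := fun j => ⟨e j, hr1 j⟩
  have hrinj : Function.Injective r := fun a b h =>
    e.injective (Subtype.ext (congrArg (fun x : Z => (x : Ω)) h))
  have hdet : (Matrix.vandermonde r).det ≠ 0 := Matrix.det_vandermonde_ne_zero_iff.2 hrinj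
  let σ : Fin pb.dim → K₀ →ₐ[F₀] Ω := fun j => pb.lift (e j : Ω) (hr0 j)
  have hσ : ∀ j, σ j pb.gen = e j := fun j => pb.lift_gen _ _
  have hσz : ∀ j, σ j z ∈ Z := by
    intro j
    rw [mem_algebraicClosure_iff]
    exact hz.algHom ((σ j).restrictScalars F)
  let a : Fin pb.dim → Z := (Matrix.vandermonde r)⁻¹.mulVec fun j => ⟨σ j z, hσz j⟩
  have ha : (Matrix.vandermonde r).mulVec a = fun j => ⟨σ j z, hσz j⟩ := by
    simp only [a]
    rw [Matrix.mulVec_mulVec, Matrix.mul_nonsing_inv _ (isUnit_iff_ne_zero.2 hdet),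
      Matrix.one_mulVec]
  have hdet' : (Matrix.vandermonde fun j => (e j : Ω)).det ≠ 0 :=
    Matrix.det_vandermonde_ne_zero_iff.2 fun a b h => e.injective (Subtype.ext h)
  have key : (fun j => ((a j : Z) : Ω) - algebraMap F₀ Ω (pb.basis.repr z j)) = 0 := by
    refine Matrix.eq_zero_of_mulVec_eq_zero hdet' ?_
    ext j
    have h1 := congrArg (fun v => ((v j : Z) : Ω)) ha
    simp only [Matrix.mulVec, dotProduct, Matrix.vandermonde_apply,
      AddSubmonoidClass.coe_finsetSum, MulMemClass.coe_mul, SubmonoidClass.coe_pow, r] at h1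
    have h2 : σ j z = ∑ i : Fin pb.dim, (e j : Ω) ^ (i : ℕ) * algebraMap F₀ Ω (pb.basis.repr z i) := by
      conv_lhs => rw [← pb.basis.sum_repr z]
      rw [map_sum]
      refine Finset.sum_congr rfl fun i _ => ?_
      rw [map_smul, pb.basis_eq_pow, map_pow, hσ, Algebra.smul_def, mul_comm]
    simp only [Matrix.mulVec, dotProduct, Matrix.vandermonde_apply, mul_sub,
      Finset.sum_sub_distrib, Pi.zero_apply] at h1 ⊢
    rw [h1, h2, sub_self]
  have h3 := congrFun key i
  simp only [Pi.zero_apply, sub_eq_zero] at h3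
  refine hF _ ?_
  have h4 : IsAlgebraic F (algebraMap F₀ Ω (pb.basis.repr z i)) := by
    rw [← h3]; exact (mem_algebraicClosure_iff).1 (a i).2
  exact (isAlgebraic_algebraMap_iff (algebraMap F₀ Ω).injective).1 h4

end RelativelyAlgebraicallyClosed

theorem Polynomial.sub_dvd_eval₂_eval₂RingHom_sub {O R : Type*} [CommRing O] [CommRing R]
    (i : O →+* R) (Q : Polynomial (Polynomial O)) (a a' b : R) :
    a - a' ∣ Q.eval₂ (Polynomial.eval₂RingHom i a) b -
      Q.eval₂ (Polynomial.eval₂RingHom i a') b := by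
  let W : Polynomial R := Q.eval₂ (Polynomial.mapRingHom i) (Polynomial.C b)
  have hW : ∀ a : R, W.eval a = Q.eval₂ (Polynomial.eval₂RingHom i a) b := by
    intro a
    have h := Polynomial.hom_eval₂ Q (Polynomial.mapRingHom i) (Polynomial.evalRingHom a)
      (Polynomial.C b)
    simp only [Polynomial.coe_evalRingHom, Polynomial.eval_C] at h
    rw [h]
    congr 1
    ext x
    · simp
    · simp
  rw [← hW, ← hW]
  exact Polynomial.sub_dvd_eval_sub _ _ W

/-- The inclusion of constants in `t`-adic power series over `k[[s]]`. -/
noncomputable abbrev PowerSeries.mapC (k : Type*) [Field k] :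
    PowerSeries k →+* PowerSeries (PowerSeries k) :=
  PowerSeries.map (PowerSeries.C (R := k))

section NewtonPoints

variable {k : Type*} [Field k] {F F' : Type*} [Field F] [Field F'] [Algebra (PowerSeries k) F]
  [IsFractionRing (PowerSeries k) F] [Algebra F F'] [Algebra (PowerSeries k) F']
  [IsScalarTower (PowerSeries k) F F']

theorem PowerSeries.exists_mul_eq_X_pow_of_isIntegral {B : Type*} [CommRing B] [IsDomain B]
    [Algebra (PowerSeries k) B] [FaithfulSMul (PowerSeries k) B]
    [Algebra.IsIntegral (PowerSeries k) B] {w : B} (hw : w ≠ 0) :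
    ∃ v m, v * w = algebraMap (PowerSeries k) B PowerSeries.X ^ m := by
  obtain ⟨r, hr, v, hv⟩ := (Algebra.IsIntegral.isIntegral (R := PowerSeries k) w).isAlgebraic
    |>.exists_nonzero_dvd (mem_nonZeroDivisors_of_ne_zero hw)
  obtain ⟨u, hu⟩ : ∃ u, r * u = PowerSeries.X ^ r.order.toNat := by
    refine ⟨PowerSeries.Inv_divided_by_X_pow_order hr, ?_⟩
    nth_rw 1 [← PowerSeries.X_pow_order_mul_divXPowOrder (f := r)]
    rw [mul_assoc, PowerSeries.Inv_divided_by_X_pow_order_rightInv, mul_one]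
  refine ⟨v * algebraMap _ B u, r.order.toNat, ?_⟩
  rw [← map_pow, ← hu, map_mul, hv]
  ring

theorem exists_newton_points [FiniteDimensional F F'] [Algebra.IsSeparable F F'] {θ : F'}
    (hθ : IsIntegral (PowerSeries k) θ) (hθt : IntermediateField.adjoin F {θ} = ⊤)
    (Q : Polynomial (Polynomial (PowerSeries k))) (x₀ : PowerSeries k)
    (y₀ : AdjoinRoot (minpoly (PowerSeries k) θ))
    (h0 : Q.eval₂ (Polynomial.eval₂RingHom (AdjoinRoot.of _) (AdjoinRoot.of _ x₀)) y₀ = 0)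
    (h1 : Q.derivative.eval₂ (Polynomial.eval₂RingHom (AdjoinRoot.of _) (AdjoinRoot.of _ x₀)) y₀
      ≠ 0) :
    ∃ (p : Polynomial (PowerSeries k)) (N : ℕ)
      (x y : AdjoinRoot ((minpoly (PowerSeries k) θ).map (PowerSeries.mapC k))),
      p.Monic ∧ Irreducible (p.map (algebraMap (PowerSeries k) F)) ∧
      p.natDegree = (minpoly (PowerSeries k) θ).natDegree ∧
      p.eval₂ ((AdjoinRoot.of _).comp (PowerSeries.mapC k)) x =
        AdjoinRoot.of _ (PowerSeries.X ^ N * PowerSeries.C PowerSeries.X) ∧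
      Q.eval₂ (Polynomial.eval₂RingHom ((AdjoinRoot.of _).comp (PowerSeries.mapC k)) x) y = 0 := by
  classical
  have : FaithfulSMul (PowerSeries k) F' := by
    rw [faithfulSMul_iff_algebraMap_injective, IsScalarTower.algebraMap_eq (PowerSeries k) F F']
    exact (algebraMap F F').injective.comp (IsFractionRing.injective _ _)
  have hqm := minpoly.monic hθ
  obtain ⟨q, hq⟩ : ∃ q, q = minpoly (PowerSeries k) θ := ⟨_, rfl⟩
  have hqF : q.map (algebraMap (PowerSeries k) F) = minpoly F θ := by
    rw [hq]; exact (minpoly.isIntegrallyClosed_eq_field_fractions F F' hθ).symm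
  have hq0 : q.eval₂ (algebraMap (PowerSeries k) F') θ = 0 := by
    rw [hq]; exact minpoly.aeval _ _
  have hdvd : ∀ P : Polynomial (PowerSeries k), Polynomial.aeval θ P = 0 → q ∣ P := fun P hP => by
    rw [hq]; exact (minpoly.isIntegrallyClosed_dvd_iff hθ P).1 hP
  rw [← hq] at hqm
  revert y₀ h0 h1
  rw [← hq]
  intro y₀ h0 h1
  let j : AdjoinRoot q →+* F' := AdjoinRoot.lift (algebraMap (PowerSeries k) F') θ hq0
  have hj : Function.Injective j := by
    rw [injective_iff_map_eq_zero]
    intro z hz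
    obtain ⟨P, rfl⟩ := AdjoinRoot.mk_surjective z
    rw [AdjoinRoot.lift_mk] at hz
    exact AdjoinRoot.mk_eq_zero.2 (hdvd P hz)
  have hdom : IsDomain (AdjoinRoot q) := hj.isDomain j
  have hfs : FaithfulSMul (PowerSeries k) (AdjoinRoot q) := by
    rw [faithfulSMul_iff_algebraMap_injective]
    intro a b hab
    have := congrArg j hab
    simp only [j, AdjoinRoot.algebraMap_eq, AdjoinRoot.lift_of] at this
    exact FaithfulSMul.algebraMap_injective (PowerSeries k) F' this
  have hfin : Module.Finite (PowerSeries k) (AdjoinRoot q) :=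
    (AdjoinRoot.powerBasis' hqm).finite
  have hintg : Algebra.IsIntegral (PowerSeries k) (AdjoinRoot q) := inferInstance
  obtain ⟨v₂, m₂, hv₂⟩ := PowerSeries.exists_mul_eq_X_pow_of_isIntegral (k := k) h1
  let c : AdjoinRoot q := AdjoinRoot.of q x₀ + AdjoinRoot.of q PowerSeries.X ^ (2 * m₂ + 1) *
    AdjoinRoot.root q
  let p := minpoly (PowerSeries k) (j c)
  have hjof : ∀ a, j (AdjoinRoot.of q a) = algebraMap F F' (algebraMap (PowerSeries k) F a) := by
    intro a
    rw [← IsScalarTower.algebraMap_apply]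
    exact AdjoinRoot.lift_of _
  have hcint : IsIntegral (PowerSeries k) (j c) := by
    obtain ⟨P, hP, h⟩ := Algebra.IsIntegral.isIntegral (R := PowerSeries k) c
    refine ⟨P, hP, ?_⟩
    have h2 := congrArg j h
    rw [Polynomial.hom_eval₂, map_zero] at h2
    rw [← h2]
    congr 1
    ext a
    rw [IsScalarTower.algebraMap_apply (PowerSeries k) F F', ← hjof]
    rfl
  have hpF : p.map (algebraMap (PowerSeries k) F) = minpoly F (j c) :=
    (minpoly.isIntegrallyClosed_eq_field_fractions F F' hcint).symm
  have hct : IntermediateField.adjoin F {j c} = ⊤ := by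
    rw [eq_top_iff, ← hθt, IntermediateField.adjoin_simple_le_iff]
    have e : θ = (algebraMap F F' (algebraMap (PowerSeries k) F (PowerSeries.X ^ (2 * m₂ + 1))))⁻¹ *
        (j c - algebraMap F F' (algebraMap (PowerSeries k) F x₀)) := by
      have hX : algebraMap F F' (algebraMap (PowerSeries k) F (PowerSeries.X ^ (2 * m₂ + 1))) ≠ 0 := by
        rw [Ne, map_eq_zero, map_eq_zero_iff _ (IsFractionRing.injective _ _)]
        exact pow_ne_zero _ PowerSeries.X_ne_zero
      rw [eq_inv_mul_iff_mul_eq₀ hX]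
      simp only [c, map_add, map_mul, hjof, ← map_pow, add_sub_cancel_left]
      congr 1
      exact (AdjoinRoot.lift_root _).symm
    rw [e]
    exact mul_mem (inv_mem (algebraMap_mem _ _))
      (sub_mem (IntermediateField.mem_adjoin_simple_self F _) (algebraMap_mem _ _))
  have hpdeg : p.natDegree = q.natDegree := by
    have e1 : p.natDegree = (minpoly F (j c)).natDegree := by
      rw [← hpF, Polynomial.natDegree_map_eq_of_injective (IsFractionRing.injective _ _)]
    have e2 : q.natDegree = (minpoly F θ).natDegree := by
      rw [← hqF, Polynomial.natDegree_map_eq_of_injective (IsFractionRing.injective _ _)]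
    rw [e1, e2, (Field.primitive_element_iff_minpoly_natDegree_eq F _).1 hct,
      (Field.primitive_element_iff_minpoly_natDegree_eq F _).1 hθt]
  have hjev : ∀ P : Polynomial (PowerSeries k), j (P.eval₂ (AdjoinRoot.of q) c) =
      Polynomial.aeval (j c) P := by
    intro P
    rw [Polynomial.hom_eval₂, Polynomial.aeval_def]
    congr 1
    ext a
    rw [IsScalarTower.algebraMap_apply (PowerSeries k) F F', ← hjof]
    rfl
  have hpc : p.eval₂ (AdjoinRoot.of q) c = 0 := by
    apply hj
    rw [hjev, map_zero]
    exact minpoly.aeval _ _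
  have hpc' : p.derivative.eval₂ (AdjoinRoot.of q) c ≠ 0 := by
    intro h
    have h2 := congrArg j h
    rw [hjev, map_zero, ← Polynomial.aeval_map_algebraMap F, ← Polynomial.derivative_map, hpF] at h2
    exact (Algebra.IsSeparable.isSeparable F (j c)).aeval_derivative_ne_zero (minpoly.aeval _ _) h2
  obtain ⟨v₁, m₁, hv₁⟩ := PowerSeries.exists_mul_eq_X_pow_of_isIntegral (k := k) hpc'
  let ψ := PowerSeries.mapC k
  let R := AdjoinRoot (q.map ψ)
  let ρ : AdjoinRoot q →+* R := AdjoinRoot.map ψ q (q.map ψ) dvd_rfl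
  let i : PowerSeries k →+* R := (AdjoinRoot.of _).comp ψ
  have hi : ρ.comp (AdjoinRoot.of q) = i := by
    ext a
    exact AdjoinRoot.map_of ψ q (q.map ψ) dvd_rfl a
  have hi' : ∀ a, ρ (AdjoinRoot.of q a) = i a := fun a => RingHom.congr_fun hi a
  let t : R := i PowerSeries.X
  let s : R := AdjoinRoot.of _ (PowerSeries.C PowerSeries.X)
  have ht : t = AdjoinRoot.of _ PowerSeries.X := by
    simp only [t, i, ψ, RingHom.comp_apply, PowerSeries.mapC, PowerSeries.map_X]
  have hcomp : IsPowComplete t := by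
    rw [ht]
    exact PowerSeries.isPowComplete_X.of_basis (AdjoinRoot.powerBasis' (hqm.map ψ)).basis
  rw [AdjoinRoot.algebraMap_eq] at hv₁ hv₂
  have hρv₁ := congrArg ρ hv₁
  have hρv₂ := congrArg ρ hv₂
  rw [map_mul, map_pow, hi', Polynomial.hom_eval₂, hi] at hρv₁
  rw [map_mul, map_pow, hi'] at hρv₂
  let M := max m₁ (2 * m₂ + 1)
  obtain ⟨x, hx, hxc⟩ := hcomp.exists_root (p.map i - Polynomial.C (t ^ (2 * M + 1) * s))
    (a := ρ c) (v := ρ v₁ * t ^ (M - m₁)) (c := -s) (m := M) (by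
      rw [Polynomial.derivative_sub, Polynomial.derivative_C, sub_zero, Polynomial.derivative_map,
        Polynomial.eval_map, mul_right_comm, hρv₁, ← pow_add]
      congr 1
      simp only [M]; omega) (by
      have := congrArg ρ hpc
      rw [Polynomial.hom_eval₂, hi, map_zero] at this
      rw [Polynomial.eval_sub, Polynomial.eval_map, Polynomial.eval_C, this]
      ring)
  have hxx₀ : t ^ (2 * m₂ + 1) ∣ x - i x₀ := by
    have e : x - i x₀ = (x - ρ c) + t ^ (2 * m₂ + 1) * ρ (AdjoinRoot.root q) := by
      simp only [c, map_add, map_mul, map_pow, hi', t]; ring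
    rw [e]
    exact ((pow_dvd_pow t (by simp only [M]; omega)).trans hxc).add (dvd_mul_right _ _)
  have hev : ∀ W : Polynomial (Polynomial (PowerSeries k)),
      ρ (W.eval₂ (Polynomial.eval₂RingHom (AdjoinRoot.of _) (AdjoinRoot.of _ x₀)) y₀) =
        W.eval₂ (Polynomial.eval₂RingHom i (i x₀)) (ρ y₀) := by
    intro W
    rw [Polynomial.hom_eval₂]
    congr 1
    ext a
    · simp [hi']
    · simp [hi']
  rw [hev] at hρv₂
  have hcong : ∀ W : Polynomial (Polynomial (PowerSeries k)), ∃ r,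
      W.eval₂ (Polynomial.eval₂RingHom i x) (ρ y₀) =
        W.eval₂ (Polynomial.eval₂RingHom i (i x₀)) (ρ y₀) + t ^ (2 * m₂ + 1) * r := by
    intro W
    obtain ⟨r, hr⟩ := hxx₀.trans
      (Polynomial.sub_dvd_eval₂_eval₂RingHom_sub i W x (i x₀) (ρ y₀))
    exact ⟨r, by rw [← hr]; ring⟩
  obtain ⟨r, hr⟩ := hcong Q
  obtain ⟨r', hr'⟩ := hcong Q.derivative
  obtain ⟨u, hu⟩ := (hcomp.isUnit_one_add (t ^ m₂ * ρ v₂ * r'))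
  obtain ⟨y, hy, -⟩ := hcomp.exists_root (Q.map (Polynomial.eval₂RingHom i x))
    (a := ρ y₀) (v := ρ v₂ * ↑u⁻¹) (c := r) (m := m₂) (by
      rw [Polynomial.derivative_map, Polynomial.eval_map, hr', mul_right_comm, mul_add, hρv₂]
      have : i PowerSeries.X ^ m₂ + ρ v₂ * (t ^ (2 * m₂ + 1) * r') = t ^ m₂ * u := by
        rw [hu]; simp only [t]; ring
      rw [this, mul_assoc, Units.mul_inv, mul_one]) (by
      rw [Polynomial.eval_map, hr, ← hev, h0, map_zero, zero_add])
  refine ⟨p, 2 * M + 1, x, y, minpoly.monic hcint, ?_, hpdeg, ?_, ?_⟩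
  · rw [hpF]
    exact minpoly.irreducible (hcint.tower_top)
  · rw [Polynomial.eval_sub, Polynomial.eval_map, Polynomial.eval_C, sub_eq_zero] at hx
    rw [map_mul, map_pow, ← ht]
    exact hx
  · rw [Polynomial.eval_map] at hy
    exact hy

end NewtonPoints

section SimpleExtension

variable {F₀ K₀ : Type*} [Field F₀] [Field K₀] [Algebra F₀ K₀]

theorem mem_adjoin_simple_iff_repr_mem {d : ℕ} {x : K₀} (b : Module.Basis (Fin d) F₀ K₀)
    (hb : ∀ i, b i = x ^ (i : ℕ)) (F₁ : Subfield F₀) {P : Polynomial F₁} (hP : P.Monic)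
    (hd : P.natDegree = d) (hx : Polynomial.aeval x P = 0) (z : K₀) :
    z ∈ IntermediateField.adjoin F₁ {x} ↔ ∀ i, b.repr z i ∈ F₁ := by
  constructor
  · intro hz
    have halg : IsAlgebraic F₁ x := ⟨P, hP.ne_zero, hx⟩
    rw [← IntermediateField.mem_toSubalgebra,
      IntermediateField.adjoin_simple_toSubalgebra_of_isAlgebraic halg,
      Algebra.adjoin_singleton_eq_range_aeval] at hz
    obtain ⟨G, rfl⟩ := hz
    intro i
    have hd0 : 0 < d := i.pos
    have h1 : Polynomial.aeval x (G %ₘ P) = Polynomial.aeval x G := by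
      conv_rhs => rw [← Polynomial.modByMonic_add_div G P]
      rw [map_add, map_mul, hx, zero_mul, add_zero]
    have hlt : (G %ₘ P).natDegree < d := by
      rw [← hd]
      exact Polynomial.natDegree_modByMonic_lt _ hP (by rintro rfl; simp at hd; omega)
    change b.repr (Polynomial.aeval x G) i ∈ F₁
    rw [← h1, Polynomial.aeval_eq_sum_range' hlt, Finset.sum_range]
    have h2 : ∑ j : Fin d, (G %ₘ P).coeff j • x ^ (j : ℕ) =
        ∑ j : Fin d, (((G %ₘ P).coeff j : F₁) : F₀) • b j :=
      Finset.sum_congr rfl fun j _ => by rw [hb]; rfl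
    rw [h2, b.repr_sum_self]
    exact ((G %ₘ P).coeff i).2
  · intro h
    rw [← b.sum_repr z]
    refine sum_mem fun i _ => ?_
    rw [hb]
    exact (IntermediateField.adjoin F₁ {x}).smul_mem (x := (⟨b.repr z i, h i⟩ : F₁))
      (pow_mem (IntermediateField.mem_adjoin_simple_self _ _) _)

/-- The patching property lifts to finite extensions of the ambient field. -/
theorem PatchingProperty.lift {d : ℕ} (b : Module.Basis (Fin d) F₀ K₀) {F₁ F₂ : Subfield F₀}
    (h : PatchingProperty F₁ F₂) {K₁ K₂ : Subfield K₀}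
    (h1 : ∀ a ∈ F₁, algebraMap F₀ K₀ a ∈ K₁) (h2 : ∀ a ∈ F₂, algebraMap F₀ K₀ a ∈ K₂)
    (hb1 : ∀ i, b i ∈ K₁) (hb2 : ∀ i, b i ∈ K₂) : PatchingProperty K₁ K₂ := by
  intro ι _ g₁ g₂
  classical
  have := Fintype.ofFinite ι
  let Φ : (ι → K₀) ≃ₗ[F₀] (Fin d × ι → F₀) := (b.smulTower (Pi.basisFun K₀ ι)).equivFun
  have key := h (Fin d × ι) ((b.smulTower g₁).map Φ) ((b.smulTower g₂).map Φ)
  have hsub : ∀ (F₁ : Subfield F₀) (K₁ : Subfield K₀) (g : Module.Basis ι K₀ (ι → K₀)),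
      (∀ a ∈ F₁, algebraMap F₀ K₀ a ∈ K₁) → (∀ i, b i ∈ K₁) →
      ∀ v ∈ Submodule.span F₁ (Set.range ((b.smulTower g).map Φ)),
        Φ.symm v ∈ Submodule.span K₁ (Set.range g) := by
    intro F₁ K₁ g h1 hb1 v hv
    induction hv using Submodule.span_induction with
    | mem v hv =>
      obtain ⟨⟨i, l⟩, rfl⟩ := hv
      rw [Module.Basis.map_apply, LinearEquiv.symm_apply_apply, Module.Basis.smulTower_apply]
      exact Submodule.smul_mem _ (⟨b i, hb1 i⟩ : K₁) (Submodule.subset_span ⟨l, rfl⟩)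
    | zero => rw [map_zero]; exact zero_mem _
    | add v w _ _ hv hw => rw [map_add]; exact add_mem hv hw
    | smul a v _ hv =>
      have e : Φ.symm (a • v) = (⟨algebraMap F₀ K₀ a, h1 a a.2⟩ : K₁) • Φ.symm v := by
        change Φ.symm ((a : F₀) • v) = (algebraMap F₀ K₀ a) • Φ.symm v
        rw [map_smul, algebraMap_smul]
      rw [e]
      exact Submodule.smul_mem _ _ hv
  rw [eq_top_iff]
  intro v _
  have hv : Φ v ∈ (⊤ : Submodule F₀ _) := trivial
  rw [← key] at hv
  rw [← Φ.symm_apply_apply v]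
  generalize Φ v = w at hv
  induction hv using Submodule.span_induction with
  | mem w hw =>
    exact Submodule.subset_span ⟨hsub F₁ K₁ g₁ h1 hb1 w hw.1, hsub F₂ K₂ g₂ h2 hb2 w hw.2⟩
  | zero => rw [map_zero]; exact zero_mem _
  | add v w _ _ hv hw => rw [map_add]; exact add_mem hv hw
  | smul a v _ hv =>
    rw [map_smul, ← algebraMap_smul K₀ a]
    exact Submodule.smul_mem _ _ hv

end SimpleExtension

theorem AdjoinRoot.exists_eq_sum_of_mul_root_pow {A : Type*} [CommRing A] {q : Polynomial A}
    (hq : q.Monic) (z : AdjoinRoot q) :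
    ∃ a : Fin q.natDegree → A, z = ∑ i, AdjoinRoot.of q (a i) * AdjoinRoot.root q ^ (i : ℕ) := by
  refine ⟨fun i => (AdjoinRoot.powerBasis' hq).basis.repr z i, ?_⟩
  conv_lhs => rw [← (AdjoinRoot.powerBasis' hq).basis.sum_repr z]
  refine Finset.sum_congr rfl fun i _ => ?_
  rw [PowerBasis.basis_eq_pow, Algebra.smul_def, AdjoinRoot.algebraMap_eq]
  rfl

/-- Linear independence of powers may be tested after specialization. -/
theorem linearIndependent_pow_of_specialization {A F₀ K₀ F F' : Type*} [CommRing A]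
    [Field F₀] [Field K₀] [Algebra F₀ K₀] [Field F] [Field F'] [Algebra F F']
    {q : Polynomial A} (hq : q.Monic) {jA : A →+* F₀} (hjA : Function.Injective jA) (ε : A →+* F)
    {d : ℕ} (hd : q.natDegree = d)
    (b : Module.Basis (Fin d) F₀ K₀) {θ : K₀} (hb : ∀ i, b i = θ ^ (i : ℕ))
    (Ψ : AdjoinRoot q →+* K₀) (hΨ : ∀ a, Ψ (AdjoinRoot.of q a) = algebraMap F₀ K₀ (jA a))
    (hΨθ : Ψ (AdjoinRoot.root q) = θ)
    (ε' : AdjoinRoot q →+* F') (hε' : ∀ a, ε' (AdjoinRoot.of q a) = algebraMap F F' (ε a))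
    {x : AdjoinRoot q} (hx : LinearIndependent F fun i : Fin d => ε' x ^ (i : ℕ)) :
    LinearIndependent F₀ fun i : Fin d => Ψ x ^ (i : ℕ) := by
  classical
  subst hd
  choose a ha using fun j : Fin q.natDegree =>
    AdjoinRoot.exists_eq_sum_of_mul_root_pow hq (x ^ (j : ℕ))
  let B : Matrix (Fin q.natDegree) (Fin q.natDegree) A := Matrix.of fun i j => a j i
  have hB : (B.map ε).det ≠ 0 := by
    intro h0
    obtain ⟨v, hv0, hv⟩ := Matrix.exists_mulVec_eq_zero_iff.2 h0
    apply hv0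
    funext j
    refine Fintype.linearIndependent_iff.1 hx v ?_ j
    have e : ∀ j : Fin q.natDegree, v j • ε' x ^ (j : ℕ) =
        ∑ i, algebraMap F F' (B.map ε i j * v j) * ε' (AdjoinRoot.root q) ^ (i : ℕ) := by
      intro j
      rw [← map_pow, ha j, map_sum, Finset.smul_sum]
      refine Finset.sum_congr rfl fun i _ => ?_
      rw [map_mul, hε', map_pow, Algebra.smul_def, map_mul]
      simp only [B, Matrix.map_apply, Matrix.of_apply]
      ring
    simp_rw [e]
    rw [Finset.sum_comm]
    refine Finset.sum_eq_zero fun i _ => ?_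
    rw [← Finset.sum_mul, ← map_sum]
    have := congrFun hv i
    simp only [Matrix.mulVec, dotProduct, Pi.zero_apply] at this
    rw [this, map_zero, zero_mul]
  have hB' : (B.map jA).det ≠ 0 := by
    rw [← RingHom.mapMatrix_apply, ← RingHom.map_det] at hB ⊢
    rw [Ne, map_eq_zero_iff _ hjA]
    intro h
    rw [h, map_zero] at hB
    exact hB rfl
  have hm : b.toMatrix (fun j : Fin q.natDegree => Ψ x ^ (j : ℕ)) = B.map jA := by
    ext i j
    have e : Ψ x ^ (j : ℕ) = ∑ i, jA (B i j) • b i := by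
      rw [← map_pow, ha j, map_sum]
      refine Finset.sum_congr rfl fun i _ => ?_
      rw [map_mul, hΨ, map_pow, hΨθ, Algebra.smul_def, hb]
      rfl
    rw [Module.Basis.toMatrix_apply, e, b.repr_sum_self]
    rfl
  refine (b.is_basis_iff_det.2 ?_).1
  rw [Module.Basis.det_apply, hm]
  exact isUnit_iff_ne_zero.2 hB'

section TwoVariables

variable (k : Type) [Field k] (F₀ : Type*) [Field F₀] [Algebra (PowerSeries (LaurentSeries k)) F₀]

/-- The embedding of `k[[s]][[t]]` into the fraction field of `k((s))[[t]]`. -/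
noncomputable def PowerSeries.toFraction : PowerSeries (PowerSeries k) →+* F₀ :=
  (algebraMap (PowerSeries (LaurentSeries k)) F₀).comp
    (PowerSeries.map (HahnSeries.ofPowerSeries ℤ k))

theorem PowerSeries.toFraction_mapC (a : PowerSeries k) :
    PowerSeries.toFraction k F₀ (PowerSeries.mapC k a) =
      algebraMap (PowerSeries (LaurentSeries k)) F₀ (PowerSeries.map HahnSeries.C a) := by
  rw [PowerSeries.toFraction, RingHom.comp_apply]
  congr 1
  ext n : 1
  simp [PowerSeries.mapC, PowerSeries.coeff_map]

theorem PowerSeries.toFraction_mem (a : PowerSeries (PowerSeries k)) :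
    PowerSeries.toFraction k F₀ a ∈
      PowerSeries.coeffSubfield (LaurentSeries.nonnegPart k) F₀ := by
  refine PowerSeries.algebraMap_mem_coeffSubfield (S := LaurentSeries k) ?_
  rw [PowerSeries.mem_coeffSubring]
  intro n
  rw [PowerSeries.coeff_map]
  intro i hi
  rw [PowerSeries.coeff_coe, if_pos hi]

variable [IsFractionRing (PowerSeries (LaurentSeries k)) F₀]

theorem PowerSeries.toFraction_injective : Function.Injective (PowerSeries.toFraction k F₀) := by
  refine (IsFractionRing.injective _ _).comp fun a b h => ?_
  ext1 n
  have := congrArg (PowerSeries.coeff n) h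
  rw [PowerSeries.coeff_map, PowerSeries.coeff_map] at this
  exact HahnSeries.ofPowerSeries_injective this

end TwoVariables

theorem LaurentSeries.exists_mul_mem_nonnegPart {k : Type} [Field k] (f : LaurentSeries k) :
    ∃ d ∈ LaurentSeries.nonnegPart k, d ≠ 0 ∧ d * f ∈ LaurentSeries.nonnegPart k := by
  refine ⟨HahnSeries.single (f.order.natAbs : ℤ) 1, fun n hn => ?_, ?_, fun n hn => ?_⟩
  · exact HahnSeries.coeff_single_of_ne (by omega)
  · exact HahnSeries.single_ne_zero one_ne_zero
  · rw [HahnSeries.coeff_single_mul, HahnSeries.coeff_eq_zero_of_lt_order (by omega), mul_zero]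

theorem LaurentSeries.patchingProperty {k : Type} [Field k] {F₀ : Type*} [Field F₀]
    [Algebra (PowerSeries (LaurentSeries k)) F₀]
    [IsFractionRing (PowerSeries (LaurentSeries k)) F₀] :
    PatchingProperty (PowerSeries.coeffSubfield (LaurentSeries.nonposPart k) F₀)
      (PowerSeries.coeffSubfield (LaurentSeries.nonnegPart k) F₀) :=
  PowerSeries.patchingProperty_coeffSubfield LaurentSeries.exists_add_eq
    LaurentSeries.exists_mul_mem_nonnegPart

theorem Module.Basis.repr_mem_of_repr_mem {d : ℕ} {F₀ K₀ : Type*} [Field F₀] [Field K₀]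
    [Algebra F₀ K₀] (b c : Module.Basis (Fin d) F₀ K₀) (F₁ : Subfield F₀)
    (h : ∀ i j, b.repr (c j) i ∈ F₁) (i j : Fin d) : c.repr (b j) i ∈ F₁ := by
  classical
  let N : Matrix (Fin d) (Fin d) F₁ := Matrix.of fun i j => ⟨b.repr (c j) i, h i j⟩
  have hN : F₁.subtype.mapMatrix N = b.toMatrix c := by
    ext i j
    rfl
  have h1 : b.toMatrix c * c.toMatrix b = 1 := b.toMatrix_mul_toMatrix_flip c
  have hdet : N.det ≠ 0 := by
    intro h0
    have h2 := congrArg Matrix.det h1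
    rw [Matrix.det_mul, ← hN, ← RingHom.map_det, h0, map_zero, zero_mul, Matrix.det_one] at h2
    exact zero_ne_one h2
  have h2 : N⁻¹ * N = 1 := Matrix.nonsing_inv_mul N (isUnit_iff_ne_zero.2 hdet)
  have h3 : F₁.subtype.mapMatrix N⁻¹ = c.toMatrix b := by
    have h4 := congrArg F₁.subtype.mapMatrix h2
    rw [map_mul, hN, map_one] at h4
    exact left_inv_eq_right_inv h4 h1
  have h5 := congrFun (congrFun h3 i) j
  rw [Module.Basis.toMatrix_apply] at h5
  rw [← h5]
  exact (N⁻¹ i j).2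

theorem toFraction_X_pow_mul_C_X {k : Type} [Field k] {F : Type} [Field F]
    [Algebra (PowerSeries k) F] {F₀ : Type} [Field F₀]
    [Algebra (PowerSeries (LaurentSeries k)) F₀] [Algebra F F₀]
    (hF : ∀ a : PowerSeries k, algebraMap F F₀ (algebraMap (PowerSeries k) F a) =
      algebraMap (PowerSeries (LaurentSeries k)) F₀ (PowerSeries.map HahnSeries.C a)) (N : ℕ) :
    PowerSeries.toFraction k F₀ (PowerSeries.X ^ N * PowerSeries.C PowerSeries.X) =
      algebraMap F F₀ (algebraMap (PowerSeries k) F (PowerSeries.X ^ N)) *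
        algebraMap (PowerSeries (LaurentSeries k)) F₀ (PowerSeries.C (HahnSeries.single 1 1)) := by
  rw [hF, ← map_mul, PowerSeries.toFraction, RingHom.comp_apply]
  congr 1
  rw [map_mul, map_pow, map_pow, PowerSeries.map_X, PowerSeries.map_X, PowerSeries.map_C]
  congr 2
  exact HahnSeries.ofPowerSeries_X

section PatchedLine

variable {k : Type} [Field k] {F : Type} [Field F] [Algebra (PowerSeries k) F]
  [IsFractionRing (PowerSeries k) F]
  {F₀ : Type} [Field F₀] [Algebra (PowerSeries (LaurentSeries k)) F₀]
  [IsFractionRing (PowerSeries (LaurentSeries k)) F₀] [Algebra F F₀]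

theorem not_isAlgebraic_C_single
    (hF : ∀ a : PowerSeries k, algebraMap F F₀ (algebraMap (PowerSeries k) F a) =
      algebraMap (PowerSeries (LaurentSeries k)) F₀ (PowerSeries.map HahnSeries.C a)) :
    ¬ IsAlgebraic F (algebraMap (PowerSeries (LaurentSeries k)) F₀
      (PowerSeries.C (HahnSeries.single 1 1))) := by
  intro h
  obtain ⟨c, hc⟩ := PowerSeries.constantCoeff_mem_of_isAlgebraic hF h
  rw [PowerSeries.constantCoeff_C] at hc
  have := congrArg (fun f : LaurentSeries k => f.coeff 1) hc
  simp [HahnSeries.C_apply] at this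

/-- The two subfields of a finite constant extension of the fraction field of `k((s))[[t]]` that
are patched, generated by `x` over the fields of series in `1/s` and in `s`. -/
theorem exists_patching_subfields
    (hF : ∀ a : PowerSeries k, algebraMap F F₀ (algebraMap (PowerSeries k) F a) =
      algebraMap (PowerSeries (LaurentSeries k)) F₀ (PowerSeries.map HahnSeries.C a))
    {F' : Type} [Field F'] [Algebra F F'] [FiniteDimensional F F'] [Algebra.IsSeparable F F']
    [Algebra (PowerSeries k) F'] [IsScalarTower (PowerSeries k) F F'] {θ : F'}
    (hθ : IsIntegral (PowerSeries k) θ) (hθt : IntermediateField.adjoin F {θ} = ⊤)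
    {p : Polynomial (PowerSeries k)} {N : ℕ}
    {x : AdjoinRoot ((minpoly (PowerSeries k) θ).map (PowerSeries.mapC k))}
    (hpm : p.Monic) (hpi : Irreducible (p.map (algebraMap (PowerSeries k) F)))
    (hpd : p.natDegree = (minpoly (PowerSeries k) θ).natDegree)
    (hpx : p.eval₂ ((AdjoinRoot.of _).comp (PowerSeries.mapC k)) x =
        AdjoinRoot.of _ (PowerSeries.X ^ N * PowerSeries.C PowerSeries.X)) :
    ∃ (K₀ : Type) (_ : Field K₀) (_ : Algebra F₀ K₀) (_ : Algebra F K₀) (_ : IsScalarTower F F₀ K₀)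
      (Ψ : AdjoinRoot ((minpoly (PowerSeries k) θ).map (PowerSeries.mapC k)) →+* K₀)
      (K₁ K₂ : Subfield K₀),
      (∀ a, Ψ (AdjoinRoot.of _ a) = algebraMap F₀ K₀ (PowerSeries.toFraction k F₀ a)) ∧
      PatchingProperty K₁ K₂ ∧ K₁ ⊓ K₂ = (IntermediateField.adjoin F {Ψ x}).toSubfield ∧
      (∀ z, Ψ z ∈ K₂) ∧ (∀ z : K₀, IsAlgebraic F z → z ∈ K₂) ∧
      (∀ a : F₀, algebraMap F₀ K₀ a ∈ K₂ ↔
        a ∈ PowerSeries.coeffSubfield (LaurentSeries.nonnegPart k) F₀) ∧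
      Transcendental F (Ψ x) ∧ Nonempty (F' →ₐ[F] K₀) := by
  classical
  have hFalg : ∀ z : F₀, IsAlgebraic F z → z ∈ (algebraMap F F₀).range :=
    fun z hz => mem_range_algebraMap_of_isAlgebraic hF hz
  have hqm := minpoly.monic hθ
  have hqF : minpoly F θ = (minpoly (PowerSeries k) θ).map (algebraMap (PowerSeries k) F) :=
    minpoly.isIntegrallyClosed_eq_field_fractions F F' hθ
  have hθF : IsIntegral F θ := hθ.tower_top
  have hqirr := minpoly.irreducible hθF
  have hqsep : (minpoly F θ).Separable := Algebra.IsSeparable.isSeparable F θ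
  let q₀ : Polynomial F₀ := (minpoly F θ).map (algebraMap F F₀)
  have hq₀m : q₀.Monic := (minpoly.monic hθF).map _
  have hq₀ : Irreducible q₀ :=
    (minpoly.monic hθF).irreducible_map_of_forall_isAlgebraic hFalg hqirr
  have : Fact (Irreducible q₀) := ⟨hq₀⟩
  let K₀ := AdjoinRoot q₀
  let pb : PowerBasis F₀ K₀ := AdjoinRoot.powerBasis hq₀.ne_zero
  have hpb : minpoly F₀ pb.gen = q₀ := AdjoinRoot.minpoly_powerBasis_gen_of_monic hq₀m
  have hgen0 : Polynomial.aeval pb.gen q₀ = 0 := 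
    (congrArg (Polynomial.aeval pb.gen) hpb).symm.trans (minpoly.aeval F₀ pb.gen)
  let θ₀ : K₀ := pb.gen
  have hdimq : (minpoly (PowerSeries k) θ).natDegree = pb.dim := by
    rw [← pb.natDegree_minpoly, hpb, Polynomial.natDegree_map, hqF,
      Polynomial.natDegree_map_eq_of_injective (IsFractionRing.injective _ _)]
  obtain ⟨q, hq⟩ : ∃ q, q = minpoly (PowerSeries k) θ := ⟨_, rfl⟩
  have hq0 : q.eval₂ (algebraMap (PowerSeries k) F') θ = 0 := by
    rw [hq]; exact minpoly.aeval _ _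
  revert x hpx
  rw [← hq] at hqm hdimq hqF hpd ⊢
  intro x hpx
  have hjF : ∀ a, PowerSeries.toFraction k F₀ (PowerSeries.mapC k a) =
      algebraMap F F₀ (algebraMap (PowerSeries k) F a) := fun a => by
    rw [PowerSeries.toFraction_mapC, hF]
  let Ψ : AdjoinRoot (q.map (PowerSeries.mapC k)) →+* K₀ :=
    AdjoinRoot.lift ((algebraMap F₀ K₀).comp (PowerSeries.toFraction k F₀)) θ₀ (by
      rw [Polynomial.eval₂_map, ← hgen0, Polynomial.aeval_def]
      simp only [q₀]
      rw [hqF, Polynomial.eval₂_map, Polynomial.eval₂_map]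
      congr 1
      ext a
      simp only [RingHom.comp_apply, hjF])
  have hΨ : ∀ a, Ψ (AdjoinRoot.of _ a) = algebraMap F₀ K₀ (PowerSeries.toFraction k F₀ a) :=
    fun a => AdjoinRoot.lift_of _
  have hΨθ : Ψ (AdjoinRoot.root _) = θ₀ := AdjoinRoot.lift_root _
  let ε : PowerSeries (PowerSeries k) →+* F :=
    (algebraMap (PowerSeries k) F).comp (PowerSeries.map PowerSeries.constantCoeff)
  have hεC : ∀ a, ε (PowerSeries.mapC k a) = algebraMap (PowerSeries k) F a := by
    intro a
    simp only [ε, RingHom.comp_apply]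
    congr 1
  let ε' : AdjoinRoot (q.map (PowerSeries.mapC k)) →+* F' :=
    AdjoinRoot.lift ((algebraMap F F').comp ε) θ (by
      rw [Polynomial.eval₂_map, ← hq0]
      congr 1
      ext a
      simp only [RingHom.comp_apply, hεC]
      rw [← IsScalarTower.algebraMap_apply])
  have hε' : ∀ a, ε' (AdjoinRoot.of _ a) = algebraMap F F' (ε a) :=
    fun a => AdjoinRoot.lift_of _
  have hpε : Polynomial.aeval (ε' x) (p.map (algebraMap (PowerSeries k) F)) = 0 := by
    have h := congrArg ε' hpx
    rw [Polynomial.hom_eval₂, hε'] at h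
    have h0 : ε (PowerSeries.X ^ N * PowerSeries.C PowerSeries.X) = 0 := by
      simp [ε]
    rw [h0, map_zero] at h
    rw [Polynomial.aeval_def, Polynomial.eval₂_map, ← h]
    congr 1
    ext a
    simp only [RingHom.comp_apply, hε', hεC]
  have hmx : minpoly F (ε' x) = p.map (algebraMap (PowerSeries k) F) :=
    (minpoly.eq_of_irreducible_of_monic hpi hpε (hpm.map _)).symm
  have hlin : LinearIndependent F fun i : Fin pb.dim => ε' x ^ (i : ℕ) := by
    have h := linearIndependent_pow (K := F) (ε' x)
    have hd : (minpoly F (ε' x)).natDegree = pb.dim := by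
      rw [hmx, Polynomial.natDegree_map_eq_of_injective (IsFractionRing.injective _ _), hpd, hdimq]
    rw [hd] at h
    exact h
  have hlin₀ : LinearIndependent F₀ fun i : Fin pb.dim => Ψ x ^ (i : ℕ) :=
    linearIndependent_pow_of_specialization (hqm.map _) (PowerSeries.toFraction_injective k F₀) ε
      (by rw [hqm.natDegree_map, hdimq]) pb.basis (fun i => pb.basis_eq_pow i) Ψ hΨ hΨθ ε' hε' hlin
  have hdpos : 0 < pb.dim := pb.dim_pos
  have : Nonempty (Fin pb.dim) := ⟨⟨0, hdpos⟩⟩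
  let b : Module.Basis (Fin pb.dim) F₀ K₀ :=
    basisOfLinearIndependentOfCardEqFinrank hlin₀ (by rw [Fintype.card_fin, pb.finrank])
  have hb : ∀ i, b i = Ψ x ^ (i : ℕ) := fun i => by
    simp only [b, coe_basisOfLinearIndependentOfCardEqFinrank]
  let s₀ : F₀ := algebraMap (PowerSeries (LaurentSeries k)) F₀
    (PowerSeries.C (HahnSeries.single 1 1))
  let γ : F₀ := PowerSeries.toFraction k F₀ (PowerSeries.X ^ N * PowerSeries.C PowerSeries.X)
  have hγ : γ = algebraMap F F₀ (algebraMap (PowerSeries k) F (PowerSeries.X ^ N)) * s₀ :=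
    toFraction_X_pow_mul_C_X hF N
  have hμ : algebraMap F F₀ (algebraMap (PowerSeries k) F (PowerSeries.X ^ N)) ≠ 0 := by
    rw [Ne, map_eq_zero, map_eq_zero_iff _ (IsFractionRing.injective _ _)]
    exact pow_ne_zero _ PowerSeries.X_ne_zero
  have hpγ : Polynomial.aeval (Ψ x) (p.map (algebraMap (PowerSeries k) F)) =
      algebraMap F₀ K₀ γ := by
    have h := congrArg Ψ hpx
    rw [Polynomial.hom_eval₂, hΨ] at h
    rw [Polynomial.aeval_def, Polynomial.eval₂_map, ← h]
    congr 1
    ext a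
    simp only [RingHom.comp_apply, hΨ, hjF]
    rfl
  have hOs : ∀ a : PowerSeries k, algebraMap F F₀ (algebraMap (PowerSeries k) F a) ∈ baseSubfield k F₀ := by
    intro a
    rw [hF]
    exact algebraMap_map_C_mem_baseSubfield a
  have hFs : ∀ a : F, algebraMap F F₀ a ∈ baseSubfield k F₀ := by
    intro a
    obtain ⟨u, v, -, rfl⟩ := IsFractionRing.div_surjective (A := PowerSeries k) a
    rw [map_div₀]
    exact div_mem (hOs _) (hOs _)
  have hss : s₀ ∈ baseSubfield k F₀ := algebraMap_C_single_mem_baseSubfield 1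
  have hγs : γ ∈ baseSubfield k F₀ := by
    rw [hγ]
    exact mul_mem (hOs _) hss
  have hmem : ∀ F₁ : Subfield F₀, baseSubfield k F₀ ≤ F₁ → ∀ z : K₀,
      z ∈ IntermediateField.adjoin F₁ {Ψ x} ↔ ∀ i, b.repr z i ∈ F₁ := by
    intro F₁ hF₁
    let φ : PowerSeries k →+* F₁ :=
      ((algebraMap F F₀).comp (algebraMap (PowerSeries k) F)).codRestrict F₁ fun a => hF₁ (hOs a)
    have hpos : 0 < (p.map φ).natDegree := by rw [hpm.natDegree_map, hpd, hdimq]; exact hdpos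
    refine mem_adjoin_simple_iff_repr_mem b hb F₁
      (P := p.map φ - Polynomial.C ⟨γ, hF₁ hγs⟩) ?_ ?_ ?_
    · exact (hpm.map φ).sub_of_left (lt_of_le_of_lt Polynomial.degree_C_le
        (Polynomial.natDegree_pos_iff_degree_pos.1 hpos))
    · rw [Polynomial.natDegree_sub_C, hpm.natDegree_map, hpd, hdimq]
    · rw [map_sub, Polynomial.aeval_C, sub_eq_zero, Polynomial.aeval_def, Polynomial.eval₂_map]
      rw [Polynomial.aeval_def, Polynomial.eval₂_map] at hpγ
      exact hpγ
  let F₁ := PowerSeries.coeffSubfield (LaurentSeries.nonposPart k) F₀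
  let F₂ := PowerSeries.coeffSubfield (LaurentSeries.nonnegPart k) F₀
  have hs1 : baseSubfield k F₀ ≤ F₁ := baseSubfield_le_coeffSubfield_nonpos
  have hs2 : baseSubfield k F₀ ≤ F₂ := baseSubfield_le_coeffSubfield_nonneg
  have hF2 : ∀ a ∈ F₂, algebraMap F₀ K₀ a ∈ IntermediateField.adjoin F₂ {Ψ x} := fun a ha =>
    algebraMap_mem (IntermediateField.adjoin F₂ {Ψ x}) (⟨a, ha⟩ : F₂)
  have hθ2 : θ₀ ∈ IntermediateField.adjoin F₂ {Ψ x} := by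
    have hcoord : ∀ i j, pb.basis.repr (b j) i ∈ F₂ := by
      intro i j
      obtain ⟨a, ha⟩ := AdjoinRoot.exists_eq_sum_of_mul_root_pow (hqm.map _) (x ^ (j : ℕ))
      rw [hb, ← map_pow, ha, map_sum, map_sum, Finsupp.finsetSum_apply]
      refine sum_mem fun l _ => ?_
      have hl : (l : ℕ) < pb.dim :=
      lt_of_lt_of_eq l.2 ((hqm.natDegree_map _).trans hdimq)
      rw [map_mul, map_pow, hΨ, hΨθ, ← Algebra.smul_def, ← pb.basis_eq_pow ⟨l, hl⟩, map_smul,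
        Module.Basis.repr_self, Finsupp.smul_apply, smul_eq_mul]
      refine mul_mem (PowerSeries.toFraction_mem k F₀ _) ?_
      rw [Finsupp.single_apply]
      split_ifs
      exacts [one_mem _, zero_mem _]
    have hpow : ∀ i : Fin pb.dim, pb.basis i ∈ IntermediateField.adjoin F₂ {Ψ x} := by
      intro i
      rw [← b.sum_repr (pb.basis i)]
      refine sum_mem fun j _ => ?_
      rw [Algebra.smul_def, hb]
      exact mul_mem (hF2 _ (pb.basis.repr_mem_of_repr_mem b F₂ hcoord j i))
        (pow_mem (IntermediateField.mem_adjoin_simple_self F₂ _) _)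
    obtain ⟨a, ha⟩ := AdjoinRoot.exists_eq_sum_of_mul_root_pow (hqm.map _)
      (AdjoinRoot.root (q.map (PowerSeries.mapC k)))
    rw [← hΨθ, ha, map_sum]
    refine sum_mem fun l _ => ?_
    have hl : (l : ℕ) < pb.dim :=
      lt_of_lt_of_eq l.2 ((hqm.natDegree_map _).trans hdimq)
    rw [map_mul, map_pow, hΨ, hΨθ, ← pb.basis_eq_pow ⟨l, hl⟩]
    exact mul_mem (hF2 _ (PowerSeries.toFraction_mem k F₀ _)) (hpow _)
  refine ⟨K₀, inferInstance, inferInstance, inferInstance, inferInstance, Ψ,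
    (IntermediateField.adjoin F₁ {Ψ x}).toSubfield, (IntermediateField.adjoin F₂ {Ψ x}).toSubfield,
    hΨ, ?_, ?_, ?_, ?_, ?_, ?_, ?_⟩
  · refine LaurentSeries.patchingProperty.lift b
      (fun a ha => algebraMap_mem (IntermediateField.adjoin F₁ {Ψ x}) (⟨a, ha⟩ : F₁)) hF2 ?_ ?_
    · intro i
      rw [hb]
      exact pow_mem (IntermediateField.mem_adjoin_simple_self F₁ (Ψ x)) _
    · intro i
      rw [hb]
      exact pow_mem (IntermediateField.mem_adjoin_simple_self F₂ (Ψ x)) _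
  · ext z
    rw [Subfield.mem_inf, IntermediateField.mem_toSubfield, IntermediateField.mem_toSubfield,
      IntermediateField.mem_toSubfield, hmem F₁ hs1, hmem F₂ hs2]
    constructor
    · rintro ⟨h1, h2⟩
      have h3 : ∀ a ∈ baseSubfield k F₀, algebraMap F₀ K₀ a ∈ IntermediateField.adjoin F {Ψ x} := by
        intro a ha
        have hs : algebraMap F₀ K₀ s₀ ∈ IntermediateField.adjoin F {Ψ x} := by
          have e : algebraMap F₀ K₀ s₀ =
              (algebraMap F K₀ (algebraMap (PowerSeries k) F (PowerSeries.X ^ N)))⁻¹ *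
              Polynomial.aeval (Ψ x) (p.map (algebraMap (PowerSeries k) F)) := by
            rw [hpγ, hγ, map_mul, ← IsScalarTower.algebraMap_apply F F₀ K₀, inv_mul_cancel_left₀]
            rw [IsScalarTower.algebraMap_apply F F₀ K₀, Ne, map_eq_zero]
            exact hμ
          rw [e]
          exact mul_mem (inv_mem (algebraMap_mem _ _))
            (IntermediateField.algebra_adjoin_le_adjoin _ _
              (Polynomial.aeval_mem_adjoin_singleton F (Ψ x)))
        have hle : baseSubfield k F₀ ≤
            (IntermediateField.adjoin F {Ψ x}).toSubfield.comap (algebraMap F₀ K₀) := by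
          refine Subfield.closure_le.2 (Set.insert_subset hs ?_)
          rintro _ ⟨_, ⟨a, rfl⟩, rfl⟩
          change algebraMap F₀ K₀ _ ∈ IntermediateField.adjoin F {Ψ x}
          rw [← hF, ← IsScalarTower.algebraMap_apply F F₀ K₀]
          exact algebraMap_mem _ _
        exact hle ha
      rw [← b.sum_repr z]
      refine sum_mem fun i _ => ?_
      rw [Algebra.smul_def, hb]
      refine mul_mem (h3 _ ?_) (pow_mem (IntermediateField.mem_adjoin_simple_self F _) _)
      rw [← coeffSubfield_inf_coeffSubfield]
      exact ⟨h1 i, h2 i⟩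
    · intro hz
      have h3 : ∀ F₁ : Subfield F₀, baseSubfield k F₀ ≤ F₁ →
          z ∈ IntermediateField.adjoin F₁ {Ψ x} := by
        intro F₁ hF₁
        induction hz using IntermediateField.adjoin_induction with
        | mem z hz =>
          rw [Set.mem_singleton_iff.1 hz]
          exact IntermediateField.mem_adjoin_simple_self F₁ _
        | algebraMap a =>
          rw [IsScalarTower.algebraMap_apply F F₀ K₀]
          exact algebraMap_mem (IntermediateField.adjoin F₁ {Ψ x}) (⟨_, hF₁ (hFs a)⟩ : F₁)
        | add u v _ _ hu hv => exact add_mem hu hv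
        | inv u _ hu => exact inv_mem hu
        | mul u v _ _ hu hv => exact mul_mem hu hv
      exact ⟨(hmem F₁ hs1 z).1 (h3 F₁ hs1), (hmem F₂ hs2 z).1 (h3 F₂ hs2)⟩
  · intro z
    obtain ⟨a, rfl⟩ := AdjoinRoot.exists_eq_sum_of_mul_root_pow (hqm.map _) z
    rw [map_sum]
    refine sum_mem fun i _ => ?_
    rw [map_mul, map_pow, hΨ, hΨθ]
    exact mul_mem (hF2 _ (PowerSeries.toFraction_mem k F₀ _)) (pow_mem hθ2 _)
  · intro z hz
    have hc := pb.repr_mem_range_of_isAlgebraic hFalg hqsep hpb hz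
    rw [← pb.basis.sum_repr z]
    refine sum_mem fun i _ => ?_
    rw [pb.basis_eq_pow, Algebra.smul_def]
    obtain ⟨a, ha⟩ := hc i
    refine mul_mem (hF2 _ ?_) (pow_mem hθ2 _)
    rw [← ha]
    exact hs2 (hFs a)
  · refine fun a => ⟨fun ha => ?_, hF2 a⟩
    have h := (hmem F₂ hs2 _).1 ha ⟨0, hdpos⟩
    have e : algebraMap F₀ K₀ a = a • b ⟨0, hdpos⟩ := by
      rw [hb, pow_zero, Algebra.smul_def, mul_one]
    rw [e, map_smul, b.repr_self, Finsupp.smul_apply, Finsupp.single_eq_same, smul_eq_mul,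
      mul_one] at h
    exact h
  · intro halg
    apply not_isAlgebraic_C_single hF
    have h1 : IsAlgebraic F (algebraMap F₀ K₀ γ) := by
      rw [← hpγ]
      exact (mem_algebraicClosure_iff (F := F)).1
        (by
          rw [← IntermediateField.mem_toSubalgebra]
          exact Algebra.adjoin_le (Set.singleton_subset_iff.2 (mem_algebraicClosure_iff.2 halg))
            (Polynomial.aeval_mem_adjoin_singleton F (Ψ x)))
    have h2 : IsAlgebraic F γ :=
      (isAlgebraic_algebraMap_iff (algebraMap F₀ K₀).injective).1 h1
    have e : s₀ = algebraMap F F₀ (algebraMap (PowerSeries k) F (PowerSeries.X ^ N))⁻¹ * γ := by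
      rw [hγ, map_inv₀, inv_mul_cancel_left₀ hμ]
    change IsAlgebraic F s₀
    rw [e]
    exact (isAlgebraic_algebraMap _).mul h2
  · have hr : Polynomial.aeval θ₀ (minpoly F θ) = 0 := by
      rw [← Polynomial.aeval_map_algebraMap F₀]
      exact hgen0
    let pbF : PowerBasis F F' := (IntermediateField.adjoin.powerBasis hθF).map
      ((IntermediateField.equivOfEq hθt).trans IntermediateField.topEquiv)
    refine ⟨pbF.lift θ₀ ?_⟩
    have : pbF.gen = θ := by
      simp [pbF]
    rw [this]
    exact hr

end PatchedLine

theorem IsFractionRing.exists_map_eq_C_mul {R E : Type*} [CommRing R] [IsDomain R] [Field E]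
    [Algebra R E] [IsFractionRing R E] (p : Polynomial E) :
    ∃ (b : R) (P : Polynomial R), b ≠ 0 ∧
      P.map (algebraMap R E) = Polynomial.C (algebraMap R E b) * p := by
  obtain ⟨b, hb, h⟩ := IsLocalization.integerNormalization_spec (nonZeroDivisors R) p
  refine ⟨b, _, nonZeroDivisors.ne_zero hb, h.trans ?_⟩
  rw [← IsScalarTower.algebraMap_smul E, Polynomial.smul_eq_C_mul]

/-- A primitive element that is integral over a subring with the given fraction field. -/
theorem exists_isIntegral_adjoin_eq_top (R : Type*) (E L : Type*) [CommRing R] [IsDomain R]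
    [Field E] [Field L]
    [Algebra R E] [IsFractionRing R E] [Algebra E L] [Algebra R L] [IsScalarTower R E L]
    [FiniteDimensional E L] [Algebra.IsSeparable E L] :
    ∃ y : L, IsIntegral R y ∧ IntermediateField.adjoin E {y} = ⊤ := by
  obtain ⟨α, hα⟩ := Field.exists_primitive_element E L
  have halg : IsAlgebraic R α :=
    (IsFractionRing.isAlgebraic_iff R E L).2 (Algebra.IsAlgebraic.isAlgebraic α)
  obtain ⟨d, hd, hi⟩ := halg.exists_integral_multiple
  refine ⟨d • α, hi, ?_⟩
  rw [eq_top_iff, ← hα, IntermediateField.adjoin_simple_le_iff]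
  have hd' : algebraMap R E d ≠ 0 :=
    (map_ne_zero_iff _ (IsFractionRing.injective R E)).2 hd
  have e : α = (algebraMap R E d)⁻¹ • (d • α) := by
    rw [← IsScalarTower.algebraMap_smul E d α, inv_smul_smul₀ hd']
  have h := (IntermediateField.adjoin E {d • α}).smul_mem (x := (algebraMap R E d)⁻¹)
    (IntermediateField.mem_adjoin_simple_self E _)
  rwa [← e] at h

theorem Polynomial.exists_mul_add_mul_derivative_eq_C {R E : Type*} [CommRing R] [IsDomain R]
    [Field E] [Algebra R E] [IsFractionRing R E] {Q : Polynomial R}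
    (hQ : (Q.map (algebraMap R E)).Separable) :
    ∃ (U V : Polynomial R) (D : R), D ≠ 0 ∧ U * Q + V * Q.derivative = Polynomial.C D := by
  obtain ⟨a, b, h⟩ := hQ
  obtain ⟨c, A, hc, hA⟩ := IsFractionRing.exists_map_eq_C_mul (R := R) a
  obtain ⟨d, B, hd, hB⟩ := IsFractionRing.exists_map_eq_C_mul (R := R) b
  refine ⟨Polynomial.C d * A, Polynomial.C c * B, c * d, mul_ne_zero hc hd, ?_⟩
  apply Polynomial.map_injective _ (IsFractionRing.injective R E)
  rw [Polynomial.map_add, Polynomial.map_mul, Polynomial.map_mul, Polynomial.map_mul,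
    Polynomial.map_mul, hA, hB, Polynomial.map_C, Polynomial.map_C, Polynomial.map_C,
    ← Polynomial.derivative_map, map_mul, map_mul]
  rw [← mul_one (Polynomial.C (algebraMap R E c) * Polynomial.C (algebraMap R E d)), ← h]
  ring

/-- A finite separable extension containing a root of a separable polynomial and a primitive
root of unity. -/
theorem exists_separable_extension_root_isPrimitiveRoot {F : Type} [Field F] {q : Polynomial F}
    (hq : q.Separable) (hd : q.degree ≠ 0) {n : ℕ} (hn : (n : F) ≠ 0) :
    ∃ (F' : Type) (_ : Field F') (_ : Algebra F F') (_ : FiniteDimensional F F')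
      (_ : Algebra.IsSeparable F F') (y ζ : F'), Polynomial.aeval y q = 0 ∧ IsPrimitiveRoot ζ n := by
  have : NeZero (n : F) := ⟨hn⟩
  have : NeZero (n : SeparableClosure F) := 
    ⟨by rw [← map_natCast (algebraMap F (SeparableClosure F)), Ne, map_eq_zero]; exact hn⟩
  obtain ⟨y, hy⟩ := IsSepClosed.exists_aeval_eq_zero (SeparableClosure F) q hd hq
  obtain ⟨ζ, hζ⟩ := HasEnoughRootsOfUnity.exists_primitiveRoot (SeparableClosure F) n
  have hi : ∀ z ∈ ({y, ζ} : Set (SeparableClosure F)), IsIntegral F z := fun z _ =>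
    Algebra.IsIntegral.isIntegral z
  have hfin : FiniteDimensional F (IntermediateField.adjoin F {y, ζ}) :=
    IntermediateField.finiteDimensional_adjoin hi
  refine ⟨IntermediateField.adjoin F {y, ζ}, inferInstance, inferInstance, hfin, inferInstance,
    ⟨y, IntermediateField.subset_adjoin _ _ (by simp)⟩,
    ⟨ζ, IntermediateField.subset_adjoin _ _ (by simp)⟩, ?_, ?_⟩
  · apply (algebraMap (IntermediateField.adjoin F {y, ζ}) (SeparableClosure F)).injective
    rw [← Polynomial.aeval_algebraMap_apply, map_zero]
    exact hy
  · exact IsPrimitiveRoot.of_map_of_injective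
      (f := algebraMap (IntermediateField.adjoin F {y, ζ}) (SeparableClosure F)) hζ
      (RingHom.injective _)

theorem Polynomial.derivative_scaleRoots_eval₂ {R S : Type*} [CommRing R] [CommRing S] [IsDomain S]
    (f : R →+* S) (p : Polynomial R) (b : R) (hb : f b ≠ 0) {y : S}
    (hy : p.derivative.eval₂ f y ≠ 0) : (p.scaleRoots b).derivative.eval₂ f (f b * y) ≠ 0 := by
  have e : ((p.scaleRoots b).map f).comp (Polynomial.C (f b) * Polynomial.X) =
      Polynomial.C (f b ^ p.natDegree) * p.map f := by
    ext i
    rw [Polynomial.comp_C_mul_X_coeff, Polynomial.coeff_map, Polynomial.coeff_scaleRoots,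
      Polynomial.coeff_C_mul, Polynomial.coeff_map, map_mul, map_pow]
    rcases le_or_gt i p.natDegree with hi | hi
    · rw [mul_assoc, ← pow_add, Nat.sub_add_cancel hi, mul_comm]
    · rw [Polynomial.coeff_eq_zero_of_natDegree_lt hi, map_zero, zero_mul, zero_mul, mul_zero]
  have h := congrArg (fun g => (Polynomial.derivative g).eval y) e
  simp only [Polynomial.derivative_comp, Polynomial.derivative_C_mul, Polynomial.derivative_X,
    Polynomial.eval_mul, Polynomial.eval_comp, Polynomial.eval_C, Polynomial.eval_X,
    Polynomial.derivative_map, Polynomial.eval_map, mul_one] at h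
  intro h0
  rw [h0, mul_zero] at h
  exact mul_ne_zero (pow_ne_zero _ hb) hy h.symm

/-- A rational function field is the fraction field of polynomials over any ring whose fraction
field is the field of constants. -/
theorem Polynomial.isFractionRing_of_transcendental {O F E : Type*} [CommRing O] [IsDomain O]
    [Field F] [Field E] [Algebra O F] [IsFractionRing O F] [Algebra F E] {x : E}
    (hx : Transcendental F x) (hxt : IntermediateField.adjoin F {x} = ⊤)
    [Algebra (Polynomial O) E] (h : ∀ g : Polynomial O,
      algebraMap (Polynomial O) E g = Polynomial.aeval x (g.map (algebraMap O F))) :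
    IsFractionRing (Polynomial O) E := by
  have : FaithfulSMul (Polynomial O) E := by
    rw [faithfulSMul_iff_algebraMap_injective, injective_iff_map_eq_zero]
    intro g hg
    rw [h] at hg
    by_contra hg0
    exact hx ⟨_, (Polynomial.map_ne_zero_iff (IsFractionRing.injective O F)).2 hg0, hg⟩
  refine IsFractionRing.of_field _ _ fun z => ?_
  have hz : z ∈ IntermediateField.adjoin F {x} := hxt ▸ IntermediateField.mem_top
  obtain ⟨r, s, rfl⟩ := (IntermediateField.mem_adjoin_simple_iff F z).1 hz
  obtain ⟨b, P, hb, hP⟩ := IsFractionRing.exists_map_eq_C_mul (R := O) r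
  obtain ⟨c, S, hc, hS⟩ := IsFractionRing.exists_map_eq_C_mul (R := O) s
  refine ⟨Polynomial.C c * P, Polynomial.C b * S, ?_⟩
  have hb' : algebraMap F E (algebraMap O F b) ≠ 0 := by
    rwa [Ne, map_eq_zero, map_eq_zero_iff _ (IsFractionRing.injective O F)]
  have hc' : algebraMap F E (algebraMap O F c) ≠ 0 := by
    rwa [Ne, map_eq_zero, map_eq_zero_iff _ (IsFractionRing.injective O F)]
  rw [h, h, Polynomial.map_mul, Polynomial.map_mul, hP, hS, Polynomial.map_C, Polynomial.map_C,
    map_mul, map_mul, map_mul, map_mul, Polynomial.aeval_C, Polynomial.aeval_C, ← mul_assoc,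
    ← mul_assoc, mul_comm (algebraMap F E (algebraMap O F c)),
    mul_div_mul_left _ _ (mul_ne_zero hb' hc')]

section Chart

variable {k : Type} [Field k] {F : Type} [Field F] [Algebra (PowerSeries k) F]
  [IsFractionRing (PowerSeries k) F]
  {F₀ : Type} [Field F₀] [Algebra (PowerSeries (LaurentSeries k)) F₀]
  [IsFractionRing (PowerSeries (LaurentSeries k)) F₀] [Algebra F F₀]

/-- A cover of the line has a point over the subfield of series in `s`, for a suitable choice of
the coordinate. -/
theorem exists_patched_point
    (hF : ∀ a : PowerSeries k, algebraMap F F₀ (algebraMap (PowerSeries k) F a) =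
      algebraMap (PowerSeries (LaurentSeries k)) F₀ (PowerSeries.map HahnSeries.C a))
    {Q U V : Polynomial (Polynomial (PowerSeries k))} {D : Polynomial (PowerSeries k)}
    (hQ : Q.Monic) (hQd : Q.natDegree ≠ 0) (hD : D ≠ 0)
    (hUV : U * Q + V * Q.derivative = Polynomial.C D) {n : ℕ} (hn : (n : F) ≠ 0) :
    ∃ (K₀ : Type) (_ : Field K₀) (_ : Algebra F₀ K₀) (_ : Algebra F K₀) (_ : IsScalarTower F F₀ K₀)
      (K₁ K₂ : Subfield K₀) (x y ζ : K₀),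
      Transcendental F x ∧ K₁ ⊓ K₂ = (IntermediateField.adjoin F {x}).toSubfield ∧
      PatchingProperty K₁ K₂ ∧ (∀ z : K₀, IsAlgebraic F z → z ∈ K₂) ∧
      (∀ a : F₀, algebraMap F₀ K₀ a ∈ K₂ ↔
        a ∈ PowerSeries.coeffSubfield (LaurentSeries.nonnegPart k) F₀) ∧
      IsPrimitiveRoot ζ n ∧ y ∈ K₂ ∧
      Q.eval₂ (Polynomial.eval₂RingHom
        ((algebraMap F K₀).comp (algebraMap (PowerSeries k) F)) x) y = 0 := by
  classical
  have : Infinite (PowerSeries k) := Infinite.of_injective (fun n : ℕ => PowerSeries.X ^ n)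
    fun i j h => by
      have := congrArg PowerSeries.order h
      simpa [PowerSeries.order_X_pow] using this
  obtain ⟨x₀, hx₀⟩ : ∃ x₀, D.eval x₀ ≠ 0 := by
    by_contra! h
    exact hD (Polynomial.funext fun r => by rw [h r, Polynomial.eval_zero])
  have hOF := IsFractionRing.injective (PowerSeries k) F
  let σ : Polynomial (PowerSeries k) →+* F :=
    (algebraMap (PowerSeries k) F).comp (Polynomial.evalRingHom x₀)
  have hσD : σ D ≠ 0 := (map_ne_zero_iff _ hOF).2 hx₀
  have hsep : (Q.map σ).Separable := by
    refine ⟨Polynomial.C (σ D)⁻¹ * U.map σ, Polynomial.C (σ D)⁻¹ * V.map σ, ?_⟩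
    rw [Polynomial.derivative_map, mul_assoc, mul_assoc, ← mul_add, ← Polynomial.map_mul,
      ← Polynomial.map_mul, ← Polynomial.map_add, hUV, Polynomial.map_C, ← Polynomial.C_mul,
      inv_mul_cancel₀ hσD, Polynomial.C_1]
  have hdeg : (Q.map σ).degree ≠ 0 := by
    rw [Polynomial.degree_eq_natDegree (hQ.map σ).ne_zero, hQ.natDegree_map]
    exact_mod_cast hQd
  obtain ⟨F', _, _, _, _, y₀, ζ, hy₀, hζ⟩ :=
    exists_separable_extension_root_isPrimitiveRoot hsep hdeg hn
  let _ : Algebra (PowerSeries k) F' :=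
    ((algebraMap F F').comp (algebraMap (PowerSeries k) F)).toAlgebra
  have : IsScalarTower (PowerSeries k) F F' := IsScalarTower.of_algebraMap_eq fun _ => rfl
  obtain ⟨θ, hθ, hθt⟩ := exists_isIntegral_adjoin_eq_top (PowerSeries k) F F'
  obtain ⟨g, hg⟩ : ∃ g : Polynomial F, Polynomial.aeval θ g = y₀ := by
    have h : y₀ ∈ IntermediateField.adjoin F {θ} := hθt ▸ IntermediateField.mem_top
    rw [← IntermediateField.mem_toSubalgebra, IntermediateField.adjoin_simple_toSubalgebra_of_isAlgebraic
      (Algebra.IsAlgebraic.isAlgebraic θ), Algebra.adjoin_singleton_eq_range_aeval] at h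
    exact h
  obtain ⟨b, g', hb, hg'⟩ := IsFractionRing.exists_map_eq_C_mul (R := PowerSeries k) g
  have hb' : algebraMap (PowerSeries k) F' b ≠ 0 := by
    rw [IsScalarTower.algebraMap_apply (PowerSeries k) F F', Ne, map_eq_zero,
      map_eq_zero_iff _ hOF]
    exact hb
  let ι : AdjoinRoot (minpoly (PowerSeries k) θ) →+* F' :=
    AdjoinRoot.lift (algebraMap (PowerSeries k) F') θ (minpoly.aeval _ _)
  let y₁ : AdjoinRoot (minpoly (PowerSeries k) θ) := AdjoinRoot.mk _ g'
  have hι : ∀ a, ι (AdjoinRoot.of _ a) = algebraMap (PowerSeries k) F' a :=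
    fun a => AdjoinRoot.lift_of _
  have hιy : ι y₁ = algebraMap (PowerSeries k) F' b * y₀ := by
    have h := congrArg (Polynomial.aeval θ) hg'
    rw [map_mul, Polynomial.aeval_C, hg, Polynomial.aeval_map_algebraMap,
      ← IsScalarTower.algebraMap_apply] at h
    rw [← h]
    exact AdjoinRoot.lift_mk _ _
  have : Module.IsTorsionFree (PowerSeries k) F' :=
    Module.isTorsionFree_iff_algebraMap_injective.2 ((algebraMap F F').injective.comp hOF)
  have hιinj : Function.Injective ι := by
    rw [injective_iff_map_eq_zero]
    intro z hz
    obtain ⟨P, rfl⟩ := AdjoinRoot.mk_surjective z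
    rw [AdjoinRoot.mk_eq_zero, ← minpoly.isIntegrallyClosed_dvd_iff hθ]
    rw [← hz]
    exact (AdjoinRoot.lift_mk _ _).symm
  let ev : Polynomial (PowerSeries k) →+* AdjoinRoot (minpoly (PowerSeries k) θ) :=
    Polynomial.eval₂RingHom (AdjoinRoot.of _) (AdjoinRoot.of _ x₀)
  have hev : ι.comp ev = (algebraMap F F').comp σ := by
    ext a
    · simp [ev, σ, hι, IsScalarTower.algebraMap_apply (PowerSeries k) F F']
    · simp [ev, σ, hι, IsScalarTower.algebraMap_apply (PowerSeries k) F F']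
  have hevb : (ι.comp ev) (Polynomial.C b) = algebraMap (PowerSeries k) F' b := by
    simp [ev, hι]
  have hQy : Q.eval₂ (ι.comp ev) y₀ = 0 := by
    rw [hev, ← Polynomial.eval₂_map, ← Polynomial.aeval_def]
    exact hy₀
  obtain ⟨p, N, x, y, hpm, hpi, hpd, hpx, hQxy⟩ := exists_newton_points hθ hθt
    (Q.scaleRoots (Polynomial.C b)) x₀ y₁ (by
      apply hιinj
      change ι (Polynomial.eval₂ ev y₁ _) = _
      rw [Polynomial.hom_eval₂, hιy, map_zero, ← hevb, Polynomial.scaleRoots_eval₂_mul, hQy,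
        mul_zero]) (by
      intro h
      have h' := congrArg ι h
      change ι (Polynomial.eval₂ ev y₁ _) = _ at h'
      rw [Polynomial.hom_eval₂, hιy, map_zero, ← hevb] at h'
      refine Polynomial.derivative_scaleRoots_eval₂ (ι.comp ev) Q (Polynomial.C b)
        (by rwa [hevb]) (fun h0 => ?_) h'
      have h2 := congrArg (Polynomial.eval₂ (ι.comp ev) y₀) hUV
      rw [Polynomial.eval₂_add, Polynomial.eval₂_mul, Polynomial.eval₂_mul, hQy, h0, mul_zero,
        mul_zero, add_zero, Polynomial.eval₂_C, hev, RingHom.comp_apply] at h2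
      exact hσD ((map_eq_zero _).1 h2.symm))
  obtain ⟨K₀, _, _, _, _, Ψ, K₁, K₂, hΨ, hP, hinf, hΨ2, halg, hF2, htr, ⟨j⟩⟩ :=
    exists_patching_subfields hF hθ hθt hpm hpi hpd hpx
  have hΨC : ∀ a, Ψ (AdjoinRoot.of _ (PowerSeries.mapC k a)) =
      algebraMap F K₀ (algebraMap (PowerSeries k) F a) := fun a => by
    rw [hΨ, PowerSeries.toFraction_mapC, ← hF, ← IsScalarTower.algebraMap_apply F F₀ K₀]
  have hbK : algebraMap F K₀ (algebraMap (PowerSeries k) F b) ≠ 0 := by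
    rwa [Ne, map_eq_zero, map_eq_zero_iff _ hOF]
  refine ⟨K₀, inferInstance, inferInstance, inferInstance, inferInstance, K₁, K₂, Ψ x,
    Ψ y / Ψ (AdjoinRoot.of _ (PowerSeries.mapC k b)), j ζ, htr, hinf, hP, halg, hF2,
    hζ.map_of_injective j.toRingHom.injective, div_mem (hΨ2 _) (hΨ2 _), ?_⟩
  have hring : Ψ.comp (Polynomial.eval₂RingHom ((AdjoinRoot.of _).comp (PowerSeries.mapC k)) x) =
      Polynomial.eval₂RingHom ((algebraMap F K₀).comp (algebraMap (PowerSeries k) F)) (Ψ x) := by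
    ext a
    · simp [hΨC]
    · simp
  have hCb : Polynomial.eval₂RingHom ((algebraMap F K₀).comp (algebraMap (PowerSeries k) F)) (Ψ x)
      (Polynomial.C b) = Ψ (AdjoinRoot.of _ (PowerSeries.mapC k b)) := by
    simp [hΨC]
  have hne : Ψ (AdjoinRoot.of _ (PowerSeries.mapC k b)) ≠ 0 := by rwa [hΨC]
  have h := congrArg Ψ hQxy
  rw [Polynomial.hom_eval₂, hring, map_zero, ← mul_div_cancel₀ (Ψ y) hne, ← hCb,
    Polynomial.scaleRoots_eval₂_mul] at h
  rw [hCb] at h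
  exact (mul_eq_zero.1 h).resolve_left (pow_ne_zero _ hne)

end Chart

section Chart

variable {k : Type} [Field k] {F : Type} [Field F] [Algebra (PowerSeries k) F]
  [IsFractionRing (PowerSeries k) F]
  {F₀ : Type} [Field F₀] [Algebra (PowerSeries (LaurentSeries k)) F₀]
  [IsFractionRing (PowerSeries (LaurentSeries k)) F₀] [Algebra F F₀]

/-- A rational function field `E` and a finite Galois extension of it embed in a field with two
patching subfields that meet in `E`, such that the Galois extension lies in the second one. -/
theorem exists_chart
    (hF : ∀ a : PowerSeries k, algebraMap F F₀ (algebraMap (PowerSeries k) F a) =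
      algebraMap (PowerSeries (LaurentSeries k)) F₀ (PowerSeries.map HahnSeries.C a))
    {E L : Type} [Field E] [Algebra F E] [Field L] [Algebra E L] [FiniteDimensional E L]
    [Algebra.IsSeparable E L] {x : E} (hx : Transcendental F x)
    (hxt : IntermediateField.adjoin F {x} = ⊤) {n : ℕ} (hn : (n : F) ≠ 0) :
    ∃ (K₀ : Type) (_ : Field K₀) (_ : Algebra F₀ K₀) (_ : Algebra F K₀) (_ : IsScalarTower F F₀ K₀)
      (_ : Algebra E K₀) (_ : IsScalarTower F E K₀) (K₁ K₂ : IntermediateField E K₀)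
      (j : L →ₐ[E] K₀) (ζ : K₀),
      K₁ ⊓ K₂ = ⊥ ∧ PatchingProperty K₁.toSubfield K₂.toSubfield ∧
      (∀ z : K₀, IsAlgebraic F z → z ∈ K₂) ∧
      (∀ a : F₀, algebraMap F₀ K₀ a ∈ K₂ ↔
        a ∈ PowerSeries.coeffSubfield (LaurentSeries.nonnegPart k) F₀) ∧
      j.fieldRange ≤ K₂ ∧ IsPrimitiveRoot ζ n := by
  let evx : Polynomial (PowerSeries k) →+* E :=
    (Polynomial.aeval x).toRingHom.comp (Polynomial.mapRingHom (algebraMap (PowerSeries k) F))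
  let _ : Algebra (Polynomial (PowerSeries k)) E := evx.toAlgebra
  have hOE : ∀ g : Polynomial (PowerSeries k), algebraMap (Polynomial (PowerSeries k)) E g =
      Polynomial.aeval x (g.map (algebraMap (PowerSeries k) F)) := fun _ => rfl
  have : IsFractionRing (Polynomial (PowerSeries k)) E :=
    Polynomial.isFractionRing_of_transcendental hx hxt hOE
  let _ : Algebra (Polynomial (PowerSeries k)) L :=
    ((algebraMap E L).comp (algebraMap (Polynomial (PowerSeries k)) E)).toAlgebra
  have : IsScalarTower (Polynomial (PowerSeries k)) E L :=
    IsScalarTower.of_algebraMap_eq fun _ => rfl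
  obtain ⟨y, hy, hyt⟩ := exists_isIntegral_adjoin_eq_top (Polynomial (PowerSeries k)) E L
  have hQE : minpoly E y = (minpoly (Polynomial (PowerSeries k)) y).map _ :=
    minpoly.isIntegrallyClosed_eq_field_fractions E L hy
  have hQm := minpoly.monic hy
  have hyE : IsIntegral E y := hy.tower_top
  obtain ⟨Q, hQ⟩ : ∃ Q, Q = minpoly (Polynomial (PowerSeries k)) y := ⟨_, rfl⟩
  rw [← hQ] at hQE hQm
  have hsep : (Q.map (algebraMap (Polynomial (PowerSeries k)) E)).Separable := by
    rw [← hQE]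
    exact Algebra.IsSeparable.isSeparable E y
  have hQd : Q.natDegree ≠ 0 := by
    rw [← hQm.natDegree_map (algebraMap (Polynomial (PowerSeries k)) E), ← hQE]
    exact (minpoly.natDegree_pos hyE).ne'
  obtain ⟨U, V, D, hD, hUV⟩ := Polynomial.exists_mul_add_mul_derivative_eq_C hsep
  obtain ⟨K₀, _, _, _, _, K₁, K₂, x', y', ζ, hx', hinf, hP, halg, hF2, hζ, hy2, hQy⟩ :=
    exists_patched_point hF hQm hQd hD hUV hn
  let φ : E →ₐ[F] K₀ := (IntermediateField.adjoin F {x'}).val.comp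
    ((((IntermediateField.topEquiv (F := F) (E := E)).symm.trans
      (IntermediateField.equivOfEq hxt.symm)).trans
      (RatFunc.algEquivOfTranscendental x hx).symm).trans
      (RatFunc.algEquivOfTranscendental x' hx')).toAlgHom
  have hφ : ∀ a : E, φ a ∈ IntermediateField.adjoin F {x'} := fun a => Subtype.property _
  have hφx : φ x = x' := by
    have e : (IntermediateField.equivOfEq hxt.symm)
        ((IntermediateField.topEquiv (F := F) (E := E)).symm x) =
        IntermediateField.AdjoinSimple.gen F x := rfl
    change ((RatFunc.algEquivOfTranscendental x' hx') ((RatFunc.algEquivOfTranscendental x hx).symm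
      ((IntermediateField.equivOfEq hxt.symm)
        ((IntermediateField.topEquiv (F := F) (E := E)).symm x))) : K₀) = x'
    rw [e, RatFunc.algEquivOfTranscendental_symm_gen, RatFunc.algEquivOfTranscendental_X]
  let _ : Algebra E K₀ := φ.toRingHom.toAlgebra
  have hφE : ∀ a, algebraMap E K₀ a = φ a := fun _ => rfl
  have : IsScalarTower F E K₀ := IsScalarTower.of_algebraMap_eq fun a => (φ.commutes a).symm
  have hE : ∀ a : E, algebraMap E K₀ a ∈ K₁ ⊓ K₂ := fun a => by
    rw [hinf]
    exact hφ a
  have hroot : Polynomial.aeval y' (minpoly E y) = 0 := by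
    rw [hQE, Polynomial.aeval_def, Polynomial.eval₂_map, ← hQy]
    congr 1
    ext a
    · simp [hOE, IsScalarTower.algebraMap_apply F E K₀]
    · simp [hOE, hφE, hφx]
  let pb : PowerBasis E L := (IntermediateField.adjoin.powerBasis hyE).map
    ((IntermediateField.equivOfEq hyt).trans IntermediateField.topEquiv)
  have hpb : pb.gen = y := by
    simp [pb]
  let j : L →ₐ[E] K₀ := pb.lift y' (by rw [hpb]; exact hroot)
  have hjy : j y = y' := by
    rw [← hpb]
    exact pb.lift_gen _ _
  refine ⟨K₀, inferInstance, inferInstance, inferInstance, inferInstance, inferInstance,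
    inferInstance, K₁.toIntermediateField fun a => (hE a).1,
    K₂.toIntermediateField fun a => (hE a).2, j, ζ, ?_, hP, halg, hF2, ?_, hζ⟩
  · rw [eq_bot_iff]
    intro z hz
    have hz' : z ∈ K₁ ⊓ K₂ := hz
    rw [hinf] at hz'
    have hz'' : z ∈ IntermediateField.adjoin F {x'} := hz'
    have hle : IntermediateField.adjoin F {x'} ≤ φ.fieldRange :=
      IntermediateField.adjoin_simple_le_iff.2 ⟨x, hφx⟩
    obtain ⟨a, rfl⟩ := hle hz''
    exact IntermediateField.mem_bot.2 ⟨a, rfl⟩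
  · have h : (⊤ : IntermediateField E L).map j ≤ K₂.toIntermediateField fun a => (hE a).2 := by
      rw [← hyt, IntermediateField.adjoin_map, Set.image_singleton, hjy,
        IntermediateField.adjoin_simple_le_iff]
      exact hy2
    rwa [← AlgHom.fieldRange_eq_map] at h

end Chart

/-- A finite group with a homomorphism to a commutative group of exponent exactly `ℓ ^ (m + 1)`
maps onto every cyclic group of order `ℓ ^ (m + 1)`. -/
theorem exists_hom_range_eq_zpowers {G C Γ : Type*} [Group G] [Finite G] [CommGroup C] [Group Γ]
    (c : G →* C) {ℓ m : ℕ} (hℓ : ℓ.Prime) (hc : ∀ g, c g ^ ℓ ^ (m + 1) = 1)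
    (hg : ∃ g, c g ^ ℓ ^ m ≠ 1) {h : Γ} (hh : orderOf h = ℓ ^ (m + 1)) :
    ∃ χ : G →* Γ, χ.range = Subgroup.zpowers h := by
  classical
  obtain ⟨g, hg⟩ := hg
  have : Finite c.range := Finite.of_surjective _ c.rangeRestrict_surjective
  have hg' : c.rangeRestrict g ^ ℓ ^ m ≠ 1 := by
    intro e
    exact hg (by simpa using congrArg Subtype.val e)
  obtain ⟨φ, hφ⟩ := CommGroup.exists_apply_ne_one_of_hasEnoughRootsOfUnity c.range ℂ hg'
  set ψ : G →* ℂˣ := φ.comp c.rangeRestrict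
  have : Finite ψ.range := Finite.of_surjective _ ψ.rangeRestrict_surjective
  have : IsCyclic ψ.range := inferInstance
  have h1 : Nat.card ψ.range ∣ ℓ ^ (m + 1) := by
    rw [← IsCyclic.exponent_eq_card, Monoid.exponent_dvd_iff_forall_pow_eq_one]
    rintro ⟨_, x, rfl⟩
    apply Subtype.ext
    have : c.rangeRestrict x ^ ℓ ^ (m + 1) = 1 := Subtype.ext (by simpa using hc x)
    simp only [ψ, MonoidHom.comp_apply, SubmonoidClass.mk_pow, OneMemClass.coe_one]
    rw [← map_pow, this, map_one]
  have h2 : ¬ Nat.card ψ.range ∣ ℓ ^ m := by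
    rw [← IsCyclic.exponent_eq_card, Monoid.exponent_dvd_iff_forall_pow_eq_one]
    intro hx
    apply hφ
    have := congrArg Subtype.val (hx ⟨ψ g, g, rfl⟩)
    simpa [ψ] using this
  have h3 : Nat.card ψ.range = Nat.card (Subgroup.zpowers h) := by
    rw [Nat.card_zpowers, hh]
    obtain ⟨i, hi, e⟩ := (Nat.dvd_prime_pow hℓ).1 h1
    rw [e] at h2 ⊢
    rcases Nat.lt_or_ge i (m + 1) with hlt | hge
    · exact absurd (pow_dvd_pow ℓ (Nat.lt_succ_iff.1 hlt)) h2
    · rw [le_antisymm hi hge]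
  let e : ψ.range ≃* Subgroup.zpowers h := mulEquivOfCyclicCardEq h3
  refine ⟨(Subgroup.zpowers h).subtype.comp (e.toMonoidHom.comp ψ.rangeRestrict), ?_⟩
  rw [MonoidHom.range_comp, MonoidHom.range_eq_top.2
    (e.surjective.comp ψ.rangeRestrict_surjective : Function.Surjective
      (e.toMonoidHom.comp ψ.rangeRestrict)), ← MonoidHom.range_eq_map, Subgroup.range_subtype]

section Descent

open PowerSeries

variable {k : Type} [Field k]

theorem PowerSeries.exists_eq_C_X_mul_of_map_eq_zero {a : PowerSeries (PowerSeries k)}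
    (h : PowerSeries.map (PowerSeries.constantCoeff (R := k)) a = 0) : ∃ a', a = C X * a' := by
  have h1 : ∀ n, ∃ c, coeff n a = X * c := fun n => by
    have := congrArg (coeff n) h
    rw [coeff_map, map_zero] at this
    exact PowerSeries.X_dvd_iff.2 this
  choose c hc using h1
  refine ⟨PowerSeries.mk c, ?_⟩
  ext1 n
  rw [coeff_C_mul, coeff_mk, hc]

theorem PowerSeries.map_constantCoeff_C_X :
    PowerSeries.map (PowerSeries.constantCoeff (R := k)) (C X) = 0 := by
  rw [map_C, constantCoeff_X, map_zero]

theorem PowerSeries.C_X_ne_zero : (C X : PowerSeries (PowerSeries k)) ≠ 0 := by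
  intro h
  have := congrArg (coeff 0) h
  simp [PowerSeries.X_ne_zero] at this

theorem PowerSeries.eq_zero_of_descent
    {P : PowerSeries (PowerSeries k) → PowerSeries (PowerSeries k) → Prop}
    (hP : ∀ a b, P a b → ∃ a' b', a = C X * a' ∧ b = C X * b' ∧ P a' b')
    {a b : PowerSeries (PowerSeries k)} (h : P a b) : b = 0 := by
  have key : ∀ n : ℕ, ∀ a b, P a b → ∃ c, b = C X ^ n * c := by
    intro n
    induction n with
    | zero => exact fun a b _ => ⟨b, by simp⟩
    | succ n ih =>
      intro a b h
      obtain ⟨a', b', -, hb, h'⟩ := hP a b h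
      obtain ⟨c, hc⟩ := ih a' b' h'
      exact ⟨c, by rw [hb, hc, pow_succ']; ring⟩
  ext i j
  obtain ⟨c, hc⟩ := key (j + 1) a b h
  rw [hc, ← map_pow, coeff_C_mul, coeff_X_pow_mul', if_neg (by omega)]
  simp

variable {F₀ : Type*} [Field F₀] [Algebra (PowerSeries (LaurentSeries k)) F₀]

theorem PowerSeries.exists_toFraction_of_mem {z : F₀}
    (hz : z ∈ PowerSeries.coeffSubfield (LaurentSeries.nonnegPart k) F₀) :
    ∃ a b : PowerSeries (PowerSeries k), toFraction k F₀ a / toFraction k F₀ b = z := by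
  have key : ∀ f ∈ PowerSeries.coeffSubring (LaurentSeries.nonnegPart k),
      ∃ a : PowerSeries (PowerSeries k),
        PowerSeries.map (HahnSeries.ofPowerSeries ℤ k) a = f := by
    intro f hf
    rw [PowerSeries.mem_coeffSubring] at hf
    have h1 : ∀ n, ∃ c : PowerSeries k, HahnSeries.ofPowerSeries ℤ k c = coeff n f := by
      intro n
      refine ⟨PowerSeries.mk fun i => (coeff n f).coeff (i : ℤ), ?_⟩
      ext i
      rcases lt_or_ge i 0 with hi | hi
      · rw [hf n i hi]
        exact (PowerSeries.coeff_coe _ _).trans (if_pos hi)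
      · refine (PowerSeries.coeff_coe _ _).trans ?_
        rw [if_neg (not_lt.2 hi), coeff_mk, Int.natAbs_of_nonneg hi]
    choose c hc using h1
    exact ⟨PowerSeries.mk c, by ext1 n; rw [coeff_map, coeff_mk, hc]⟩
  obtain ⟨f, hf, g, hg, rfl⟩ := PowerSeries.mem_coeffSubfield_iff.1 hz
  obtain ⟨a, rfl⟩ := key f hf
  obtain ⟨b, rfl⟩ := key g hg
  exact ⟨a, b, rfl⟩

variable [IsFractionRing (PowerSeries (LaurentSeries k)) F₀]

theorem PowerSeries.pow_ne_one_add_of_mem {z : F₀}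
    (hz : z ∈ PowerSeries.coeffSubfield (LaurentSeries.nonnegPart k) F₀) {l : ℕ} (hl : 2 ≤ l) :
    z ^ l ≠ 1 + toFraction k F₀ X / toFraction k F₀ (C X) := by
  intro hzl
  obtain ⟨a, b, rfl⟩ := PowerSeries.exists_toFraction_of_mem hz
  have hinj := PowerSeries.toFraction_injective k F₀
  have hs : toFraction k F₀ (C X) ≠ 0 := by
    rw [Ne, map_eq_zero_iff _ hinj]
    exact PowerSeries.C_X_ne_zero
  have ht : toFraction k F₀ (C X + X) ≠ 0 := by
    rw [Ne, map_eq_zero_iff _ hinj]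
    intro h
    have := congrArg (PowerSeries.map (PowerSeries.constantCoeff (R := k))) h
    rw [map_add, map_constantCoeff_C_X, map_X, zero_add, map_zero] at this
    exact PowerSeries.X_ne_zero this
  have hz0 : toFraction k F₀ a / toFraction k F₀ b ≠ 0 := by
    intro h0
    rw [h0, zero_pow (by omega)] at hzl
    apply ht
    rw [map_add]
    field_simp at hzl
    simpa using hzl.symm
  have hb : toFraction k F₀ b ≠ 0 := fun h => hz0 (by rw [h, div_zero])
  have hrel : a ^ l * C X = (C X + X) * b ^ l := by
    apply hinj
    rw [map_mul, map_mul, map_pow, map_pow, map_add]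
    rw [div_pow] at hzl
    field_simp at hzl
    rw [hzl]
    ring
  refine hb ?_
  rw [map_eq_zero_iff _ hinj]
  refine PowerSeries.eq_zero_of_descent (P := fun a b => a ^ l * C X = (C X + X) * b ^ l) ?_ hrel
  intro a b h
  obtain ⟨l, rfl⟩ := Nat.exists_eq_add_of_le hl
  have h1 := congrArg (PowerSeries.map (PowerSeries.constantCoeff (R := k))) h
  rw [map_mul, map_mul, map_add, map_constantCoeff_C_X, map_X, zero_add, mul_zero, eq_comm,
    mul_eq_zero, map_pow] at h1
  obtain ⟨b', rfl⟩ := exists_eq_C_X_mul_of_map_eq_zero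
    (eq_zero_of_pow_eq_zero (h1.resolve_left PowerSeries.X_ne_zero))
  have h2 : a ^ (2 + l) = (C X + X) * C X ^ (l + 1) * b' ^ (2 + l) := by
    apply mul_right_cancel₀ (PowerSeries.C_X_ne_zero (k := k))
    rw [h]
    ring
  have h3 := congrArg (PowerSeries.map (PowerSeries.constantCoeff (R := k))) h2
  rw [map_mul, map_mul, map_pow, map_pow, map_constantCoeff_C_X, zero_pow (by omega), mul_zero,
    zero_mul] at h3
  obtain ⟨a', rfl⟩ := exists_eq_C_X_mul_of_map_eq_zero (eq_zero_of_pow_eq_zero h3)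
  refine ⟨a', b', rfl, rfl, ?_⟩
  apply mul_left_cancel₀ (pow_ne_zero (2 + l) (PowerSeries.C_X_ne_zero (k := k)))
  linear_combination h

theorem PowerSeries.pow_sub_self_ne_of_mem {z : F₀}
    (hz : z ∈ PowerSeries.coeffSubfield (LaurentSeries.nonnegPart k) F₀) {l : ℕ} (hl : 2 ≤ l) :
    z ^ l - z ≠ toFraction k F₀ X / toFraction k F₀ (C X) := by
  intro hzl
  obtain ⟨a, b, rfl⟩ := PowerSeries.exists_toFraction_of_mem hz
  have hinj := PowerSeries.toFraction_injective k F₀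
  have hs : toFraction k F₀ (C X) ≠ 0 := by
    rw [Ne, map_eq_zero_iff _ hinj]
    exact PowerSeries.C_X_ne_zero
  have ht : toFraction k F₀ X ≠ 0 := by
    rw [Ne, map_eq_zero_iff _ hinj]
    exact PowerSeries.X_ne_zero
  have hz0 : toFraction k F₀ a / toFraction k F₀ b ≠ 0 := by
    intro h0
    rw [h0, zero_pow (by omega), sub_zero, eq_comm, div_eq_zero_iff] at hzl
    exact hzl.elim ht hs
  obtain ⟨l, rfl⟩ := Nat.exists_eq_add_of_le hl
  have hb : toFraction k F₀ b ≠ 0 := fun h => hz0 (by rw [h, div_zero])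
  have hrel : C X * (a ^ (2 + l) - a * b ^ (l + 1)) = X * b ^ (2 + l) := by
    apply hinj
    simp only [map_mul, map_pow, map_sub]
    rw [div_pow, eq_div_iff hs] at hzl
    have e : toFraction k F₀ b ^ (2 + l) = toFraction k F₀ b * toFraction k F₀ b ^ (l + 1) := by
      ring
    rw [← hzl, e]
    field_simp
  refine hb ?_
  rw [map_eq_zero_iff _ hinj]
  refine PowerSeries.eq_zero_of_descent
    (P := fun a b => C X * (a ^ (2 + l) - a * b ^ (l + 1)) = X * b ^ (2 + l)) ?_ hrel
  intro a b h
  have h1 := congrArg (PowerSeries.map (PowerSeries.constantCoeff (R := k))) h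
  rw [map_mul, map_mul, map_constantCoeff_C_X, map_X, zero_mul, eq_comm,
    mul_eq_zero, map_pow] at h1
  obtain ⟨b', rfl⟩ := exists_eq_C_X_mul_of_map_eq_zero
    (eq_zero_of_pow_eq_zero (h1.resolve_left PowerSeries.X_ne_zero))
  have h2 : a ^ (2 + l) - a * (C X * b') ^ (l + 1) = X * C X ^ (l + 1) * b' ^ (2 + l) := by
    apply mul_left_cancel₀ (PowerSeries.C_X_ne_zero (k := k))
    rw [h]
    ring
  have h3 := congrArg (PowerSeries.map (PowerSeries.constantCoeff (R := k))) h2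
  simp only [map_mul, map_sub, map_pow, map_constantCoeff_C_X] at h3
  rw [zero_mul, zero_pow (by omega), mul_zero, mul_zero, zero_mul, sub_zero, ← map_pow,
    map_pow] at h3
  obtain ⟨a', rfl⟩ := exists_eq_C_X_mul_of_map_eq_zero (eq_zero_of_pow_eq_zero h3)
  refine ⟨a', b', rfl, rfl, ?_⟩
  apply mul_left_cancel₀ (pow_ne_zero (2 + l) (PowerSeries.C_X_ne_zero (k := k)))
  linear_combination h

end Descent

/-- A Kummer extension generated by an element no smaller power of which is in the base field
has a cyclic quotient of full order. -/
theorem exists_kummer_extension {K₂ K₀ Γ : Type*} [Field K₂] [Field K₀] [Algebra K₂ K₀] [Group Γ]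
    {l m : ℕ} (hl : l.Prime) (hl0 : (l : K₂) ≠ 0) {ζ : K₂}
    (hζ : IsPrimitiveRoot ζ (l ^ (m + 1))) {y : K₀} {u : K₂}
    (hy : y ^ l ^ (m + 1) = algebraMap K₂ K₀ u) (hy' : y ^ l ^ m ∉ (algebraMap K₂ K₀).range)
    {h : Γ} (hh : orderOf h = l ^ (m + 1)) :
    ∃ M₂ : IntermediateField K₂ K₀, FiniteDimensional K₂ M₂ ∧ IsGalois K₂ M₂ ∧
      ∃ χ : Gal(M₂/K₂) →* Γ, χ.range = Subgroup.zpowers h := by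
  classical
  set n := l ^ (m + 1) with hn
  have hn0 : n ≠ 0 := pow_ne_zero _ hl.ne_zero
  have hy0 : y ≠ 0 := by
    rintro rfl
    exact hy' (by rw [zero_pow (pow_ne_zero _ hl.ne_zero)]; exact zero_mem _)
  have hu0 : u ≠ 0 := by
    rintro rfl
    rw [map_zero] at hy
    exact hy0 (eq_zero_of_pow_eq_zero hy)
  let p : Polynomial K₂ := Polynomial.X ^ n - Polynomial.C u
  have hpm : ∀ (L : Type _) [Field L] [Algebra K₂ L], p.map (algebraMap K₂ L) =
      Polynomial.X ^ n - Polynomial.C (algebraMap K₂ L u) := by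
    intro L _ _
    simp [p]
  have hsplit : (p.map (algebraMap K₂ K₀)).Splits := by
    rw [hpm]
    exact X_pow_sub_C_splits_of_isPrimitiveRoot (hζ.map_of_injective (algebraMap K₂ K₀).injective)
      hy
  have hsep : p.Separable := Polynomial.separable_X_pow_sub_C u
    (by rw [hn, Nat.cast_pow]; exact pow_ne_zero _ hl0) hu0
  let M₂ := IntermediateField.adjoin K₂ (p.rootSet K₀)
  have hsf : p.IsSplittingField K₂ M₂ := IntermediateField.adjoin_rootSet_isSplittingField hsplit
  have hfin : FiniteDimensional K₂ M₂ := Polynomial.IsSplittingField.finiteDimensional M₂ p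
  have hgal : IsGalois K₂ M₂ := IsGalois.of_separable_splitting_field (p := p) hsep
  refine ⟨M₂, hfin, hgal, ?_⟩
  have hyM : y ∈ M₂ := by
    refine IntermediateField.subset_adjoin _ _ ?_
    rw [Polynomial.mem_rootSet']
    refine ⟨?_, ?_⟩
    · rw [hpm]
      exact Polynomial.X_pow_sub_C_ne_zero (Nat.pos_of_ne_zero hn0) _
    · simp [p, hy]
  let Y : M₂ := ⟨y, hyM⟩
  have hY0 : Y ≠ 0 := fun e => hy0 (congrArg Subtype.val e)
  have hYn : Y ^ n = algebraMap K₂ M₂ u := Subtype.ext hy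
  have hfix : ∀ w : M₂, w ^ n = 1 → ∀ σ : Gal(M₂/K₂), σ w = w := by
    intro w hw σ
    have hζ' := hζ.map_of_injective (algebraMap K₂ M₂).injective
    have : NeZero n := ⟨hn0⟩
    obtain ⟨i, -, rfl⟩ := hζ'.eq_pow_of_pow_eq_one hw
    rw [map_pow, AlgEquiv.commutes]
  have hc : ∀ σ : Gal(M₂/K₂), (σ Y / Y) ^ n = 1 := by
    intro σ
    rw [div_pow, ← map_pow, hYn, AlgEquiv.commutes, ← hYn, div_self (pow_ne_zero _ hY0)]
  have hσY : ∀ σ : Gal(M₂/K₂), σ Y ≠ 0 := fun σ => (map_ne_zero σ).2 hY0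
  let c : Gal(M₂/K₂) →* M₂ˣ := MonoidHom.toHomUnits
    { toFun := fun σ => σ Y / Y
      map_one' := by simp [hY0]
      map_mul' := by
        intro σ τ
        have h1 := hfix _ (hc τ) σ
        rw [map_div₀, div_eq_div_iff (hσY σ) hY0] at h1
        rw [AlgEquiv.mul_apply]
        field_simp
        linear_combination h1 }
  refine exists_hom_range_eq_zpowers c hl (m := m) (fun σ => Units.ext ?_) ?_ hh
  · simpa [c] using hc σ
  · by_contra! hcon
    apply hy'
    have : Y ^ l ^ m ∈ Set.range (algebraMap K₂ M₂) := by
      rw [IsGalois.mem_range_algebraMap_iff_fixed]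
      intro σ
      have h1 : (σ Y / Y) ^ l ^ m = 1 := by simpa [c] using congrArg Units.val (hcon σ)
      rw [div_pow, div_eq_one_iff_eq (pow_ne_zero _ hY0)] at h1
      rw [map_pow, h1]
    obtain ⟨v, hv⟩ := this
    exact ⟨v, congrArg Subtype.val hv⟩

section

variable {k : Type} [Field k]

theorem PowerSeries.exists_pow_eq_one_add {A : Type*} [CommRing A] {n : ℕ} (hn : IsUnit (n : A))
    (c : PowerSeries A) : ∃ y : PowerSeries A, y ^ n = 1 + PowerSeries.X * c := by
  obtain ⟨v, hv⟩ := hn.exists_left_inv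
  obtain ⟨y, hy, -⟩ := (PowerSeries.isPowComplete_X (A := A)).exists_root
    (Polynomial.X ^ n - Polynomial.C (1 + PowerSeries.X * c)) (a := 1) (v := PowerSeries.C v)
    (c := -c) (m := 0) (by
      have hv' : PowerSeries.C v * (n : PowerSeries A) = 1 := by
        rw [← map_natCast (PowerSeries.C (R := A)), ← map_mul, hv, map_one]
      simp [Polynomial.derivative_X_pow, hv']) (by simp)
  refine ⟨y, ?_⟩
  simpa [sub_eq_zero] using hy

variable {F₀ : Type*} [Field F₀] [Algebra (PowerSeries (LaurentSeries k)) F₀]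
  [IsFractionRing (PowerSeries (LaurentSeries k)) F₀]

theorem PowerSeries.toFraction_X_div_C_X :
    toFraction k F₀ X / toFraction k F₀ (C X) =
      algebraMap (PowerSeries (LaurentSeries k)) F₀ (X * C (HahnSeries.single (-1) 1)) := by
  have h1 : toFraction k F₀ (C X) =
      algebraMap (PowerSeries (LaurentSeries k)) F₀ (C (HahnSeries.single 1 1)) := by
    rw [toFraction, RingHom.comp_apply, map_C]
    congr 2
    exact HahnSeries.ofPowerSeries_X
  have h0 : toFraction k F₀ (C X) ≠ 0 := by
    rw [Ne, map_eq_zero_iff _ (toFraction_injective k F₀)]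
    exact C_X_ne_zero
  rw [div_eq_iff h0, h1, ← map_mul, mul_assoc, ← map_mul, HahnSeries.single_mul_single,
    toFraction, RingHom.comp_apply, map_X]
  simp

theorem exists_tame_cyclic_extension {K₂ K₀ Γ : Type*} [Field K₂] [Field K₀] [Algebra K₂ K₀]
    [Algebra F₀ K₀] [Group Γ]
    (hF₂ : ∀ a : F₀, algebraMap F₀ K₀ a ∈ (algebraMap K₂ K₀).range ↔
      a ∈ PowerSeries.coeffSubfield (LaurentSeries.nonnegPart k) F₀)
    {l m : ℕ} (hl : l.Prime) (hl0 : (l : k) ≠ 0) {ζ : K₂}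
    (hζ : IsPrimitiveRoot ζ (l ^ (m + 1))) {h : Γ} (hh : orderOf h = l ^ (m + 1)) :
    ∃ M₂ : IntermediateField K₂ K₀, FiniteDimensional K₂ M₂ ∧ IsGalois K₂ M₂ ∧
      ∃ χ : Gal(M₂/K₂) →* Γ, χ.range = Subgroup.zpowers h := by
  let φ : k →+* K₀ := (algebraMap F₀ K₀).comp ((algebraMap (PowerSeries (LaurentSeries k)) F₀).comp
    (PowerSeries.C.comp HahnSeries.C))
  have hlu : IsUnit ((l ^ (m + 1) : ℕ) : LaurentSeries k) := by
    rw [← map_natCast (HahnSeries.C : k →+* LaurentSeries k)]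
    refine (IsUnit.mk0 _ ?_).map _
    rw [Nat.cast_pow]
    exact pow_ne_zero _ hl0
  obtain ⟨y, hy⟩ := PowerSeries.exists_pow_eq_one_add hlu (PowerSeries.C (HahnSeries.single (-1) 1))
  have hτ := PowerSeries.toFraction_X_div_C_X (k := k) (F₀ := F₀)
  have hmem : 1 + PowerSeries.toFraction k F₀ PowerSeries.X /
      PowerSeries.toFraction k F₀ (PowerSeries.C PowerSeries.X) ∈
        PowerSeries.coeffSubfield (LaurentSeries.nonnegPart k) F₀ :=
    add_mem (one_mem _) (div_mem (PowerSeries.toFraction_mem _ _ _)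
      (PowerSeries.toFraction_mem _ _ _))
  obtain ⟨u, hu⟩ := (hF₂ _).2 hmem
  have hyn : algebraMap (PowerSeries (LaurentSeries k)) F₀ y ^ l ^ (m + 1) =
      1 + PowerSeries.toFraction k F₀ PowerSeries.X /
        PowerSeries.toFraction k F₀ (PowerSeries.C PowerSeries.X) := by
    rw [hτ, ← map_pow, hy, map_add, map_one]
  refine exists_kummer_extension hl (fun h0 => hl0 ?_) hζ
    (y := algebraMap F₀ K₀ (algebraMap (PowerSeries (LaurentSeries k)) F₀ y)) (u := u) ?_ ?_ hh
  · apply φ.injective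
    rw [map_zero, map_natCast, ← map_natCast (algebraMap K₂ K₀), h0, map_zero]
  · rw [hu, ← map_pow, hyn]
  · rw [← map_pow, hF₂]
    intro hmem
    refine PowerSeries.pow_ne_one_add_of_mem hmem hl.two_le ?_
    rw [← hyn, ← pow_mul, ← pow_succ]

end

section ArtinSchreier

open PowerSeries

variable {p : ℕ}

theorem IsSeparable.of_pow_sub_self {K₂ K₀ : Type*} [Field K₂] [Field K₀] [Algebra K₂ K₀]
    [CharP K₂ p] {w : K₀} (hw : IsSeparable K₂ (w ^ p - w)) : IsSeparable K₂ w := by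
  let S := separableClosure K₂ K₀
  have : CharP S p := charP_of_injective_algebraMap (algebraMap K₂ S).injective p
  let c : S := ⟨w ^ p - w, mem_separableClosure_iff.2 hw⟩
  let P : Polynomial S := Polynomial.X ^ p - Polynomial.X - Polynomial.C c
  have hP : P.Separable := by
    rw [Polynomial.separable_def]
    refine ⟨0, -1, ?_⟩
    simp only [P, Polynomial.derivative_sub, Polynomial.derivative_X_pow, CharP.cast_eq_zero,
      Polynomial.derivative_X, Polynomial.derivative_C, map_zero]
    ring
  have h1 : Polynomial.aeval w P = 0 := by
    simp only [P, map_sub, map_pow, Polynomial.aeval_X, Polynomial.aeval_C]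
    exact sub_self _
  have h2 : IsSeparable S w := hP.of_dvd (minpoly.dvd S w h1)
  exact IsSeparable.of_algebra_isSeparable_of_isSeparable K₂ h2

theorem PowerSeries.exists_pow_sub_self_eq {A : Type*} [CommRing A] (hp : 2 ≤ p)
    (c : PowerSeries A) : ∃ y : PowerSeries A, y ^ p - y = PowerSeries.X * c := by
  obtain ⟨y, hy, -⟩ := (PowerSeries.isPowComplete_X (A := A)).exists_root
    (Polynomial.X ^ p - Polynomial.X - Polynomial.C (PowerSeries.X * c)) (a := 0) (v := -1)
    (c := -c) (m := 0) (by
      simp [Polynomial.derivative_X_pow, zero_pow (show p - 1 ≠ 0 by omega)])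
    (by simp [zero_pow (show p ≠ 0 by omega)])
  refine ⟨y, ?_⟩
  simpa [sub_eq_zero] using hy

variable [Fact p.Prime]

theorem PowerSeries.constantCoeff_map_apply {R S : Type*} [CommRing R] [CommRing S] (f : R →+* S)
    (g : PowerSeries R) : constantCoeff (map f g) = f (constantCoeff g) := by
  rw [← coeff_zero_eq_constantCoeff_apply, coeff_map, coeff_zero_eq_constantCoeff_apply]

theorem PowerSeries.X_pow_dvd_frobenius_sub {Ω : Type*} [Field Ω] [CharP Ω p] {r : ℕ}
    {g g' q d : PowerSeries Ω} (hg : X ^ r ∣ map (frobenius Ω p) g - q * g)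
    (hg' : X ^ r ∣ map (frobenius Ω p) g' - q * g') (h0 : constantCoeff g = 1)
    (hd : d * g = g') : X ^ r ∣ map (frobenius Ω p) d - d := by
  have hu : IsUnit (map (frobenius Ω p) g) := by
    rw [PowerSeries.isUnit_iff_constantCoeff, PowerSeries.constantCoeff_map_apply, h0, map_one]
    exact isUnit_one
  rw [← hu.dvd_mul_right]
  have := hg'.sub (hg.mul_left d)
  rw [← hd, map_mul] at this
  convert this using 1
  ring

theorem PowerSeries.coeff_mem_bot_of_X_pow_dvd {Ω : Type*} [Field Ω] [CharP Ω p] {r : ℕ}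
    {d : PowerSeries Ω} (hd : X ^ r ∣ map (frobenius Ω p) d - d) {i : ℕ} (hi : i < r) :
    coeff i d ∈ (⊥ : Subfield Ω) := by
  rw [Subfield.mem_bot_iff_pow_eq_self Ω p]
  have := PowerSeries.X_pow_dvd_iff.1 hd i hi
  rwa [map_sub, coeff_map, sub_eq_zero, frobenius_def] at this

theorem PowerSeries.X_pow_dvd_frobenius_mk_sub {Ω : Type*} [Field Ω] [CharP Ω p] {r : ℕ}
    {a : ℕ → Ω} {b : Ω} (h0 : a 0 = 1)
    (ha : ∀ j, j + 1 < r → a (j + 1) ^ p - a (j + 1) = b * a j) :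
    X ^ r ∣ map (frobenius Ω p) (PowerSeries.mk a) - (1 + C b * X) * PowerSeries.mk a := by
  rw [PowerSeries.X_pow_dvd_iff]
  intro j hj
  rw [map_sub, coeff_map, add_mul, one_mul, map_add, mul_assoc, coeff_C_mul, coeff_mk, frobenius_def]
  cases j with
  | zero => simp [h0]
  | succ j =>
    rw [coeff_succ_X_mul, coeff_mk]
    linear_combination ha j hj

theorem RingHom.apply_eq_of_mem_bot {Ω : Type*} [Field Ω] (σ : Ω →+* Ω) {x : Ω}
    (hx : x ∈ (⊥ : Subfield Ω)) : σ x = x :=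
  (bot_le : (⊥ : Subfield Ω) ≤ σ.eqLocusField (RingHom.id Ω)) hx

theorem exists_artinSchreier_extension {K₂ K₀ Γ : Type*} [Field K₂] [Field K₀] [Algebra K₂ K₀]
    [CharP K₂ p] [Group Γ] {m : ℕ} {a : ℕ → K₀} {b : K₂} (h0 : a 0 = 1)
    (ha : ∀ j, a (j + 1) ^ p - a (j + 1) = algebraMap K₂ K₀ b * a j)
    (ha1 : a 1 ∉ (algebraMap K₂ K₀).range) {h : Γ} (hh : orderOf h = p ^ (m + 1)) :
    ∃ M₂ : IntermediateField K₂ K₀, FiniteDimensional K₂ M₂ ∧ IsGalois K₂ M₂ ∧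
      ∃ χ : Gal(M₂/K₂) →* Γ, χ.range = Subgroup.zpowers h := by
  classical
  have hp : p.Prime := Fact.out
  let r := p ^ m + 1
  have hr : 1 < r := Nat.succ_lt_succ (pow_pos hp.pos m)
  let M₂ := IntermediateField.adjoin K₂ (a '' Set.Iio r)
  have hsep : ∀ j, IsSeparable K₂ (a j) := by
    intro j
    induction j with
    | zero => rw [h0, ← map_one (algebraMap K₂ K₀)]; exact isSeparable_algebraMap 1
    | succ j ih =>
      refine IsSeparable.of_pow_sub_self (p := p) ?_
      rw [ha]
      exact Field.isSeparable_mul (isSeparable_algebraMap b) ih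
  have hfin : FiniteDimensional K₂ M₂ := by
    have : Finite (a '' Set.Iio r) := ((Set.finite_Iio r).image a).to_subtype
    refine IntermediateField.finiteDimensional_adjoin ?_
    rintro _ ⟨j, -, rfl⟩
    exact (hsep j).isIntegral
  have hsepM : Algebra.IsSeparable K₂ M₂ := by
    rw [IntermediateField.isSeparable_adjoin_iff_isSeparable]
    rintro _ ⟨j, -, rfl⟩
    exact hsep j
  have hcharM : CharP M₂ p := charP_of_injective_algebraMap (algebraMap K₂ M₂).injective p
  have hmem : ∀ j, j < r → a j ∈ M₂ := fun j hj => IntermediateField.subset_adjoin _ _ ⟨j, hj, rfl⟩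
  let A : ℕ → M₂ := fun j => if hj : j < r then ⟨a j, hmem j hj⟩ else 0
  have hAj : ∀ j, j < r → (A j : K₀) = a j := fun j hj => by simp [A, hj]
  have hA0 : A 0 = 1 := Subtype.ext (by rw [hAj 0 (by omega), h0]; rfl)
  have hA : ∀ j, j + 1 < r → A (j + 1) ^ p - A (j + 1) = algebraMap K₂ M₂ b * A j := by
    intro j hj
    apply Subtype.ext
    push_cast
    rw [hAj _ hj, hAj j (by omega), ha]
  have hnormal : Normal K₂ M₂ := by
    let Ω := AlgebraicClosure M₂
    have : CharP Ω p := charP_of_injective_algebraMap (algebraMap M₂ Ω).injective p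
    let ι : M₂ →ₐ[K₂] Ω := IsScalarTower.toAlgHom K₂ M₂ Ω
    have hΩ : IsAlgClosure K₂ Ω := ⟨inferInstance, Algebra.IsAlgebraic.trans K₂ M₂ Ω⟩
    have hΩn : Normal K₂ Ω := IsAlgClosure.normal K₂ Ω
    suffices hN : Normal K₂ ι.fieldRange from
      Normal.of_algEquiv ι.equivFieldRange.symm
    rw [IntermediateField.normal_iff_forall_map_le]
    intro σ
    rintro _ ⟨_, ⟨z, rfl⟩, rfl⟩
    let N : IntermediateField K₂ M₂ := ι.fieldRange.comap (σ.comp ι)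
    have hconj : ∀ j, j < r → A j ∈ N := by
      intro j hj
      change σ (ι (A j)) ∈ ι.fieldRange
      let g : PowerSeries Ω := PowerSeries.mk fun j => ι (A j)
      let g' : PowerSeries Ω := PowerSeries.mk fun j => σ (ι (A j))
      have hg : X ^ r ∣ map (frobenius Ω p) g - (1 + C (algebraMap K₂ Ω b) * X) * g := by
        refine PowerSeries.X_pow_dvd_frobenius_mk_sub (by rw [hA0, map_one]) fun j hj => ?_
        rw [← map_pow, ← map_sub, hA j hj, map_mul, AlgHom.commutes]
      have hg' : X ^ r ∣ map (frobenius Ω p) g' - (1 + C (algebraMap K₂ Ω b) * X) * g' := by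
        refine PowerSeries.X_pow_dvd_frobenius_mk_sub (by rw [hA0, map_one, map_one])
          fun j hj => ?_
        rw [← map_pow, ← map_sub, ← map_pow, ← map_sub, hA j hj, map_mul, AlgHom.commutes,
          map_mul, AlgHom.commutes]
      have hg0 : constantCoeff g = 1 := by
        rw [← coeff_zero_eq_constantCoeff_apply, coeff_mk, hA0, map_one]
      have hd : g' * g⁻¹ * g = g' := by
        rw [mul_assoc, PowerSeries.inv_mul_cancel _ (by rw [hg0]; exact one_ne_zero), mul_one]
      have hdd := PowerSeries.X_pow_dvd_frobenius_sub hg hg' hg0 hd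
      have := congrArg (coeff j) hd
      rw [coeff_mk, PowerSeries.coeff_mul] at this
      rw [← this]
      refine sum_mem fun i hi => ?_
      have hij := Finset.HasAntidiagonal.mem_antidiagonal.1 hi
      refine mul_mem ?_ ?_
      · exact (bot_le : (⊥ : Subfield Ω) ≤ ι.fieldRange.toSubfield)
          (PowerSeries.coeff_mem_bot_of_X_pow_dvd hdd (by omega))
      · rw [coeff_mk]
        exact ⟨_, rfl⟩
    have hle : M₂ ≤ N.map M₂.val := by
      refine IntermediateField.adjoin_le_iff.2 ?_
      rintro _ ⟨j, hj, rfl⟩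
      exact ⟨A j, hconj j hj, hAj j hj⟩
    obtain ⟨z', hz', e⟩ := hle z.2
    rwa [← show z' = z from Subtype.ext e]
  have hgal : IsGalois K₂ M₂ := ⟨⟩
  refine ⟨M₂, hfin, hgal, ?_⟩
  let g : PowerSeries M₂ := PowerSeries.mk A
  let d : Gal(M₂/K₂) → PowerSeries M₂ := fun σ => map (σ : M₂ →+* M₂) g * g⁻¹
  have hg0 : constantCoeff g = 1 := by
    rw [← coeff_zero_eq_constantCoeff_apply, coeff_mk, hA0]
  have hgg : g⁻¹ * g = 1 := PowerSeries.inv_mul_cancel _ (by rw [hg0]; exact one_ne_zero)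
  have hd : ∀ σ, d σ * g = map (σ : M₂ →+* M₂) g := fun σ => by
    simp only [d]
    rw [mul_assoc, hgg, mul_one]
  have hd0 : ∀ σ, constantCoeff (d σ) = 1 := fun σ => by
    have := congrArg constantCoeff (hd σ)
    rw [map_mul, hg0, mul_one, PowerSeries.constantCoeff_map_apply, hg0, map_one] at this
    exact this
  have hdr : ∀ σ, X ^ r ∣ map (frobenius M₂ p) (d σ) - d σ := by
    intro σ
    refine PowerSeries.X_pow_dvd_frobenius_sub (q := 1 + C (algebraMap K₂ M₂ b) * X)
      (PowerSeries.X_pow_dvd_frobenius_mk_sub hA0 hA) ?_ hg0 (hd σ)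
    have e : map (σ : M₂ →+* M₂) g = PowerSeries.mk fun j => σ (A j) := by
      ext1 j
      rw [coeff_map, coeff_mk, coeff_mk]
      rfl
    rw [e]
    refine PowerSeries.X_pow_dvd_frobenius_mk_sub (by rw [hA0, map_one]) fun j hj => ?_
    rw [← map_pow, ← map_sub, hA j hj, map_mul, AlgEquiv.commutes]
  have hfix : ∀ σ τ : Gal(M₂/K₂), X ^ r ∣ map (σ : M₂ →+* M₂) (d τ) - d τ := by
    intro σ τ
    rw [PowerSeries.X_pow_dvd_iff]
    intro j hj
    rw [map_sub, coeff_map, sub_eq_zero]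
    exact RingHom.apply_eq_of_mem_bot _ (PowerSeries.coeff_mem_bot_of_X_pow_dvd (hdr τ) hj)
  let I : Ideal (PowerSeries M₂) := Ideal.span {X ^ r}
  let c : Gal(M₂/K₂) →* (PowerSeries M₂ ⧸ I)ˣ := MonoidHom.toHomUnits
    { toFun := fun σ => Ideal.Quotient.mk I (d σ)
      map_one' := by
        rw [← map_one (Ideal.Quotient.mk I)]
        congr 1
        have e : map ((1 : Gal(M₂/K₂)) : M₂ →+* M₂) g = g := by
          ext1 j
          rw [coeff_map]
          rfl
        simp only [d]
        rw [e, mul_comm, hgg]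
      map_mul' := by
        intro σ τ
        rw [← map_mul, Ideal.Quotient.mk_eq_mk_iff_sub_mem, Ideal.mem_span_singleton]
        have e1 : d (σ * τ) = map (σ : M₂ →+* M₂) (d τ) * d σ := by
          have h1 : d (σ * τ) * g = map (σ : M₂ →+* M₂) (d τ) * d σ * g := by
            rw [hd (σ * τ), mul_assoc, hd σ, ← map_mul, hd τ]
            ext1 j
            rw [coeff_map, coeff_map, coeff_map]
            rfl
          calc d (σ * τ) = d (σ * τ) * g * g⁻¹ := by rw [mul_assoc, mul_comm g, hgg, mul_one]
            _ = _ := by rw [h1, mul_assoc, mul_comm g, hgg, mul_one]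
        rw [e1]
        have := (hfix σ τ).mul_right (d σ)
        convert this using 1
        ring }
  have hcharP : CharP (PowerSeries M₂) p :=
    charP_of_injective_ringHom (PowerSeries.C_injective (R := M₂)) p
  have he : ∀ σ, ∃ e, d σ = 1 + X * e := by
    intro σ
    have : X ∣ d σ - 1 := by rw [PowerSeries.X_dvd_iff, map_sub, hd0, map_one, sub_self]
    obtain ⟨e, h⟩ := this
    exact ⟨e, by rw [← h]; ring⟩
  have hpow : ∀ σ e i, d σ = 1 + X * e → d σ ^ p ^ i - 1 = X ^ p ^ i * e ^ p ^ i := by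
    intro σ e i h
    rw [h, add_pow_char_pow, one_pow, mul_pow]
    ring
  have hc : ∀ σ i, c σ ^ p ^ i = 1 ↔ X ^ r ∣ d σ ^ p ^ i - 1 := by
    intro σ i
    rw [← Ideal.mem_span_singleton, ← Ideal.Quotient.mk_eq_mk_iff_sub_mem, Units.ext_iff,
      map_pow, map_one]
    rfl
  refine exists_hom_range_eq_zpowers (C := (PowerSeries M₂ ⧸ I)ˣ) c hp (m := m) (fun σ => ?_) ?_ hh
  · obtain ⟨e, h⟩ := he σ
    rw [hc, hpow σ e _ h]
    exact Dvd.dvd.mul_right (pow_dvd_pow _ (Nat.pow_lt_pow_right hp.one_lt (Nat.lt_succ_self m))) _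
  · by_contra! hcon
    apply ha1
    have : A 1 ∈ Set.range (algebraMap K₂ M₂) := by
      rw [IsGalois.mem_range_algebraMap_iff_fixed]
      intro σ
      obtain ⟨e, h⟩ := he σ
      have h1 := (hc σ m).1 (hcon σ)
      rw [hpow σ e _ h, show r = p ^ m + 1 from rfl, pow_succ] at h1
      have h2 := (mul_dvd_mul_iff_left (pow_ne_zero _ PowerSeries.X_ne_zero)).1 h1
      rw [PowerSeries.X_dvd_iff, map_pow] at h2
      have h3 := eq_zero_of_pow_eq_zero h2
      have h4 := congrArg (coeff 1) (hd σ)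
      rw [coeff_map, coeff_mk, h, add_mul, one_mul, map_add, coeff_mk, mul_assoc,
        show (1 : ℕ) = 0 + 1 from rfl, coeff_succ_X_mul, coeff_zero_eq_constantCoeff_apply,
        map_mul, h3, zero_mul, add_zero] at h4
      exact h4.symm
    obtain ⟨v, hv⟩ := this
    refine ⟨v, ?_⟩
    rw [← hAj 1 hr, ← hv]
    rfl

variable {k : Type} [Field k]

variable {F₀ : Type*} [Field F₀] [Algebra (PowerSeries (LaurentSeries k)) F₀]
  [IsFractionRing (PowerSeries (LaurentSeries k)) F₀]

theorem exists_wild_cyclic_extension {K₂ K₀ Γ : Type*} [Field K₂] [Field K₀] [Algebra K₂ K₀]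
    [Algebra F₀ K₀] [Group Γ] [CharP k p]
    (hF₂ : ∀ a : F₀, algebraMap F₀ K₀ a ∈ (algebraMap K₂ K₀).range ↔
      a ∈ PowerSeries.coeffSubfield (LaurentSeries.nonnegPart k) F₀)
    {m : ℕ} {h : Γ} (hh : orderOf h = p ^ (m + 1)) :
    ∃ M₂ : IntermediateField K₂ K₀, FiniteDimensional K₂ M₂ ∧ IsGalois K₂ M₂ ∧
      ∃ χ : Gal(M₂/K₂) →* Γ, χ.range = Subgroup.zpowers h := by
  have hp : p.Prime := Fact.out
  let φ : k →+* K₀ := (algebraMap F₀ K₀).comp ((algebraMap (PowerSeries (LaurentSeries k)) F₀).comp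
    (PowerSeries.C.comp HahnSeries.C))
  have : CharP K₀ p := charP_of_injective_ringHom φ.injective p
  have : CharP K₂ p := (RingHom.charP_iff _ (algebraMap K₂ K₀).injective p).2 this
  choose w hw using fun a : PowerSeries (LaurentSeries k) =>
    PowerSeries.exists_pow_sub_self_eq hp.two_le (PowerSeries.C (HahnSeries.single (-1) 1) * a)
  let a' : ℕ → PowerSeries (LaurentSeries k) := fun j => Nat.rec 1 (fun _ x => w x) j
  have hmem : PowerSeries.toFraction k F₀ PowerSeries.X /
      PowerSeries.toFraction k F₀ (PowerSeries.C PowerSeries.X) ∈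
        PowerSeries.coeffSubfield (LaurentSeries.nonnegPart k) F₀ :=
    div_mem (PowerSeries.toFraction_mem _ _ _) (PowerSeries.toFraction_mem _ _ _)
  obtain ⟨b, hb⟩ := (hF₂ _).2 hmem
  have ha : ∀ j, algebraMap (PowerSeries (LaurentSeries k)) F₀ (a' (j + 1)) ^ p -
      algebraMap (PowerSeries (LaurentSeries k)) F₀ (a' (j + 1)) =
      PowerSeries.toFraction k F₀ PowerSeries.X /
        PowerSeries.toFraction k F₀ (PowerSeries.C PowerSeries.X) *
          algebraMap (PowerSeries (LaurentSeries k)) F₀ (a' j) := by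
    intro j
    rw [PowerSeries.toFraction_X_div_C_X, ← map_pow, ← map_sub, ← map_mul, mul_assoc]
    exact congrArg _ (hw (a' j))
  refine exists_artinSchreier_extension (p := p) (b := b)
    (a := fun j => algebraMap F₀ K₀ (algebraMap (PowerSeries (LaurentSeries k)) F₀ (a' j)))
    ?_ (fun j => ?_) ?_ hh
  · change algebraMap F₀ K₀ (algebraMap (PowerSeries (LaurentSeries k)) F₀ 1) = 1
    rw [map_one, map_one]
  · rw [hb, ← map_pow, ← map_sub, ha, map_mul]
  · rw [hF₂]
    intro hm
    refine PowerSeries.pow_sub_self_ne_of_mem hm hp.two_le ?_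
    have := ha 0
    rwa [show a' 0 = 1 from rfl, map_one, mul_one] at this

end ArtinSchreier

section CyclicExtension

variable {k : Type} [Field k] {F₀ : Type*} [Field F₀] [Algebra (PowerSeries (LaurentSeries k)) F₀]
  [IsFractionRing (PowerSeries (LaurentSeries k)) F₀]

theorem exists_cyclic_extension {K₂ K₀ Γ : Type*} [Field K₂] [Field K₀] [Algebra K₂ K₀]
    [Algebra F₀ K₀] [Group Γ]
    (hF₂ : ∀ a : F₀, algebraMap F₀ K₀ a ∈ (algebraMap K₂ K₀).range ↔
      a ∈ PowerSeries.coeffSubfield (LaurentSeries.nonnegPart k) F₀)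
    {l m : ℕ} (hl : l.Prime) (hζ : (l : k) ≠ 0 → ∃ ζ : K₂, IsPrimitiveRoot ζ (l ^ m))
    {h : Γ} (hh : orderOf h = l ^ m) :
    ∃ M₂ : IntermediateField K₂ K₀, FiniteDimensional K₂ M₂ ∧ IsGalois K₂ M₂ ∧
      ∃ χ : Gal(M₂/K₂) →* Γ, χ.range = Subgroup.zpowers h := by
  cases m with
  | zero =>
    refine ⟨⊥, inferInstance, inferInstance, 1, ?_⟩
    rw [pow_zero, orderOf_eq_one_iff] at hh
    rw [hh, Subgroup.zpowers_one_eq_bot, MonoidHom.range_one]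
  | succ m =>
    by_cases hl0 : (l : k) = 0
    · have : Fact l.Prime := ⟨hl⟩
      have : CharP k l := by
        obtain ⟨q, hq⟩ := CharP.exists k
        rcases (Nat.dvd_prime hl).1 ((CharP.cast_eq_zero_iff k q l).1 hl0) with rfl | rfl
        · exact absurd rfl (CharP.char_ne_one k 1)
        · exact hq
      exact exists_wild_cyclic_extension hF₂ hh
    · obtain ⟨ζ, hζ⟩ := hζ hl0
      exact exists_tame_cyclic_extension hF₂ hl hl0 hζ hh

end CyclicExtension

/-- One step of enlarging the image of a homomorphism from the absolute Galois group of a rational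
function field over `k((t))`, in terms of finite Galois extensions. -/
theorem exists_regular_step {k : Type} [Field k] {F : Type} [Field F] [Algebra (PowerSeries k) F]
    [IsFractionRing (PowerSeries k) F] {E Ω : Type} [Field E] [Field Ω] [Algebra F E]
    [Algebra E Ω] [Algebra F Ω] [IsScalarTower F E Ω] [IsAlgClosed Ω]
    {x : E} (hx : Transcendental F x) (hxt : IntermediateField.adjoin F {x} = ⊤)
    {Γ : Type} [Group Γ] [Finite Γ] (N : IntermediateField E Ω) [FiniteDimensional E N]
    [IsGalois E N] (a : Gal(N/E) →* Γ) {l m : ℕ} (hl : l.Prime) {h : Γ} (hh : orderOf h = l ^ m) :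
    ∃ M : IntermediateField E Ω, FiniteDimensional E M ∧ IsGalois E M ∧
      ∃ b : Gal(M/E) →* Γ, h ∈ b.range ∧
        (∀ ρ : Gal(N/E), ∃ σ : Gal(M/E), b σ = a ρ ∧
          ∀ (x : M) (hx : (x : Ω) ∈ N), (ρ ⟨x, hx⟩ : Ω) = σ x) ∧
        (∀ V : Subgroup Γ, V.Normal → h ∈ V → ∀ σ : Gal(M/E),
          (∀ x : M, (x : Ω) ∈ N → σ x = x) → b σ ∈ V) ∧
        (∀ z ∈ M, IsAlgebraic F z → z ∈ N) := by
  classical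
  let F₀ := FractionRing (PowerSeries (LaurentSeries k))
  let g : PowerSeries k →+* F₀ := (algebraMap (PowerSeries (LaurentSeries k)) F₀).comp
    (PowerSeries.map HahnSeries.C)
  have hg : Function.Injective g := by
    refine (IsFractionRing.injective (PowerSeries (LaurentSeries k)) F₀).comp fun a b hab => ?_
    ext1 n
    have : PowerSeries.coeff n (PowerSeries.map HahnSeries.C a) =
        PowerSeries.coeff n (PowerSeries.map (HahnSeries.C : k →+* LaurentSeries k) b) :=
      congrArg (PowerSeries.coeff n) hab
    rw [PowerSeries.coeff_map, PowerSeries.coeff_map] at this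
    exact HahnSeries.C_injective this
  let _ : Algebra F F₀ := (IsFractionRing.lift hg : F →+* F₀).toAlgebra
  have hF : ∀ a : PowerSeries k, algebraMap F F₀ (algebraMap (PowerSeries k) F a) =
      algebraMap (PowerSeries (LaurentSeries k)) F₀ (PowerSeries.map HahnSeries.C a) :=
    fun a => IsFractionRing.lift_algebraMap hg a
  have hkF : ∀ n : ℕ, (n : k) ≠ 0 → (n : F) ≠ 0 := by
    intro n hn h0
    apply hn
    apply ((algebraMap (PowerSeries k) F).comp (PowerSeries.C (R := k))).injective
    rw [map_natCast, h0, map_zero]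
  obtain ⟨K₀, _, _, _, _, _, _, K₁, K₂, j, ζ, hK, hP, hFK, hF₂, hj, hζ⟩ := exists_chart (k := k) hF
    (L := N) hx hxt (n := if (l : k) = 0 then 1 else l ^ m) (by
      split_ifs with h0
      · simp
      · rw [Nat.cast_pow]
        exact pow_ne_zero _ (hkF l h0))
  obtain ⟨M₂, hM₂f, hM₂g, χ, hχ⟩ := exists_cyclic_extension (k := k) (F₀ := F₀) (K₂ := K₂)
    (K₀ := K₀) (fun a => by
      rw [← hF₂]
      exact ⟨fun ⟨y, hy⟩ => hy ▸ y.2, fun hy => ⟨⟨_, hy⟩, rfl⟩⟩) hl (fun h0 => by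
      rw [if_neg h0] at hζ
      have hζ2 : ζ ∈ K₂ := by
        refine hFK ζ ⟨Polynomial.X ^ l ^ m - 1,
          Polynomial.X_pow_sub_C_ne_zero (pow_pos hl.pos m) 1, ?_⟩
        simp [hζ.pow_eq_one]
      exact ⟨⟨ζ, hζ2⟩, (IsPrimitiveRoot.map_iff_of_injective (f := algebraMap K₂ K₀)
        (algebraMap K₂ K₀).injective).1 hζ⟩) hh
  let eL := j.equivFieldRange
  have : FiniteDimensional E j.fieldRange := eL.toLinearEquiv.finiteDimensional
  have : IsGalois E j.fieldRange := IsGalois.of_algEquiv eL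
  obtain ⟨M, hMf, hMg, b, -, hb1, hb2, hb3, hb4⟩ := exists_patching_step (F := F) K₁ K₂ hK hP hFK
    j.fieldRange hj (a.comp eL.autCongr.symm.toMonoidHom) M₂ χ h hχ
  let T : IntermediateField E K₀ := j.fieldRange ⊔ M
  have hTf : FiniteDimensional E T := IntermediateField.finiteDimensional_sup _ _
  let ιM : M →ₐ[E] T := IntermediateField.inclusion le_sup_right
  let ιN : N →ₐ[E] T := (IntermediateField.inclusion le_sup_left).comp eL.toAlgHom
  have hιN : ∀ y, (ιN y : K₀) = j y := fun _ => rfl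
  let _ : Algebra N T := ιN.toRingHom.toAlgebra
  have : IsScalarTower E N T := IsScalarTower.of_algebraMap_eq fun y => (ιN.commutes y).symm
  have : Algebra.IsAlgebraic N T := Algebra.IsAlgebraic.tower_top (K := E) N
  let ψ₀ : T →ₐ[N] Ω := IsAlgClosed.lift
  let ψ : T →ₐ[E] Ω := ψ₀.restrictScalars E
  have hψN : ∀ y : N, ψ (ιN y) = y := fun y => ψ₀.commutes y
  let ψM : M →ₐ[E] Ω := ψ.comp ιM
  let e : M ≃ₐ[E] ψM.fieldRange := ψM.equivFieldRange
  have he : ∀ y, (e y : Ω) = ψ (ιM y) := fun _ => rfl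
  have hjM : ∀ (y : N) (z : M), (e z : Ω) = y ↔ j y = z := by
    intro y z
    have hψi : Function.Injective ψ := ψ.injective
    rw [he, ← hψN, hψi.eq_iff, Subtype.ext_iff, hιN, eq_comm]
    rfl
  refine ⟨ψM.fieldRange, e.toLinearEquiv.finiteDimensional, IsGalois.of_algEquiv e,
    b.comp e.autCongr.symm.toMonoidHom, ?_, ?_, ?_, ?_⟩
  · obtain ⟨σ, hσ⟩ := hb1
    refine ⟨e.autCongr σ, ?_⟩
    change b (e.autCongr.symm (e.autCongr σ)) = _
    rw [MulEquiv.symm_apply_apply, hσ]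
  · intro ρ
    obtain ⟨σ, hσ, hσ'⟩ := hb2 (eL.autCongr ρ)
    have hσ2 : b (e.autCongr.symm (e.autCongr σ)) = a ρ := by
      rw [MulEquiv.symm_apply_apply, hσ]
      change a (eL.autCongr.symm (eL.autCongr ρ)) = a ρ
      rw [MulEquiv.symm_apply_apply]
    refine ⟨e.autCongr σ, hσ2, fun y hy => ?_⟩
    obtain ⟨z, rfl⟩ := e.surjective y
    have h1 := (hjM ⟨_, hy⟩ z).1 rfl
    have h2 := hσ' z ⟨_, h1⟩
    have h3 : e.autCongr σ (e z) = e (σ z) := by simp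
    rw [h3, eq_comm, hjM, ← h2]
    have h4 : (⟨(z : K₀), ⟨_, h1⟩⟩ : j.fieldRange) = eL ⟨_, hy⟩ := Subtype.ext h1.symm
    rw [h4]
    have h5 : eL.autCongr ρ (eL ⟨_, hy⟩) = eL (ρ ⟨_, hy⟩) := by simp
    rw [h5]
    rfl
  · intro V hV hhV σ hσ
    refine hb3 V hV hhV _ fun y hy => ?_
    obtain ⟨n, hn⟩ := hy
    have h1 : (e y : Ω) = n := (hjM n y).2 hn
    have h2 := hσ (e y) (h1 ▸ n.2)
    apply e.injective
    simpa using h2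
  · rintro _ ⟨y, rfl⟩ hy
    have h1 : IsAlgebraic F (y : K₀) := by
      have h2 : IsAlgebraic F (ιM y) :=
        (isAlgebraic_algHom_iff (ψ.restrictScalars F) ψ.injective).1 hy
      exact (isAlgebraic_algHom_iff (T.val.restrictScalars F) T.val.injective).2 h2
    obtain ⟨n, hn⟩ := hb4 y y.2 h1
    have := (hjM n y).2 hn
    change (e y : Ω) ∈ N
    rw [this]
    exact n.2

/-- A homomorphism on a (possibly infinite) automorphism group which factors through the Galois
group of a finite Galois subextension. -/
def IsFiniteLevel {E Ω Γ : Type*} [Field E] [Field Ω] [Algebra E Ω] [Group Γ]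
    (α : Gal(Ω/E) →* Γ) : Prop :=
  ∃ N : IntermediateField E Ω, FiniteDimensional E N ∧ IsGalois E N ∧
    ∀ σ : Gal(Ω/E), (∀ x ∈ N, σ x = x) → α σ = 1

theorem exists_pow_mem_of_forall_fixed {M Ω : Type*} [Field M] [Field Ω] [Algebra M Ω]
    [IsAlgClosed Ω] [Algebra.IsAlgebraic M Ω] {z : Ω} (hz : ∀ σ : Gal(Ω/M), σ z = z) :
    ∃ n : ℕ, z ^ ringExpChar M ^ n ∈ (algebraMap M Ω).range := by
  classical
  have : IsAlgClosure M Ω := ⟨inferInstance, inferInstance⟩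
  have : Normal M Ω := IsAlgClosure.normal M Ω
  rw [← mem_perfectClosure_iff, mem_perfectClosure_iff_natSepDegree_eq_one,
    Polynomial.natSepDegree_eq_of_isAlgClosed Ω, Finset.card_eq_one]
  have hi : IsIntegral M z := Algebra.IsIntegral.isIntegral z
  refine ⟨z, Finset.ext fun y => ?_⟩
  rw [Multiset.mem_toFinset, Polynomial.mem_aroots, Finset.mem_singleton]
  constructor
  · rintro ⟨-, hy⟩
    have h1 : minpoly M z = minpoly M y :=
      minpoly.eq_of_irreducible_of_monic (minpoly.irreducible hi) hy (minpoly.monic hi)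
    obtain ⟨σ, hσ⟩ := Normal.minpoly_eq_iff_mem_orbit (E := Ω) |>.1 h1.symm
    rw [← hσ]
    exact hz σ
  · rintro rfl
    exact ⟨minpoly.ne_zero hi, minpoly.aeval M y⟩

theorem exists_enlarged_hom {k : Type} [Field k] {F : Type} [Field F] [Algebra (PowerSeries k) F]
    [IsFractionRing (PowerSeries k) F] {E Ω : Type} [Field E] [Field Ω] [Algebra F E]
    [Algebra E Ω] [Algebra F Ω] [IsScalarTower F E Ω] [IsAlgClosed Ω] [Algebra.IsAlgebraic E Ω]
    {x : E} (hx : Transcendental F x) (hxt : IntermediateField.adjoin F {x} = ⊤)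
    {Γ : Type} [Group Γ] [Finite Γ] {α : Gal(Ω/E) →* Γ} (hα : IsFiniteLevel α)
    {l m : ℕ} (hl : l.Prime) {h : Γ} (hh : orderOf h = l ^ m) :
    ∃ β : Gal(Ω/E) →* Γ, IsFiniteLevel β ∧ α.range ≤ β.range ∧ h ∈ β.range ∧
      (∀ V : Subgroup Γ, V.Normal → h ∈ V → ∀ σ, (α σ)⁻¹ * β σ ∈ V) ∧
      ∀ z : Ω, IsAlgebraic F z → (∀ σ ∈ β.ker, σ z = z) → ∀ σ ∈ α.ker, σ z = z := by
  have : IsAlgClosure E Ω := ⟨inferInstance, inferInstance⟩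
  have : Normal E Ω := IsAlgClosure.normal E Ω
  obtain ⟨N, _, _, hN⟩ := hα
  let rN : Gal(Ω/E) →* Gal(N/E) := AlgEquiv.restrictNormalHom N
  have hrN : Function.Surjective rN := AlgEquiv.restrictNormalHom_surjective Ω
  have hrNa : ∀ (σ : Gal(Ω/E)) (y : N), (rN σ y : Ω) = σ y :=
    AlgEquiv.restrictNormalHom_apply N
  let a : Gal(N/E) →* Γ := MonoidHom.liftOfSurjective rN hrN ⟨α, fun σ hσ => hN σ fun y hy => by
    rw [← hrNa σ ⟨y, hy⟩, show rN σ = 1 from hσ]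
    rfl⟩
  have ha : ∀ σ, a (rN σ) = α σ := fun σ =>
    MonoidHom.liftOfRightInverse_comp_apply rN _ (Function.rightInverse_surjInv hrN) _ σ
  obtain ⟨M, _, _, b, hb1, hb2, hb3, hb4⟩ := exists_regular_step (k := k) hx hxt N a hl hh
  let rM : Gal(Ω/E) →* Gal(M/E) := AlgEquiv.restrictNormalHom M
  have hrM : Function.Surjective rM := AlgEquiv.restrictNormalHom_surjective Ω
  have hrMa : ∀ (σ : Gal(Ω/E)) (y : M), (rM σ y : Ω) = σ y :=
    AlgEquiv.restrictNormalHom_apply M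
  refine ⟨b.comp rM, ⟨M, inferInstance, inferInstance, fun σ hσ => ?_⟩, ?_, ?_, ?_, ?_⟩
  · have : rM σ = 1 := AlgEquiv.ext fun y => Subtype.ext ((hrMa σ y).trans (hσ y y.2))
    rw [MonoidHom.comp_apply, this, map_one]
  · rintro _ ⟨σ, rfl⟩
    obtain ⟨τ, hτ, -⟩ := hb2 (rN σ)
    obtain ⟨τ, rfl⟩ := hrM τ
    exact ⟨τ, hτ.trans (ha σ)⟩
  · obtain ⟨τ, hτ⟩ := hb1
    obtain ⟨τ, rfl⟩ := hrM τ
    exact ⟨τ, hτ⟩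
  · intro V hV hhV σ
    obtain ⟨τ, hτ, hτ'⟩ := hb2 (rN σ)
    have h1 := hb3 V hV hhV (τ⁻¹ * rM σ) fun y hy => by
      have h2 : rM σ y = τ y := by
        apply Subtype.ext
        rw [hrMa, ← hτ' y hy, hrNa]
      rw [AlgEquiv.mul_apply, h2, ← AlgEquiv.mul_apply, inv_mul_cancel, AlgEquiv.one_apply]
    rwa [map_mul, map_inv, hτ, ha] at h1
  · intro z hz hzβ σ hσ
    have : Algebra.IsAlgebraic M Ω := Algebra.IsAlgebraic.tower_top (K := E) M
    obtain ⟨n, w, hw⟩ := exists_pow_mem_of_forall_fixed (M := M) (z := z) fun σ =>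
      hzβ (σ.restrictScalars E) (by
        have : rM (σ.restrictScalars E) = 1 :=
          AlgEquiv.ext fun y => Subtype.ext ((hrMa _ y).trans (σ.commutes y))
        rw [MonoidHom.mem_ker, MonoidHom.comp_apply, this, map_one])
    have hwN : (w : Ω) ∈ N := hb4 w w.2 (by
      change IsAlgebraic F (algebraMap M Ω w)
      rw [hw]
      exact hz.pow _)
    obtain ⟨τ, hτ, hτ'⟩ := hb2 (rN σ)
    obtain ⟨τ, rfl⟩ := hrM τ
    have h1 := hzβ τ (by rw [MonoidHom.mem_ker, MonoidHom.comp_apply, hτ, ha]; exact hσ)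
    have h2 : σ w = w := by
      have h3 := hτ' w hwN
      rw [hrNa, hrMa] at h3
      change σ w = _ at h3
      rw [h3]
      change τ (algebraMap M Ω w) = algebraMap M Ω w
      rw [hw, map_pow, h1]
    have hq : ExpChar Ω (ringExpChar M) :=
      expChar_of_injective_algebraMap (algebraMap M Ω).injective _
    apply iterateFrobenius_inj Ω (ringExpChar M) n
    rw [iterateFrobenius_def, iterateFrobenius_def, ← map_pow, ← hw]
    exact h2

theorem Subgroup.le_of_forall_orderOf_eq_prime_pow {Γ : Type*} [Group Γ] [Finite Γ]
    {V R : Subgroup Γ}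
    (h : ∀ g ∈ V, ∀ l m : ℕ, l.Prime → orderOf g = l ^ m → g ∈ R) : V ≤ R := by
  suffices H : ∀ n : ℕ, ∀ g ∈ V, orderOf g = n → g ∈ R from fun g hg => H _ g hg rfl
  intro n
  induction n using Nat.recOnPosPrimePosCoprime with
  | prime_pow p n hp hn => exact fun g hg ho => h g hg p n hp ho
  | zero => exact fun g _ ho => absurd ho (orderOf_pos g).ne'
  | one => exact fun g _ ho => (orderOf_eq_one_iff.1 ho) ▸ R.one_mem
  | coprime a b ha hb hab iha ihb =>
    intro g hg ho
    have h1 : g ^ a ∈ R := ihb _ (V.pow_mem hg a) (by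
      rw [orderOf_pow_of_dvd (by lia) (ho ▸ dvd_mul_right a b), ho,
        Nat.mul_div_cancel_left _ (by lia)])
    have h2 : g ^ b ∈ R := iha _ (V.pow_mem hg b) (by
      rw [orderOf_pow_of_dvd (by lia) (ho ▸ dvd_mul_left b a), ho,
        Nat.mul_div_cancel _ (by lia)])
    have h3 : g = (g ^ a) ^ Nat.gcdA a b * (g ^ b) ^ Nat.gcdB a b := by
      rw [← zpow_natCast, ← zpow_natCast, ← zpow_mul, ← zpow_mul, ← zpow_add,
        ← Nat.gcd_eq_gcd_ab, hab.gcd_eq_one, Nat.cast_one, zpow_one]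
    rw [h3]
    exact R.mul_mem (R.zpow_mem h1 _) (R.zpow_mem h2 _)

/-- Split embedding problems over a rational function field over `k((t))` have proper regular
solutions. -/
theorem exists_regular_solution_of_adjoin_eq_top {k : Type} [Field k] {F : Type} [Field F]
    [Algebra (PowerSeries k) F]
    [IsFractionRing (PowerSeries k) F] {E Ω : Type} [Field E] [Field Ω] [Algebra F E]
    [Algebra E Ω] [Algebra F Ω] [IsScalarTower F E Ω] [IsAlgClosed Ω] [Algebra.IsAlgebraic E Ω]
    {x : E} (hx : Transcendental F x) (hxt : IntermediateField.adjoin F {x} = ⊤)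
    {A Γ : Type} [Group A] [Group Γ] [Finite Γ] {α : Gal(Ω/E) →* A} (hα : IsFiniteLevel α)
    (hαs : Function.Surjective α) {f : Γ →* A} {s : A →* Γ} (hfs : f.comp s = MonoidHom.id A) :
    ∃ β : Gal(Ω/E) →* Γ, IsFiniteLevel β ∧ Function.Surjective β ∧ f.comp β = α ∧
      ∀ z : Ω, IsAlgebraic F z → (∀ σ ∈ β.ker, σ z = z) → ∀ σ ∈ α.ker, σ z = z := by
  classical
  have hfs' : ∀ a, f (s a) = a := fun a => DFunLike.congr_fun hfs a
  suffices H : ∀ S : Finset Γ, (∀ h ∈ S, f h = 1 ∧ ∃ l m : ℕ, l.Prime ∧ orderOf h = l ^ m) →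
      ∃ β : Gal(Ω/E) →* Γ, IsFiniteLevel β ∧ (s.comp α).range ≤ β.range ∧ (∀ h ∈ S, h ∈ β.range) ∧
        f.comp β = α ∧
      ∀ z : Ω, IsAlgebraic F z → (∀ σ ∈ β.ker, σ z = z) → ∀ σ ∈ α.ker, σ z = z by
    cases nonempty_fintype Γ
    obtain ⟨β, h1, h2, h3, h4, h5⟩ := H (Finset.univ.filter fun h =>
      f h = 1 ∧ ∃ l m : ℕ, l.Prime ∧ orderOf h = l ^ m) (by simp)
    refine ⟨β, h1, fun γ => ?_, h4, h5⟩
    have h6 : f.ker ≤ β.range := Subgroup.le_of_forall_orderOf_eq_prime_pow fun g hg l m hl ho =>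
      h3 g (by simpa using ⟨hg, l, hl, m, ho⟩)
    have h7 : γ * (s (f γ))⁻¹ ∈ β.range := h6 (by rw [MonoidHom.mem_ker]; simp [hfs'])
    have h8 : s (f γ) ∈ β.range := by
      obtain ⟨σ, hσ⟩ := hαs (f γ)
      exact h2 ⟨σ, by rw [MonoidHom.comp_apply, hσ]⟩
    simpa using β.range.mul_mem h7 h8
  intro S
  induction S using Finset.induction_on with
  | empty =>
    intro _
    obtain ⟨N, h1, h2, h3⟩ := hα
    refine ⟨s.comp α, ⟨N, h1, h2, fun σ hσ => ?_⟩, le_rfl, by simp, ?_, ?_⟩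
    · rw [MonoidHom.comp_apply, h3 σ hσ, map_one]
    · rw [← MonoidHom.comp_assoc, hfs, MonoidHom.id_comp]
    · intro z _ hz σ hσ
      refine hz σ ?_
      rw [MonoidHom.mem_ker, MonoidHom.comp_apply, show α σ = 1 from hσ, map_one]
  | insert h S hS ih =>
    intro H
    obtain ⟨β, h1, h2, h3, h4, h5⟩ := ih fun g hg => H g (Finset.mem_insert_of_mem hg)
    obtain ⟨hf, l, m, hl, ho⟩ := H h (Finset.mem_insert_self h S)
    obtain ⟨β', g1, g2, g3, g4, g5⟩ := exists_enlarged_hom (k := k) hx hxt h1 hl ho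
    have h6 : ∀ σ, f (β' σ) = α σ := fun σ => by
      have h7 := g4 f.ker inferInstance hf σ
      rw [MonoidHom.mem_ker, map_mul, map_inv, inv_mul_eq_one] at h7
      rw [← h7, ← h4, MonoidHom.comp_apply]
    refine ⟨β', g1, h2.trans g2, fun g hg => ?_, MonoidHom.ext h6, fun z hz hz' => ?_⟩
    · rcases Finset.mem_insert.1 hg with rfl | hg
      · exact g3
      · exact g2 (h3 g hg)
    · exact h5 z hz (g5 z hz hz')

namespace Induced

variable {A C Γ : Type} [Group A] [Group C] [Group Γ] (r : C →* A) (ρ : C →* Γ) (H : Subgroup Γ)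

/-- The group of functions on `A` with values in `H` which are equivariant under `C`, acting
through `r` and through conjugation by `ρ`. -/
def inducedSubgroup : Subgroup (A → Γ) where
  carrier := {φ | (∀ a, φ a ∈ H) ∧ ∀ c a, φ (r c * a) = ρ c * φ a * (ρ c)⁻¹}
  mul_mem' := fun h h' => ⟨fun a => H.mul_mem (h.1 a) (h'.1 a), fun c a => by
    rw [Pi.mul_apply, Pi.mul_apply, h.2, h'.2]; group⟩
  one_mem' := ⟨fun _ => H.one_mem, fun c a => by simp⟩
  inv_mem' := fun h => ⟨fun a => H.inv_mem (h.1 a), fun c a => by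
    rw [Pi.inv_apply, Pi.inv_apply, h.2]; group⟩

/-- Right translation on the induced group. -/
def translate : A →* MulAut (inducedSubgroup r ρ H) where
  toFun a :=
    { toFun := fun φ => ⟨fun x => φ.1 (x * a), fun x => φ.2.1 _, fun c x => by
        beta_reduce; rw [mul_assoc (r c)]; exact φ.2.2 c _⟩
      invFun := fun φ => ⟨fun x => φ.1 (x * a⁻¹), fun x => φ.2.1 _, fun c x => by
        beta_reduce; rw [mul_assoc (r c)]; exact φ.2.2 c _⟩
      left_inv := fun φ => by ext x; simp
      right_inv := fun φ => by ext x; simp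
      map_mul' := fun φ ψ => rfl }
  map_one' := by ext φ x; simp
  map_mul' := fun a b => by ext φ x; simp [mul_assoc]

theorem translate_apply (a : A) (φ : inducedSubgroup r ρ H) (x : A) :
    (translate r ρ H a φ).1 x = φ.1 (x * a) := rfl

instance [Finite A] [Finite Γ] :
    Finite (inducedSubgroup r ρ H ⋊[translate r ρ H] A) :=
  Finite.of_equiv _ SemidirectProduct.equivProd.symm

variable {r ρ H}

/-- The homomorphism to `Γ` obtained by evaluating at `1`. -/
def evalHom (β : C →* inducedSubgroup r ρ H ⋊[translate r ρ H] A)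
    (hβ : ∀ c, (β c).right = r c) : C →* Γ :=
  MonoidHom.mk' (fun c => (β c).left.1 1 * ρ c) fun c d => by
    have h1 : (β (c * d)).left.1 1 = (β c).left.1 1 * (β d).left.1 (r c) := by
      rw [map_mul, SemidirectProduct.mul_left, Subgroup.coe_mul, Pi.mul_apply, translate_apply,
        one_mul, hβ]
    have h2 := (β d).left.2.2 c 1
    rw [mul_one] at h2
    rw [h1, h2, map_mul]
    group

theorem exists_apply_one_eq (hr : ∀ c, r c = 1 → ρ c = 1) (hH : H.Normal) {h : Γ} (hh : h ∈ H) :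
    ∃ φ : inducedSubgroup r ρ H, φ.1 1 = h := by
  classical
  refine ⟨⟨fun a => if ha : ∃ c, r c = a then ρ ha.choose * h * (ρ ha.choose)⁻¹ else 1,
    fun a => ?_, fun c a => ?_⟩, ?_⟩
  · beta_reduce
    split_ifs with ha
    · exact hH.conj_mem h hh _
    · exact H.one_mem
  · beta_reduce
    by_cases ha : ∃ c, r c = a
    · have hca : ∃ d, r d = r c * a := ⟨c * ha.choose, by rw [map_mul, ha.choose_spec]⟩
      rw [dif_pos ha, dif_pos hca]
      have h1 : ρ hca.choose = ρ c * ρ ha.choose := by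
        rw [← map_mul, ← mul_inv_eq_one, ← map_inv, ← map_mul]
        apply hr
        rw [map_mul, map_inv, map_mul, ha.choose_spec, hca.choose_spec, mul_inv_cancel]
      rw [h1]
      group
    · have hca : ¬∃ d, r d = r c * a := fun ⟨d, hd⟩ => ha ⟨c⁻¹ * d, by simp [hd]⟩
      rw [dif_neg ha, dif_neg hca]
      group
  · have h1 : ∃ c, r c = 1 := ⟨1, map_one r⟩
    change dite _ _ _ = _
    rw [dif_pos h1, hr _ h1.choose_spec]
    simp

end Induced

theorem IntermediateField.fg_of_finiteDimensional_self {E Ω : Type*} [Field E] [Field Ω]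
    [Algebra E Ω] (M : IntermediateField E Ω) [FiniteDimensional E M] : M.FG := by
  apply M.fg_of_fg_toSubalgebra
  rw [Subalgebra.fg_iff_finiteType]
  exact (inferInstance : Algebra.FiniteType E M)

/-- A finite subextension of an algebraic closure is fixed by every automorphism fixing a suitable
finite Galois subextension. -/
theorem exists_isGalois_forall_fixed {E Ω : Type*} [Field E] [Field Ω] [Algebra E Ω]
    [IsAlgClosed Ω] [Algebra.IsAlgebraic E Ω] (L : IntermediateField E Ω) [FiniteDimensional E L] :
    ∃ N : IntermediateField E Ω, FiniteDimensional E N ∧ IsGalois E N ∧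
      ∀ d : Gal(Ω/E), (∀ y ∈ N, d y = y) → ∀ y ∈ L, d y = y := by
  have : IsAlgClosure E Ω := ⟨inferInstance, inferInstance⟩
  have : Normal E Ω := IsAlgClosure.normal E Ω
  let N' := IntermediateField.normalClosure E L Ω
  have hN'n : Normal E N' := normalClosure.normal E L Ω
  have hN'f : FiniteDimensional E N' := normalClosure.is_finiteDimensional E L Ω
  let N := N' ⊓ separableClosure E Ω
  have hNN' : N ≤ N' := inf_le_left
  have hf : FiniteDimensional E N := FiniteDimensional.of_injective
    (IntermediateField.inclusion hNN').toLinearMap (IntermediateField.inclusion hNN').injective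
  have hs : Algebra.IsSeparable E N := by
    rw [← le_separableClosure_iff]
    exact inf_le_right
  have hn : Normal E N := by
    rw [IntermediateField.normal_iff_forall_map_le]
    rintro σ _ ⟨y, hy, rfl⟩
    refine ⟨IntermediateField.normal_iff_forall_map_le.1 hN'n σ ⟨y, hy.1, rfl⟩, ?_⟩
    have h1 : IsSeparable E y := hy.2
    have h2 : minpoly E (σ y) = minpoly E y := minpoly.algHom_eq σ σ.injective y
    change (minpoly E (σ y)).Separable
    rw [h2]
    exact h1
  refine ⟨N, hf, ⟨⟩, fun d hd y hy => ?_⟩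
  have hy' : y ∈ N' := IntermediateField.le_normalClosure L hy
  obtain ⟨q, _⟩ := ExpChar.exists E
  have : ExpChar Ω q := expChar_of_injective_algebraMap (algebraMap E Ω).injective q
  have hyi : (minpoly E y) ≠ 0 := minpoly.ne_zero (Algebra.IsIntegral.isIntegral y)
  obtain ⟨n, hn⟩ : ∃ n, y ^ q ^ n ∈ separableClosure E Ω := by
    have := separableClosure.isPurelyInseparable E Ω
    obtain ⟨n, w, hw⟩ := IsPurelyInseparable.pow_mem (separableClosure E Ω) q y
    exact ⟨n, hw ▸ w.2⟩
  apply iterateFrobenius_inj Ω q n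
  rw [iterateFrobenius_def, iterateFrobenius_def, ← map_pow]
  exact hd _ ⟨pow_mem hy' _, hn⟩

/-- Split embedding problems over a finite extension of a rational function field over `k((t))`
have proper regular solutions. -/
theorem exists_regular_solution_of_finiteDimensional {k : Type} [Field k] {F : Type} [Field F]
    [Algebra (PowerSeries k) F] [IsFractionRing (PowerSeries k) F] {E K Ω : Type} [Field E]
    [Field K] [Field Ω] [Algebra F E] [Algebra E Ω] [Algebra F Ω] [IsScalarTower F E Ω]
    [Algebra E K] [Algebra K Ω] [IsScalarTower E K Ω] [FiniteDimensional E K]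
    [IsAlgClosed Ω] [Algebra.IsAlgebraic K Ω]
    {x : E} (hx : Transcendental F x) (hxt : IntermediateField.adjoin F {x} = ⊤)
    {G Γ : Type} [Group G] [Group Γ] [Finite Γ] {α : Gal(Ω/K) →* G}
    (L : IntermediateField K Ω) [FiniteDimensional K L]
    (hL : ∀ τ : Gal(Ω/K), (∀ y ∈ L, τ y = y) → α τ = 1)
    (hα : Function.Surjective α) {f : Γ →* G} {s : G →* Γ} (hfs : f.comp s = MonoidHom.id G) :
    ∃ β : Gal(Ω/K) →* Γ, (∃ M : IntermediateField K Ω, FiniteDimensional K M ∧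
        ∀ τ : Gal(Ω/K), (∀ y ∈ M, τ y = y) → β τ = 1) ∧
      Function.Surjective β ∧ f.comp β = α ∧
      ∀ z : Ω, IsAlgebraic F z → (∀ σ ∈ β.ker, σ z = z) → ∀ σ ∈ α.ker, σ z = z := by
  have hfs' : ∀ a, f (s a) = a := fun a => DFunLike.congr_fun hfs a
  have : Algebra.IsAlgebraic E Ω := Algebra.IsAlgebraic.trans E K Ω
  have : IsAlgClosure E Ω := ⟨inferInstance, inferInstance⟩
  have : Normal E Ω := IsAlgClosure.normal E Ω
  have : FiniteDimensional E L := FiniteDimensional.trans E K L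
  have : FiniteDimensional E (L.restrictScalars E) := this
  obtain ⟨N, _, _, hN⟩ := exists_isGalois_forall_fixed (L.restrictScalars E)
  let res : Gal(Ω/K) →* Gal(Ω/E) := AlgEquiv.restrictScalarsHom E
  have hres : ∀ (c : Gal(Ω/K)) (y : Ω), res c y = c y := fun _ _ => rfl
  have hresi : Function.Injective res := AlgEquiv.restrictScalarsHom_injective E
  let rN : Gal(Ω/E) →* Gal(N/E) := AlgEquiv.restrictNormalHom N
  have hrN : Function.Surjective rN := AlgEquiv.restrictNormalHom_surjective Ω
  have hrNa : ∀ (σ : Gal(Ω/E)) (y : N), (rN σ y : Ω) = σ y :=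
    AlgEquiv.restrictNormalHom_apply N
  have hker : ∀ d, rN d = 1 → ∃ c, res c = d ∧ α c = 1 := fun d hd => by
    have h1 : ∀ y ∈ L, d y = y := hN d fun y hy => by
      rw [← hrNa d ⟨y, hy⟩, hd]
      rfl
    refine ⟨{ d with commutes' := fun y => h1 _ (L.algebraMap_mem y) }, ?_, hL _ h1⟩
    ext y
    rfl
  have hrange : ∀ d c, rN d = rN (res c) → ∃ c', res c' = d ∧ α c' = α c := fun d c hd => by
    obtain ⟨c', h1, h2⟩ := hker (d * (res c)⁻¹) (by rw [map_mul, map_inv, hd, mul_inv_cancel])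
    exact ⟨c' * c, by rw [map_mul, h1, inv_mul_cancel_right], by rw [map_mul, h2, one_mul]⟩
  let r : Gal(Ω/K) →* Gal(N/E) := rN.comp res
  let ρ : Gal(Ω/K) →* Γ := s.comp α
  have hr : ∀ c, r c = 1 → ρ c = 1 := fun c hc => by
    obtain ⟨c', h1, h2⟩ := hker (res c) hc
    rw [hresi h1] at h2
    change s (α c) = 1
    rw [h2, map_one]
  have : Finite Gal(N/E) := inferInstance
  obtain ⟨β, ⟨M, _, _, hM⟩, hβs, hβr, hβ⟩ := exists_regular_solution_of_adjoin_eq_top (k := k)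
    (F := F) (E := E) (Ω := Ω) hx hxt (α := rN) ⟨N, inferInstance, inferInstance, fun σ hσ =>
      AlgEquiv.ext fun y => Subtype.ext ((hrNa σ y).trans (hσ y y.2))⟩ hrN
    (f := SemidirectProduct.rightHom (φ := Induced.translate r ρ f.ker))
    (s := SemidirectProduct.inr) SemidirectProduct.rightHom_comp_inr
  have hβr' : ∀ d, (β d).right = rN d := fun d => DFunLike.congr_fun hβr d
  let γ : Gal(Ω/K) →* Γ := Induced.evalHom (β.comp res) fun c => hβr' (res c)
  have hγ : ∀ c, γ c = (β (res c)).left.1 1 * ρ c := fun c => rfl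
  refine ⟨γ, ?_, ?_, ?_, ?_⟩
  · obtain ⟨S, hS⟩ := M.fg_of_finiteDimensional_self
    refine ⟨IntermediateField.adjoin K (S : Set Ω), IntermediateField.finiteDimensional_adjoin
      fun y _ => Algebra.IsIntegral.isIntegral y, fun τ hτ => ?_⟩
    have h1 : β (res τ) = 1 := by
      apply hM
      intro y hy
      have h2 : M ≤ IntermediateField.restrictScalars E (IntermediateField.adjoin K (S : Set Ω)) := by
        rw [← hS, IntermediateField.adjoin_le_iff]
        exact IntermediateField.subset_adjoin K _
      exact hτ y (h2 hy)
    have h3 : r τ = 1 := by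
      rw [show r τ = (β (res τ)).right from (hβr' _).symm, h1]
      rfl
    rw [hγ, h1, hr τ h3, mul_one]
    rfl
  · intro g
    obtain ⟨c, hc⟩ := hα (f g)
    have h1 : f (ρ c) = f g := by
      change f (s (α c)) = _
      rw [hfs', hc]
    obtain ⟨φ, hφ⟩ := Induced.exists_apply_one_eq (H := f.ker) hr inferInstance
      (h := g * (ρ c)⁻¹) (by rw [MonoidHom.mem_ker, map_mul, map_inv, h1, mul_inv_cancel])
    obtain ⟨d, hd⟩ := hβs ⟨φ, r c⟩
    obtain ⟨c', rfl, h2⟩ := hrange d c (by rw [← hβr', hd]; rfl)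
    refine ⟨c', ?_⟩
    have h3 : ρ c' = ρ c := congrArg s h2
    rw [hγ, hd, h3, hφ, inv_mul_cancel_right]
  · ext c
    have h1 : f ((β (res c)).left.1 1) = 1 := (β (res c)).left.2.1 1
    rw [MonoidHom.comp_apply, hγ, map_mul, h1, one_mul]
    exact hfs' _
  · intro z hz hzγ σ hσ
    have h1 : ∀ d ∈ β.ker, d z = z := fun d hd => by
      rw [MonoidHom.mem_ker] at hd
      have h2 : rN d = 1 := by rw [← hβr', hd]; rfl
      obtain ⟨c, rfl, hc⟩ := hker d h2
      refine hzγ c ?_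
      rw [MonoidHom.mem_ker, hγ, hd, hr c h2, mul_one]
      rfl
    obtain ⟨d, hd⟩ := hβs ⟨1, r σ⟩
    obtain ⟨c, rfl, hc⟩ := hrange d σ (by rw [← hβr', hd]; rfl)
    have h2 : c z = z := hzγ c (by
      have h3 : ρ c = 1 := by
        change s (α c) = 1
        rw [hc, show α σ = 1 from hσ, map_one]
      rw [MonoidHom.mem_ker, hγ, hd, h3, mul_one]
      rfl)
    have h3 := hβ z hz h1 (res (c⁻¹ * σ)) (by
      rw [MonoidHom.mem_ker, map_mul, map_mul, map_inv, map_inv, ← hβr', hd]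
      exact inv_mul_cancel (r σ))
    rw [hres, AlgEquiv.mul_apply] at h3
    have h4 := congrArg c h3
    rw [← AlgEquiv.mul_apply, mul_inv_cancel, AlgEquiv.one_apply, h2] at h4
    exact h4

theorem ringKrullDim_le_of_isIntegral_of_injective {R S : Type*} [CommRing R] [CommRing S]
    [Algebra R S] [Algebra.IsIntegral R S] (h : Function.Injective (algebraMap R S)) :
    ringKrullDim R ≤ ringKrullDim S := by
  refine iSup_le fun l => ?_
  obtain ⟨P, -, hP, hPl⟩ := Ideal.exists_ideal_over_prime_of_isIntegral (l.head).asIdeal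
    (⊥ : Ideal S) (by
      change RingHom.ker (algebraMap R S) ≤ _
      rw [(RingHom.injective_iff_ker_eq_bot _).1 h]
      exact bot_le)
  have : P.LiesOver (RelSeries.head l).asIdeal := ⟨hPl.symm⟩
  obtain ⟨L, hL, -⟩ := Ideal.exists_ltSeries_of_hasGoingUp l P
  rw [← hL]
  exact Order.LTSeries.length_le_krullDim L

theorem exists_transcendental_finiteDimensional {F K A : Type*} [Field F] [Field K] [CommRing A]
    [IsDomain A] [Algebra F A] [Algebra F K] [Algebra A K] [IsScalarTower F A K]
    [IsFractionRing A K] [Algebra.FiniteType F A] (hdim : ringKrullDim A ≤ 1) (hA : ¬IsField A) :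
    ∃ x : K, Transcendental F x ∧ FiniteDimensional (IntermediateField.adjoin F {x}) K := by
  obtain ⟨n, g, hg, hgi⟩ := exists_integral_inj_algHom_of_fg F A
  let _ : Algebra (MvPolynomial (Fin n) F) A := g.toRingHom.toAlgebra
  have : IsScalarTower F (MvPolynomial (Fin n) F) A :=
    IsScalarTower.of_algebraMap_eq fun y => (g.commutes y).symm
  have hintg : Algebra.IsIntegral (MvPolynomial (Fin n) F) A := ⟨hgi⟩
  have hn1 : n ≤ 1 := by
    have h1 := (ringKrullDim_le_of_isIntegral_of_injective (R := MvPolynomial (Fin n) F) hg).trans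
      hdim
    rw [MvPolynomial.ringKrullDim_of_isNoetherianRing, ringKrullDim_eq_zero_of_field, zero_add,
      Nat.card_fin] at h1
    exact_mod_cast h1
  have hn0 : n ≠ 0 := by
    rintro rfl
    apply hA
    apply isField_of_isIntegral_of_isField' (R := MvPolynomial (Fin 0) F)
    exact (MvPolynomial.isEmptyRingEquiv F (Fin 0)).toMulEquiv.isField (Field.toIsField F)
  obtain rfl : n = 1 := by lia
  have hAK : Function.Injective (algebraMap A K) := IsFractionRing.injective A K
  let φ : MvPolynomial (Fin 1) F →ₐ[F] K := (IsScalarTower.toAlgHom F A K).comp g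
  let x : K := φ (MvPolynomial.X 0)
  refine ⟨x, ?_, ?_⟩
  · have h1 : AlgebraicIndependent F (MvPolynomial.X : Fin 1 → MvPolynomial (Fin 1) F) :=
      MvPolynomial.algebraicIndependent_X (Fin 1) F
    exact (h1.map' (f := φ) (hAK.comp hg)).transcendental 0
  · let S := IntermediateField.adjoin F {x}
    have hφ : ∀ p, φ p ∈ S := by
      intro p
      induction p using MvPolynomial.induction_on with
      | C a =>
        rw [MvPolynomial.algHom_C]
        exact S.algebraMap_mem a
      | add p q hp hq =>
        rw [map_add]
        exact S.add_mem hp hq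
      | mul_X p i hp =>
        rw [map_mul, Subsingleton.elim i 0]
        exact S.mul_mem hp (IntermediateField.mem_adjoin_simple_self F x)
    have hi : ∀ a : A, IsIntegral S (algebraMap A K a) := by
      intro a
      obtain ⟨p, hp, hpa⟩ := hintg.isIntegral a
      refine ⟨p.map (φ.toRingHom.codRestrict S.toSubring hφ), hp.map _, ?_⟩
      rw [Polynomial.eval₂_map]
      have h2 : (algebraMap S K).comp (φ.toRingHom.codRestrict S.toSubring hφ) =
          (algebraMap A K).comp (algebraMap (MvPolynomial (Fin 1) F) A) := rfl
      rw [h2, ← Polynomial.hom_eval₂, hpa, map_zero]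
    obtain ⟨t, ht⟩ := (inferInstance : Algebra.FiniteType F A)
    let T := IntermediateField.adjoin S ((algebraMap A K) '' t)
    have hT : ∀ a : A, algebraMap A K a ∈ T := by
      intro a
      have h1 : a ∈ Algebra.adjoin F (t : Set A) := ht ▸ Algebra.mem_top
      induction h1 using Algebra.adjoin_induction with
      | mem a ha => exact IntermediateField.subset_adjoin _ _ ⟨a, ha, rfl⟩
      | algebraMap r =>
        rw [← IsScalarTower.algebraMap_apply F A K]
        exact T.algebraMap_mem (algebraMap F S r)
      | add a b _ _ ha hb => rw [map_add]; exact T.add_mem ha hb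
      | mul a b _ _ ha hb => rw [map_mul]; exact T.mul_mem ha hb
    have hTtop : T = ⊤ := by
      rw [eq_top_iff]
      intro y _
      obtain ⟨a, b, -, rfl⟩ := IsFractionRing.div_surjective (A := A) y
      exact T.div_mem (hT a) (hT b)
    have hTf : FiniteDimensional S T := by
      have : Finite ((algebraMap A K) '' (t : Set A)) := (t.finite_toSet.image _).to_subtype
      refine IntermediateField.finiteDimensional_adjoin ?_
      rintro _ ⟨a, -, rfl⟩
      exact hi a
    rw [hTtop] at hTf
    exact (IntermediateField.topEquiv (F := S) (E := K)).toLinearEquiv.finiteDimensional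

theorem SmoothProjectiveCurveData.exists_transcendental {F K : Type} [Field F] [Field K]
    [Algebra F K] (D : SmoothProjectiveCurveData F K) :
    ∃ x : K, Transcendental F x ∧ FiniteDimensional (IntermediateField.adjoin F {x}) K := by
  obtain ⟨X, hInt, f, -, hproper, hdim, e, hcompat⟩ := D
  have hne : Nonempty X := inferInstance
  have hntriv : ¬Subsingleton X := by
    intro h
    have h0 := topologicalKrullDim_zero_of_discreteTopology X
    rw [hdim] at h0
    exact absurd h0 (by norm_num)
  obtain ⟨p, hp⟩ : ∃ p : X, p ≠ genericPoint X := by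
    by_contra! h
    exact hntriv ⟨fun a b => (h a).trans (h b).symm⟩
  obtain ⟨_, ⟨U, hU, rfl⟩, hpU, -⟩ :=
    X.isBasis_affineOpens.exists_subset_of_mem_open (Set.mem_univ p) isOpen_univ
  replace hU : IsAffineOpen U := hU
  have hneU : Nonempty U := ⟨⟨p, hpU⟩⟩
  have hneT : Nonempty (⊤ : X.Opens) := ⟨⟨p, trivial⟩⟩
  have hgU : genericPoint X ∈ U :=
    ((genericPoint_spec X).mem_open_set_iff U.isOpen).mpr (by simpa using hneU)
  let A := Γ(X, U)
  let φ : CommRingCat.of F ⟶ A := (Scheme.ΓSpecIso (.of F)).inv ≫ f.appLE ⊤ U (by simp)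
  let _ : Algebra F A := φ.hom.toAlgebra
  let ψ : A →+* K := e.symm.toRingHom.comp (X.germToFunctionField U).hom
  let _ : Algebra A K := ψ.toAlgebra
  have htower : IsScalarTower F A K := by
    refine IsScalarTower.of_algebraMap_eq fun a => ?_
    change _ = e.symm ((φ ≫ X.germToFunctionField U) a)
    rw [RingEquiv.eq_symm_apply, hcompat a]
    congr 2
    simp only [φ, Scheme.Hom.appLE, Category.assoc]
    erw [X.presheaf.germ_res]
    rfl
  have hfrac : IsFractionRing A X.functionField := functionField_isFractionRing_of_isAffineOpen X U hU
  have : IsFractionRing A K := by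
    let e' : X.functionField ≃ₐ[A] K := AlgEquiv.ofRingEquiv (f := e.symm) fun _ => rfl
    exact IsLocalization.isLocalization_of_algEquiv (nonZeroDivisors A) e'
  have hft : Algebra.FiniteType F A := by
    have h1 : (f.appLE ⊤ U (by simp)).hom.FiniteType :=
      f.finiteType_appLE (isAffineOpen_top _) hU (by simp)
    have h2 : φ.hom.FiniteType := by
      rw [CommRingCat.hom_comp]
      exact h1.comp (RingHom.FiniteType.of_surjective _
        (ConcreteCategory.bijective_of_isIso (Scheme.ΓSpecIso (.of F)).inv).surjective)
    exact h2
  refine exists_transcendental_finiteDimensional (A := A) ?_ ?_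
  · rw [← PrimeSpectrum.topologicalKrullDim_eq_ringKrullDim, ← hdim]
    exact hU.fromSpec.isOpenEmbedding.isInducing.topologicalKrullDim_le
  · intro hA
    let _ := hA.toField
    have hsub : Subsingleton (Spec A) := inferInstanceAs (Subsingleton (PrimeSpectrum A))
    have hr := hU.range_fromSpec
    obtain ⟨a, ha⟩ : p ∈ Set.range hU.fromSpec := hr ▸ hpU
    obtain ⟨b, hb⟩ : genericPoint X ∈ Set.range hU.fromSpec := hr ▸ hgU
    exact hp (ha ▸ hb ▸ congrArg _ (Subsingleton.elim a b))

theorem ContinuousToDiscrete.exists_finiteDimensional {K G : Type} [Field K] [Group G]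
    {α : AbsGaloisGroup K →* G} (hα : ContinuousToDiscrete α) :
    ∃ L : IntermediateField K (AlgebraicClosure K), FiniteDimensional K L ∧
      ∀ τ : AbsGaloisGroup K, (∀ y ∈ L, τ y = y) → α τ = 1 := by
  have h : α ⁻¹' {1} ∈ nhds (1 : AbsGaloisGroup K) :=
    (hα {1}).mem_nhds (by simp)
  rw [krullTopology_mem_nhds_one_iff] at h
  obtain ⟨L, hL, hLs⟩ := h
  exact ⟨L, hL, fun τ hτ => hLs ((IntermediateField.mem_fixingSubgroup_iff L τ).2 hτ)⟩

theorem ContinuousToDiscrete.of_finiteDimensional {K Γ : Type} [Field K] [Group Γ]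
    {β : AbsGaloisGroup K →* Γ} (M : IntermediateField K (AlgebraicClosure K))
    [FiniteDimensional K M] (hM : ∀ τ : AbsGaloisGroup K, (∀ y ∈ M, τ y = y) → β τ = 1) :
    ContinuousToDiscrete β := by
  let _ : TopologicalSpace Γ := ⊥
  have : DiscreteTopology Γ := ⟨rfl⟩
  have hker : IsOpen (β.ker : Set (AbsGaloisGroup K)) :=
    Subgroup.isOpen_mono (H₁ := M.fixingSubgroup)
      (fun τ hτ => hM τ ((IntermediateField.mem_fixingSubgroup_iff M τ).1 hτ))
      (IntermediateField.fixingSubgroup_isOpen M)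
  have hcont : Continuous β := by
    refine continuous_of_continuousAt_one β ?_
    rw [ContinuousAt, map_one, nhds_discrete Γ, Filter.tendsto_pure]
    exact hker.mem_nhds (one_mem _)
  exact fun s => (isOpen_discrete s).preimage hcont

/-- (Pop; Harbater–Stevenson Theorem 4.1(a).)  Let `k̂ = k((t))` and let `X` be a smooth
projective connected curve over `k̂` with function field `K`.  Then every finite split embedding
problem for `K` has a proper solution that is regular over `k̂`. -/
theorem split_embeddingProblem_has_regular_solution_over_laurentSeries
    (k : Type) [Field k]
    (K : Type) [Field K] [Algebra (FractionRing (PowerSeries k)) K]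
    (hcurve : Nonempty (SmoothProjectiveCurveData (FractionRing (PowerSeries k)) K))
    (G Γ : Type) [Group G] [Group Γ] [Finite G] [Finite Γ]
    (α : AbsGaloisGroup K →* G) (f : Γ →* G)
    (hαc : ContinuousToDiscrete α) (hα : Function.Surjective α)
    (hf : Function.Surjective f)
    (hsplit : ∃ s : G →* Γ, f.comp s = MonoidHom.id G) :
    ∃ β : AbsGaloisGroup K →* Γ,
      ContinuousToDiscrete β ∧ Function.Surjective β ∧ f.comp β = α ∧
      RegularSolutionOver (FractionRing (PowerSeries k)) K α β := by
  obtain ⟨D⟩ := hcurve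
  obtain ⟨s, hfs⟩ := hsplit
  obtain ⟨x, hx, hxK⟩ := D.exists_transcendental
  obtain ⟨L, hLf, hL⟩ := hαc.exists_finiteDimensional
  set F := FractionRing (PowerSeries k) with hF
  let E := IntermediateField.adjoin F {x}
  let y : E := IntermediateField.AdjoinSimple.gen F x
  have hy : Transcendental F y := fun h => hx (IsAlgebraic.algebraMap (S := E) (A := K) h)
  have hyt : IntermediateField.adjoin F {y} = ⊤ := by
    apply IntermediateField.map_injective E.val
    rw [IntermediateField.adjoin_map, Set.image_singleton, ← AlgHom.fieldRange_eq_map,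
      IntermediateField.fieldRange_val]
    rfl
  obtain ⟨β, ⟨M, hMf, hM⟩, hβ, hfβ, hreg⟩ :=
    exists_regular_solution_of_finiteDimensional (k := k) (F := F) (E := E) (K := K)
      (Ω := AlgebraicClosure K) hy hyt L hL hα hfs
  refine ⟨β, ContinuousToDiscrete.of_finiteDimensional M hM, hβ, hfβ, fun z hz hzF => ?_⟩
  rw [IntermediateField.mem_fixedField_iff] at hz ⊢
  exact hreg z hzF hz
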